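/- Let F be a funnel and let m denote the minimum cardinality of a set G of vertices of F such that every point of F is seen by some vertex in G. Then every vertex-to-point conflict-free chromatic guarding of F uses at least ⌊log₂(m+3)⌋ − 3 colours; that is, if G is a set of vertices of F and χ : G → {1, …, k} is a colouring such that every point of F sees a guard whose colour is unique among the guards it sees, then k ≥ ⌊log₂(m+3)⌋ − 3. -/

import Mathlib

/-- A simple polygon: a cyclic sequence of `n ≥ 3` distinct points in the plane
(`ℝ × ℝ`) whose closed edges `[vtx i, vtx (i+1)]` (indices mod `n`) are pairwise
disjoint, except that consecutive edges share exactly their common endpoint. -/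
structure SimplePolygon where
  n : ℕ
  three_le : 3 ≤ n
  vtx : Fin n → ℝ × ℝ
  inj : Function.Injective vtx
  consec_edges : ∀ i : Fin n,
    haveI : NeZero n := ⟨by omega⟩
    segment ℝ (vtx i) (vtx (i + 1)) ∩ segment ℝ (vtx (i + 1)) (vtx (i + 1 + 1))
      = {vtx (i + 1)}
  nonconsec_edges : ∀ i j : Fin n,
    haveI : NeZero n := ⟨by omega⟩
    i ≠ j → j ≠ i + 1 → i ≠ j + 1 →
      segment ℝ (vtx i) (vtx (i + 1)) ∩ segment ℝ (vtx j) (vtx (j + 1)) = ∅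

instance (P : SimplePolygon) : NeZero P.n := ⟨by have := P.three_le; omega⟩

namespace SimplePolygon

/-- The boundary of the polygon: the union of its edges. -/
def boundary (P : SimplePolygon) : Set (ℝ × ℝ) :=
  ⋃ i : Fin P.n, segment ℝ (P.vtx i) (P.vtx (i + 1))

/-- The polygon as a point set: its boundary together with the union of all
bounded connected components of the complement of the boundary. -/
def region (P : SimplePolygon) : Set (ℝ × ℝ) :=
  P.boundary ∪
    {p | p ∉ P.boundary ∧ Bornology.IsBounded (connectedComponentIn P.boundaryᶜ p)}

/-- `p` sees `q` if the closed segment between them lies in the polygon. -/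
def Sees (P : SimplePolygon) (p q : ℝ × ℝ) : Prop :=
  segment ℝ p q ⊆ P.region

/-- The planar cross product of two vectors. -/
def cross2 (a b : ℝ × ℝ) : ℝ := a.1 * b.2 - a.2 * b.1

/-- Counterclockwise orientation: positive shoelace signed area. -/
def Ccw (P : SimplePolygon) : Prop :=
  0 < ∑ i : Fin P.n, cross2 (P.vtx i) (P.vtx (i + 1))

/-- A vertex is convex if the cross product of the incoming and the outgoing
edge vectors is positive (for a counterclockwise-oriented polygon). -/
def ConvexVtx (P : SimplePolygon) (i : Fin P.n) : Prop :=
  0 < cross2 (P.vtx i - P.vtx (i - 1)) (P.vtx (i + 1) - P.vtx i)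

/-- A funnel: a counterclockwise-oriented simple polygon with exactly three
convex vertices, two of which (the endpoints of the base edge) are adjacent;
the third convex vertex is the apex. -/
def IsFunnel (P : SimplePolygon) : Prop :=
  P.Ccw ∧ ∃ b c : Fin P.n, c ≠ b ∧ c ≠ b + 1 ∧
    {i : Fin P.n | P.ConvexVtx i} = {b, b + 1, c}

/-- `G` is a set of vertices of `P` such that every point of `P` is seen by
some vertex in `G`. -/
def GuardsAll (P : SimplePolygon) (G : Finset (ℝ × ℝ)) : Prop :=
  ↑G ⊆ Set.range P.vtx ∧ ∀ p ∈ P.region, ∃ g ∈ G, P.Sees g p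

/-- A vertex-to-point conflict-free chromatic guarding of `P` with `k` colours:
a set `G` of vertices of `P` together with a colouring `χ` (only its values on
`G` matter) such that every point of `P` sees at least one guard whose colour
is unique among the guards that this point sees. -/
def IsCFGuardV2P (P : SimplePolygon) (G : Finset (ℝ × ℝ)) (k : ℕ)
    (χ : ℝ × ℝ → Fin k) : Prop :=
  ↑G ⊆ Set.range P.vtx ∧
  ∀ p ∈ P.region, ∃ g ∈ G, P.Sees g p ∧
    ∀ h ∈ G, h ≠ g → P.Sees h p → χ h ≠ χ g

/-- A vertex-to-vertex conflict-free chromatic guarding of `P` with `k`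
colours: every vertex of `P` sees at least one guard whose colour is unique
among the guards that this vertex sees. -/
def IsCFGuardV2V (P : SimplePolygon) (G : Finset (ℝ × ℝ)) (k : ℕ)
    (χ : ℝ × ℝ → Fin k) : Prop :=
  ↑G ⊆ Set.range P.vtx ∧
  ∀ i : Fin P.n, ∃ g ∈ G, P.Sees g (P.vtx i) ∧
    ∀ h ∈ G, h ≠ g → P.Sees h (P.vtx i) → χ h ≠ χ g

end SimplePolygon


namespace FunnelLB

/-- Coordinates of a funnel: left chain `(xl i, yl i)`, `i ≤ a`, right chain `(xr j, yr j)`. -/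
structure FD where
  a : ℕ
  b : ℕ
  ha : 0 < a
  hb : 0 < b
  h : ℝ
  yl : ℕ → ℝ
  xl : ℕ → ℝ
  sl : ℕ → ℝ
  yr : ℕ → ℝ
  xr : ℕ → ℝ
  sr : ℕ → ℝ
  f : ℝ → ℝ
  g : ℝ → ℝ
  yl0 : yl 0 = 0
  yla : yl a = h
  ylm : ∀ i < a, yl i < yl (i + 1)
  slm : ∀ i, i + 1 < a → sl (i + 1) ≤ sl i
  xls : ∀ i < a, xl (i + 1) = xl i + sl i * (yl (i + 1) - yl i)
  f_le : ∀ i < a, ∀ y, 0 ≤ y → y ≤ h → f y ≤ xl i + sl i * (y - yl i)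
  f_eq : ∀ i < a, ∀ y, yl i ≤ y → y ≤ yl (i + 1) → f y = xl i + sl i * (y - yl i)
  yr0 : yr 0 = 0
  yrb : yr b = h
  yrm : ∀ i < b, yr i < yr (i + 1)
  srm : ∀ i, i + 1 < b → sr i ≤ sr (i + 1)
  xrs : ∀ i < b, xr (i + 1) = xr i + sr i * (yr (i + 1) - yr i)
  g_ge : ∀ i < b, ∀ y, 0 ≤ y → y ≤ h → xr i + sr i * (y - yr i) ≤ g y
  g_eq : ∀ i < b, ∀ y, yr i ≤ y → y ≤ yr (i + 1) → g y = xr i + sr i * (y - yr i)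
  fg : ∀ y, 0 ≤ y → y < h → f y < g y
  fgh : f h = g h
  slope : ∀ i < a, ∀ j < b, sr j ≤ sl i

namespace FD

variable (F : FD)

/-- Mirror image. -/
def mirror : FD where
  a := F.b
  b := F.a
  ha := F.hb
  hb := F.ha
  h := F.h
  yl := F.yr
  xl := fun i => - F.xr i
  sl := fun i => - F.sr i
  yr := F.yl
  xr := fun i => - F.xl i
  sr := fun i => - F.sl i
  f := fun y => - F.g y
  g := fun y => - F.f y
  yl0 := F.yr0
  yla := F.yrb
  ylm := F.yrm
  slm := fun i hi => by have := F.srm i hi; linarith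
  xls := fun i hi => by have := F.xrs i hi; linarith
  f_le := fun i hi y h0 h1 => by have := F.g_ge i hi y h0 h1; linarith
  f_eq := fun i hi y h0 h1 => by have := F.g_eq i hi y h0 h1; linarith
  yr0 := F.yl0
  yrb := F.yla
  yrm := F.ylm
  srm := fun i hi => by have := F.slm i hi; linarith
  xrs := fun i hi => by have := F.xls i hi; linarith
  g_ge := fun i hi y h0 h1 => by have := F.f_le i hi y h0 h1; linarith
  g_eq := fun i hi y h0 h1 => by have := F.f_eq i hi y h0 h1; linarith
  fg := fun y h0 h1 => by have := F.fg y h0 h1; linarith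
  fgh := by have := F.fgh; linarith
  slope := fun i hi j hj => by have := F.slope j hj i hi; linarith

/-- Line of the left edge `i`. -/
def L (i : ℕ) (y : ℝ) : ℝ := F.xl i + F.sl i * (y - F.yl i)

/-- Line of the right edge `j`. -/
def M (j : ℕ) (y : ℝ) : ℝ := F.xr j + F.sr j * (y - F.yr j)

lemma mirror_L (j : ℕ) (y : ℝ) : F.mirror.L j y = - F.M j y := by
  simp only [L, M, mirror]; ring

lemma mirror_M (j : ℕ) (y : ℝ) : F.mirror.M j y = - F.L j y := by
  simp only [L, M, mirror]; ring

/-- The funnel region. -/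
def R : Set (ℝ × ℝ) := {p | 0 ≤ p.2 ∧ p.2 ≤ F.h ∧ F.f p.2 ≤ p.1 ∧ p.1 ≤ F.g p.2}

lemma mem_R {p : ℝ × ℝ} :
    p ∈ F.R ↔ 0 ≤ p.2 ∧ p.2 ≤ F.h ∧ F.f p.2 ≤ p.1 ∧ p.1 ≤ F.g p.2 := Iff.rfl

/-- Mirror a point. -/
def mp (p : ℝ × ℝ) : ℝ × ℝ := (-p.1, p.2)

lemma mem_R_mirror {p : ℝ × ℝ} : mp p ∈ F.mirror.R ↔ p ∈ F.R := by
  simp only [mem_R, mp, mirror, neg_le_neg_iff]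
  tauto

/-- Visibility in the region. -/
def See (p q : ℝ × ℝ) : Prop := segment ℝ p q ⊆ F.R

lemma see_symm {p q : ℝ × ℝ} (h : F.See p q) : F.See q p := by
  unfold See at *; rwa [segment_symm]

lemma See_mirror {p q : ℝ × ℝ} (h : F.mirror.See (mp p) (mp q)) : F.See p q := by
  intro z hz
  rw [← mem_R_mirror]
  apply h
  obtain ⟨s, t, hs, ht, hst, rfl⟩ := hz
  exact ⟨s, t, hs, ht, hst, by ext <;> simp [mp]; ring⟩

lemma mp_mp (p : ℝ × ℝ) : mp (mp p) = p := by simp [mp]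

lemma mirror_mirror : F.mirror.mirror = F := by
  cases F; simp [mirror]

lemma See_mirror_iff {p q : ℝ × ℝ} : F.mirror.See (mp p) (mp q) ↔ F.See p q := by
  refine ⟨F.See_mirror, fun h => ?_⟩
  apply F.mirror.See_mirror
  rw [mirror_mirror, mp_mp, mp_mp]; exact h

/-- Strictly above the upper shadow of the left vertex `i`. -/
def UL (i : ℕ) (p : ℝ × ℝ) : Prop := p ∈ F.R ∧ F.yl i < p.2 ∧ p.1 < F.L i p.2

/-- Strictly above the upper shadow of the right vertex `j`. -/
def UR (j : ℕ) (p : ℝ × ℝ) : Prop := p ∈ F.R ∧ F.yr j < p.2 ∧ F.M j p.2 < p.1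

lemma mirror_UL {j : ℕ} {p : ℝ × ℝ} : F.mirror.UL j (mp p) ↔ F.UR j p := by
  simp only [UL, UR, mem_R_mirror, mirror_L]
  simp [mp, mirror]

lemma mirror_UR {j : ℕ} {p : ℝ × ℝ} : F.mirror.UR j (mp p) ↔ F.UL j p := by
  simp only [UL, UR, mem_R_mirror, mirror_M]
  simp [mp, mirror]

/-- left vertex -/
def l (i : ℕ) : ℝ × ℝ := (F.xl i, F.yl i)
/-- right vertex -/
def r (i : ℕ) : ℝ × ℝ := (F.xr i, F.yr i)

lemma mirror_l (i : ℕ) : F.mirror.l i = mp (F.r i) := by simp [l, r, mp, mirror]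
lemma mirror_r (i : ℕ) : F.mirror.r i = mp (F.l i) := by simp [l, r, mp, mirror]

lemma yl_lt {i j : ℕ} (hij : i < j) (hj : j ≤ F.a) : F.yl i < F.yl j := by
  induction j with
  | zero => omega
  | succ k ih =>
    have h1 := F.ylm k (by omega)
    rcases Nat.lt_or_ge i k with h | h
    · exact (ih h (by omega)).trans h1
    · have : i = k := by omega
      rwa [this]

lemma yl_le {i j : ℕ} (hij : i ≤ j) (hj : j ≤ F.a) : F.yl i ≤ F.yl j := by
  rcases Nat.lt_or_ge i j with h | h
  · exact (F.yl_lt h hj).le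
  · rw [show i = j by omega]

lemma yr_lt {i j : ℕ} (hij : i < j) (hj : j ≤ F.b) : F.yr i < F.yr j := F.mirror.yl_lt hij hj
lemma yr_le {i j : ℕ} (hij : i ≤ j) (hj : j ≤ F.b) : F.yr i ≤ F.yr j := F.mirror.yl_le hij hj

lemma yl_nonneg {i : ℕ} (hi : i ≤ F.a) : 0 ≤ F.yl i := by
  rw [← F.yl0]; exact F.yl_le (Nat.zero_le _) hi

lemma yl_le_h {i : ℕ} (hi : i ≤ F.a) : F.yl i ≤ F.h := by
  rw [← F.yla]; exact F.yl_le hi le_rfl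

lemma sl_anti {i j : ℕ} (hij : i ≤ j) (hj : j < F.a) : F.sl j ≤ F.sl i := by
  induction j with
  | zero => rw [show i = 0 by omega]
  | succ k ih =>
    rcases Nat.lt_or_ge i (k + 1) with h | h
    · exact (F.slm k hj).trans (ih (by omega) (by omega))
    · rw [show i = k + 1 by omega]

lemma L_at (i : ℕ) : F.L i (F.yl i) = F.xl i := by simp [L]

lemma L_at_succ {i : ℕ} (hi : i < F.a) : F.L i (F.yl (i + 1)) = F.xl (i + 1) := by
  rw [F.xls i hi, L]

lemma L_sub (i : ℕ) (y z : ℝ) : F.L i y = F.L i z + F.sl i * (y - z) := by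
  simp only [L]; ring

lemma L_le_above {i j : ℕ} (hij : i ≤ j) (hj : j < F.a) {y : ℝ} (hy : F.yl j ≤ y) :
    F.L j y ≤ F.L i y := by
  induction j with
  | zero => rw [show i = 0 by omega]
  | succ k ih =>
    rcases Nat.lt_or_ge i (k + 1) with h | h
    · refine le_trans ?_ (ih (by omega) (by omega) ((F.yl_le (by omega) (by omega)).trans hy))
      rw [F.L_sub k y (F.yl (k + 1)), F.L_at_succ (by omega), F.L_sub (k + 1) y (F.yl (k + 1)), L_at]
      have := F.slm k hj
      nlinarith
    · rw [show i = k + 1 by omega]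

lemma L_le_below {i j : ℕ} (hij : i ≤ j) (hj : j < F.a) {y : ℝ} (hy : y ≤ F.yl (i + 1)) :
    F.L i y ≤ F.L j y := by
  induction j with
  | zero => rw [show i = 0 by omega]
  | succ k ih =>
    rcases Nat.lt_or_ge i (k + 1) with h | h
    · refine le_trans (ih (by omega) (by omega)) ?_
      rw [F.L_sub k y (F.yl (k + 1)), F.L_at_succ (by omega), F.L_sub (k + 1) y (F.yl (k + 1)), L_at]
      have := F.slm k hj
      have := F.yl_le (show i + 1 ≤ k + 1 by omega) (by omega)
      nlinarith
    · rw [show i = k + 1 by omega]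

lemma f_le_L {i : ℕ} (hi : i < F.a) {y : ℝ} (h0 : 0 ≤ y) (h1 : y ≤ F.h) : F.f y ≤ F.L i y :=
  F.f_le i hi y h0 h1

lemma f_eq_L {i : ℕ} (hi : i < F.a) {y : ℝ} (h0 : F.yl i ≤ y) (h1 : y ≤ F.yl (i + 1)) :
    F.f y = F.L i y := F.f_eq i hi y h0 h1

lemma f_at {i : ℕ} (hi : i ≤ F.a) : F.f (F.yl i) = F.xl i := by
  rcases Nat.lt_or_ge i F.a with h | h
  · rw [F.f_eq_L h le_rfl (F.ylm i h).le, L_at]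
  · obtain ⟨k, rfl⟩ : ∃ k, i = k + 1 := ⟨i - 1, by have := F.ha; omega⟩
    rw [F.f_eq_L (show k < F.a by omega) (F.ylm k (by omega)).le le_rfl, L_at_succ _ (by omega)]

lemma g_at {i : ℕ} (hi : i ≤ F.b) : F.g (F.yr i) = F.xr i := by
  have := F.mirror.f_at hi
  simp only [mirror] at this; linarith

lemma cover {y : ℝ} {i0 : ℕ} (hi0 : i0 < F.a) (h0 : F.yl i0 ≤ y) (h1 : y ≤ F.h) :
    ∃ i, i0 ≤ i ∧ i < F.a ∧ F.yl i ≤ y ∧ y ≤ F.yl (i + 1) := by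
  by_contra hcon
  push Not at hcon
  have : ∀ i, i0 ≤ i → i ≤ F.a → F.yl i ≤ y ∧ (i < F.a → F.yl (i + 1) < y) := by
    intro i hi
    induction i, hi using Nat.le_induction with
    | base => exact fun _ => ⟨h0, fun hh => hcon i0 le_rfl hh h0⟩
    | succ k hk ih =>
      intro hka
      have := (ih (by omega)).2 (by omega)
      exact ⟨this.le, fun hh => hcon (k + 1) (by omega) hh this.le⟩
  have h2 := (this (F.a - 1) (by omega) (by omega)).2 (by omega)
  rw [show F.a - 1 + 1 = F.a by omega, F.yla] at h2
  linarith

lemma f_slope {j : ℕ} (hj : j < F.b) {y z : ℝ} (h0 : 0 ≤ y) (hyz : y ≤ z) (hz : z ≤ F.h) :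
    F.sr j * (z - y) ≤ F.f z - F.f y := by
  obtain ⟨i, -, hi, h2, h3⟩ := F.cover (i0 := 0) F.ha (by rw [F.yl0]; linarith : F.yl 0 ≤ z) hz
  have h4 := F.f_eq_L hi h2 h3
  have h5 := F.f_le_L hi h0 (hyz.trans hz)
  have h6 := F.L_sub i z y
  have h7 := F.slope i hi j hj
  nlinarith

lemma g_slope {i : ℕ} (hi : i < F.a) {y z : ℝ} (h0 : 0 ≤ y) (hyz : y ≤ z) (hz : z ≤ F.h) :
    F.g z - F.g y ≤ F.sl i * (z - y) := by
  have := F.mirror.f_slope hi h0 hyz hz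
  simp only [mirror] at this; linarith

lemma f_le_g {y : ℝ} (h0 : 0 ≤ y) (h1 : y ≤ F.h) : F.f y ≤ F.g y := by
  rcases h1.lt_or_eq with h | h
  · exact (F.fg y h0 h).le
  · rw [h, F.fgh]

lemma l_mem {i : ℕ} (hi : i ≤ F.a) : F.l i ∈ F.R := by
  have h1 := F.yl_nonneg hi
  have h2 := F.yl_le_h hi
  have h3 := F.f_at hi
  have h4 := F.f_le_g h1 h2
  refine ⟨h1, h2, ?_, ?_⟩ <;> simp only [l] <;> linarith

lemma r_mem {i : ℕ} (hi : i ≤ F.b) : F.r i ∈ F.R := by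
  rw [← mem_R_mirror, ← mirror_l]; exact F.mirror.l_mem hi

lemma apex_eq : F.l F.a = F.r F.b := by
  have h1 := F.f_at le_rfl
  have h2 := F.g_at le_rfl
  rw [F.yla] at h1; rw [F.yrb] at h2
  simp only [l, r, F.yla, F.yrb, ← h1, ← h2, F.fgh]

/-- Sufficient criterion for visibility. -/
lemma see_of {p q : ℝ × ℝ} (hp : p ∈ F.R) (hq : q ∈ F.R) (hpq : p.2 ≤ q.2)
    (s₁ c₁ s₂ c₂ : ℝ) (h₁ : ∀ y, p.2 ≤ y → y ≤ q.2 → F.f y ≤ c₁ + s₁ * y)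
    (h₁p : c₁ + s₁ * p.2 ≤ p.1) (h₁q : c₁ + s₁ * q.2 ≤ q.1)
    (h₂ : ∀ y, p.2 ≤ y → y ≤ q.2 → c₂ + s₂ * y ≤ F.g y)
    (h₂p : p.1 ≤ c₂ + s₂ * p.2) (h₂q : q.1 ≤ c₂ + s₂ * q.2) : F.See p q := by
  rintro z ⟨s, t, hs, ht, hst, rfl⟩
  obtain rfl : s = 1 - t := by linarith
  obtain ⟨hp0, hp1, -, -⟩ := hp
  obtain ⟨hq0, hq1, -, -⟩ := hq
  have e1 : ((1 - t) • p + t • q).1 = (1 - t) * p.1 + t * q.1 := by simp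
  have e2 : ((1 - t) • p + t • q).2 = (1 - t) * p.2 + t * q.2 := by simp
  rw [mem_R, e1, e2]
  have a1 : p.2 ≤ (1 - t) * p.2 + t * q.2 := by nlinarith
  have a2 : (1 - t) * p.2 + t * q.2 ≤ q.2 := by nlinarith
  refine ⟨by linarith, by linarith, ?_, ?_⟩
  · have := h₁ _ a1 a2
    nlinarith [mul_le_mul_of_nonneg_left h₁p hs, mul_le_mul_of_nonneg_left h₁q ht]
  · have := h₂ _ a1 a2
    nlinarith [mul_le_mul_of_nonneg_left h₂p hs, mul_le_mul_of_nonneg_left h₂q ht]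

/-- A left vertex sees every point above it which is not above its shadow. -/
lemma see_up {i : ℕ} (hi : i < F.a) {p : ℝ × ℝ} (hp : p ∈ F.R) (h1 : F.yl i ≤ p.2)
    (h2 : F.L i p.2 ≤ p.1) : F.See (F.l i) p := by
  refine F.see_of (F.l_mem hi.le) hp h1 (F.sl i) (F.xl i - F.sl i * F.yl i) (F.sl i)
    (p.1 - F.sl i * p.2) ?_ ?_ ?_ ?_ ?_ ?_
  · intro y h3 h4
    have := F.f_le_L hi ((F.l_mem hi.le).1.trans h3) (h4.trans hp.2.1)
    simp only [L] at this; linarith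
  · simp [l]
  · simp only [L] at h2; linarith
  · intro y h3 h4
    have := F.g_slope hi ((F.l_mem hi.le).1.trans h3) h4 hp.2.1
    have := hp.2.2.2
    linarith
  · simp only [l, L] at *; linarith
  · linarith

/-- A point `p` of the line of the left edge `i`, below its upper end, does not see points
above the shadow. -/
lemma not_see {i : ℕ} (hi : i < F.a) {p q : ℝ × ℝ} (hp : p.1 = F.L i p.2)
    (hpy : p.2 < F.yl (i + 1)) (hq : F.UL i q) : ¬ F.See p q := by
  intro hs
  obtain ⟨hqR, hq1, hq2⟩ := hq
  have hqy : F.yl (i + 1) < q.2 := by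
    by_contra hcon
    have := F.f_eq_L hi hq1.le (not_lt.mp hcon)
    have := hqR.2.2.1
    linarith
  have hd : 0 < q.2 - p.2 := by linarith
  set t := (F.yl (i + 1) - p.2) / (q.2 - p.2) with ht
  have ht0 : 0 < t := div_pos (by linarith) hd
  have ht1 : t ≤ 1 := by rw [ht, div_le_one hd]; linarith
  have hty : t * (q.2 - p.2) = F.yl (i + 1) - p.2 := by rw [ht]; field_simp
  have hz : (1 - t) • p + t • q ∈ F.R := hs ⟨1 - t, t, by linarith, ht0.le, by ring, rfl⟩
  have e1 : ((1 - t) • p + t • q).1 = (1 - t) * p.1 + t * q.1 := by simp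
  have e2 : ((1 - t) • p + t • q).2 = F.yl (i + 1) := by simp; linarith
  have h3 := hz.2.2.1
  rw [e1, e2, F.f_at hi, ← F.L_at_succ hi, hp] at h3
  have h4 := F.L_sub i (F.yl (i + 1)) p.2
  have h5 := F.L_sub i q.2 p.2
  have h6 : t * (F.L i q.2) = t * F.L i p.2 + F.sl i * (F.yl (i + 1) - p.2) := by
    rw [h5, ← hty]; ring
  nlinarith [mul_lt_mul_of_pos_left hq2 ht0]

lemma not_see_l {i : ℕ} (hi : i < F.a) {q : ℝ × ℝ} (hq : F.UL i q) : ¬ F.See (F.l i) q :=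
  F.not_see hi (by simp [l, L]) (F.ylm i hi) hq

lemma not_see_r {j : ℕ} (hj : j < F.b) {q : ℝ × ℝ} (hq : F.UR j q) : ¬ F.See (F.r j) q := by
  rw [← See_mirror_iff, ← mirror_l]
  exact F.mirror.not_see_l hj (F.mirror_UL.2 hq)

lemma see_up_l {i : ℕ} (hi : i < F.a) {p : ℝ × ℝ} (hp : p ∈ F.R) (h1 : F.yl i ≤ p.2)
    (h2 : ¬ F.UL i p) : F.See (F.l i) p := by
  apply F.see_up hi hp h1
  by_contra hcon
  rcases h1.lt_or_eq with h | h
  · exact h2 ⟨hp, h, not_le.mp hcon⟩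
  · rw [← h, L_at] at hcon
    have := hp.2.2.1
    rw [← h, F.f_at hi.le] at this
    exact hcon this

lemma see_up_r {j : ℕ} (hj : j < F.b) {p : ℝ × ℝ} (hp : p ∈ F.R) (h1 : F.yr j ≤ p.2)
    (h2 : ¬ F.UR j p) : F.See (F.r j) p := by
  rw [← See_mirror_iff, ← mirror_l]
  exact F.mirror.see_up_l hj (F.mem_R_mirror.2 hp) h1 (fun h => h2 (F.mirror_UL.1 h))

/-- `L i` stays in the funnel below its upper end. -/
lemma L_le_g {i : ℕ} (hi : i < F.a) {y : ℝ} (h0 : 0 ≤ y) (h1 : y ≤ F.yl (i + 1)) :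
    F.L i y ≤ F.g y := by
  have h2 := F.g_slope hi h0 h1 (F.yl_le_h hi)
  have h3 := F.l_mem (i := i + 1) hi
  have h4 := h3.2.2.2
  simp only [l] at h4
  rw [← F.L_at_succ hi] at h4
  have := F.L_sub i (F.yl (i + 1)) y
  linarith

/-- On the chord `L i`: sees all lower left vertices, if not above their shadow. -/
lemma chord_see_l {i k : ℕ} (hi : i < F.a) (hk : k ≤ i) {p : ℝ × ℝ} (hp : p ∈ F.R)
    (hpL : p.1 = F.L i p.2) (h2 : ¬ F.UL k p) : F.See (F.l k) p := by
  rcases le_total (F.yl k) p.2 with h | h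
  · exact F.see_up_l (by omega) hp h h2
  · apply F.see_symm
    have hka : k < F.a := by omega
    refine F.see_of hp (F.l_mem hka.le) h (F.sl k) (F.xl k - F.sl k * F.yl k) (F.sl i)
      (F.xl i - F.sl i * F.yl i) ?_ ?_ ?_ ?_ ?_ ?_
    · intro y h3 h4
      have := F.f_le_L hka (hp.1.trans h3) (h4.trans (F.yl_le_h hka.le))
      simp only [L] at this; linarith
    · have := F.L_le_below hk hi (y := p.2) (h.trans (F.ylm k hka).le)
      rw [hpL]
      simp only [L] at this ⊢; linarith
    · simp [l]
    · intro y h3 h4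
      have := F.L_le_g hi (hp.1.trans h3) (h4.trans (F.yl_le (by omega) (by omega)))
      simp only [L] at this; linarith
    · rw [hpL, L]; linarith
    · have := F.f_le_L hi (F.yl_nonneg hka.le) (F.yl_le_h hka.le)
      rw [F.f_at hka.le, L] at this
      simp only [l]; linarith

lemma chord_see_r {i j : ℕ} (hi : i < F.a) (hj : j < F.b) {p : ℝ × ℝ} (hp : p ∈ F.R)
    (hpL : p.1 = F.L i p.2) (h2 : ¬ F.UR j p) (h3 : ¬ F.UL i (F.r j)) : F.See (F.r j) p := by
  rcases le_total (F.yr j) p.2 with h | h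
  · exact F.see_up_r hj hp h h2
  · apply F.see_symm
    have hr := F.r_mem hj.le
    have key : F.L i (F.yr j) ≤ F.xr j := by
      by_contra hcon
      rcases le_or_gt (F.yr j) (F.yl i) with h4 | h4
      · have := F.L_le_g hi hr.1 (h4.trans (F.ylm i hi).le)
        simp only [r] at this
        rw [F.g_at hj.le] at this
        exact hcon this
      · exact h3 ⟨hr, h4, not_le.mp hcon⟩
    refine F.see_of hp hr h (F.sl i) (F.xl i - F.sl i * F.yl i) (F.sl i)
      (F.xr j - F.sl i * F.yr j) ?_ ?_ ?_ ?_ ?_ ?_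
    · intro y h3 h4
      have := F.f_le_L hi (hp.1.trans h3) (h4.trans hr.2.1)
      simp only [L] at this; linarith
    · rw [hpL, L]; linarith
    · simp only [L] at key; simp only [r]; linarith
    · intro y h3 h4
      have := F.g_slope hi (hp.1.trans h3) h4 hr.2.1
      simp only [r] at this
      rw [F.g_at hj.le] at this
      linarith
    · rw [hpL]; simp only [L] at key ⊢; linarith
    · simp [r]

/-- If a left vertex is not above the shadow of `r j` but the lower point `p` is, then they
see each other. -/
lemma see_down {i j : ℕ} (hi : i < F.a) (hj : j < F.b) {p : ℝ × ℝ} (hp : F.UR j p)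
    (h1 : p.2 < F.yl i) (h2 : ¬ F.UR j (F.l i)) : F.See (F.l i) p := by
  obtain ⟨hpR, hpy, hpx⟩ := hp
  have hl := F.l_mem hi.le
  have key : F.xl i ≤ F.M j (F.yl i) := by
    by_contra hcon
    exact h2 ⟨hl, hpy.trans h1, not_le.mp hcon⟩
  obtain ⟨k, rfl⟩ : ∃ k, i = k + 1 := by
    refine ⟨i - 1, ?_⟩
    rcases Nat.eq_zero_or_pos i with h | h
    · subst h; rw [F.yl0] at h1; linarith [hpR.1]
    · omega
  have hk : k < F.a := by omega
  have hs := F.slope k hk j hj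
  have eM : F.M j (F.yl (k + 1)) = F.M j p.2 + F.sr j * (F.yl (k + 1) - p.2) := by
    simp only [M]; ring
  apply F.see_symm
  refine F.see_of hpR hl h1.le (F.sl k) (F.xl k - F.sl k * F.yl k) (F.sr j)
      (p.1 - F.sr j * p.2) ?_ ?_ ?_ ?_ ?_ ?_
  · intro y h3 h4
    have := F.f_le_L hk (hpR.1.trans h3) (h4.trans hl.2.1)
    simp only [L] at this; linarith
  · have e1 := F.L_at_succ hk
    have e2 := F.L_sub k (F.yl (k + 1)) p.2
    have : F.L k p.2 ≤ p.1 := by nlinarith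
    simp only [L] at this; linarith
  · have := F.L_at_succ hk
    simp only [L] at this; simp only [l]; linarith
  · intro y h3 h4
    obtain ⟨j', hj', hj'b, h5, h6⟩ := F.mirror.cover hj hpy.le hpR.2.1
    have h5' : F.yr j' ≤ p.2 := h5
    have h6' : p.2 ≤ F.yr (j' + 1) := h6
    have e1 := F.g_eq j' hj'b p.2 h5' h6'
    have e2 := F.g_ge j' hj'b y (hpR.1.trans h3) (h4.trans hl.2.1)
    have e3 : F.sr j ≤ F.sr j' := by
      have := F.mirror.sl_anti hj' hj'b
      simp only [mirror] at this; linarith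
    have := hpR.2.2.2
    nlinarith
  · linarith
  · simp only [l]; linarith

lemma UL_mono {i k : ℕ} (hik : i ≤ k) (hk : k < F.a) {p : ℝ × ℝ} (h : F.UL k p) : F.UL i p :=
  ⟨h.1, (F.yl_le hik hk.le).trans_lt h.2.1, h.2.2.trans_le (F.L_le_above hik hk h.2.1.le)⟩

lemma UR_mono {i k : ℕ} (hik : i ≤ k) (hk : k < F.b) {p : ℝ × ℝ} (h : F.UR k p) : F.UR i p :=
  F.mirror_UL.1 (F.mirror.UL_mono hik hk (F.mirror_UL.2 h))

/-- Everything above a right vertex in `UL i` is in `UL i`. -/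
lemma UL_of_r {i j : ℕ} (hi : i < F.a) (hj : j ≤ F.b) (h : F.UL i (F.r j)) {p : ℝ × ℝ}
    (hp : p ∈ F.R) (hpy : F.yr j ≤ p.2) : F.UL i p := by
  obtain ⟨h1, h2, h3⟩ := h
  refine ⟨hp, h2.trans_le hpy, ?_⟩
  have h4 := F.g_slope hi h1.1 hpy hp.2.1
  simp only [r] at h3 h4
  rw [F.g_at hj] at h4
  have := F.L_sub i p.2 (F.yr j)
  have := hp.2.2.2
  linarith

lemma UR_of_l {i j : ℕ} (hj : j < F.b) (hi : i ≤ F.a) (h : F.UR j (F.l i)) {p : ℝ × ℝ}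
    (hp : p ∈ F.R) (hpy : F.yl i ≤ p.2) : F.UR j p := by
  rw [← mirror_UL] at h ⊢
  rw [← mirror_r] at h
  exact F.mirror.UL_of_r hj hi h (F.mem_R_mirror.2 hp) hpy

/-- points in `UL i` are above `l (i+1)` -/
lemma UL_height {i : ℕ} (hi : i < F.a) {p : ℝ × ℝ} (h : F.UL i p) : F.yl (i + 1) < p.2 := by
  by_contra hcon
  have := F.f_eq_L hi h.2.1.le (not_lt.mp hcon)
  linarith [h.1.2.2.1, h.2.2]

lemma UR_height {i : ℕ} (hi : i < F.b) {p : ℝ × ℝ} (h : F.UR i p) : F.yr (i + 1) < p.2 :=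
  F.mirror.UL_height (p := mp p) hi (F.mirror_UL.2 h)

lemma UL_apex {i : ℕ} (hi : i < F.a) {p : ℝ × ℝ} (h : F.UL i p) : F.UL i (F.l F.a) := by
  obtain ⟨h1, h2, h3⟩ := h
  have hh : F.yl i < F.h := h2.trans_le h1.2.1
  obtain ⟨k, hik, hk, h4, h5⟩ := F.cover hi h2.le h1.2.1
  refine ⟨F.l_mem le_rfl, by simpa [l, F.yla] using hh, ?_⟩
  have e1 := F.f_eq_L hk h4 h5
  have e2 := F.f_le_L hk (y := F.h) (h1.1.trans h1.2.1) le_rfl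
  have e3 := F.f_at (i := F.a) le_rfl
  rw [F.yla] at e3
  simp only [l, F.yla]
  have e4 := F.L_sub k F.h p.2
  have e5 := F.L_sub i F.h p.2
  have e6 := F.sl_anti hik hk
  have e7 := h1.2.2.1
  nlinarith [h1.2.1]

lemma UR_apex {i : ℕ} (hi : i < F.b) {p : ℝ × ℝ} (h : F.UR i p) : F.UR i (F.r F.b) := by
  have := F.mirror.UL_apex hi (F.mirror_UL.2 h)
  rw [mirror_l] at this
  exact F.mirror_UL.1 this

end FD
end FunnelLB


namespace FunnelLB
namespace FD

variable (F : FD)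

open Classical in
/-- Greatest index with a property. -/
noncomputable def fgr (P : ℕ → Prop) (n : ℕ) : ℕ := Nat.findGreatest P n

lemma fgr_le (P : ℕ → Prop) (n : ℕ) : fgr P n ≤ n := by
  classical exact Nat.findGreatest_le _

/-- Greedy indices of shadows. -/
noncomputable def st : ℕ → ℕ × ℕ
  | 0 => (0, 0)
  | t + 1 =>
    (fgr (fun i => ¬ (F.UL (st t).1 (F.l i) ∧ F.UR (st t).2 (F.l i))) (F.a - 1),
     fgr (fun j => ¬ (F.UL (st t).1 (F.r j) ∧ F.UR (st t).2 (F.r j))) (F.b - 1))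

/-- left greedy index -/
noncomputable def I (t : ℕ) : ℕ := (F.st t).1
/-- right greedy index -/
noncomputable def J (t : ℕ) : ℕ := (F.st t).2

/-- The part of the funnel above both shadows. -/
def V (t : ℕ) (p : ℝ × ℝ) : Prop := F.UL (F.I t) p ∧ F.UR (F.J t) p

lemma mirror_st (t : ℕ) : F.mirror.st t = (F.st t).swap := by
  induction t with
  | zero => rfl
  | succ t ih =>
    have h1 : ∀ p, (F.mirror.UL (F.mirror.st t).1 (mp p) ∧ F.mirror.UR (F.mirror.st t).2 (mp p)) ↔
        (F.UL (F.st t).1 p ∧ F.UR (F.st t).2 p) := by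
      intro p; rw [ih, mirror_UL, mirror_UR, and_comm]; rfl
    simp only [st, Prod.swap, mirror_l, mirror_r, h1]
    rfl

lemma mirror_I (t : ℕ) : F.mirror.I t = F.J t := by simp [I, J, mirror_st]
lemma mirror_J (t : ℕ) : F.mirror.J t = F.I t := by simp [I, J, mirror_st]

lemma mirror_V {t : ℕ} {p : ℝ × ℝ} : F.mirror.V t (mp p) ↔ F.V t p := by
  simp only [V, mirror_I, mirror_J, mirror_UL, mirror_UR]; tauto

lemma I_lt (t : ℕ) : F.I t < F.a := by
  have := F.ha
  cases t with
  | zero => exact this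
  | succ t =>
    have h : F.I (t + 1) ≤ F.a - 1 := fgr_le _ _
    omega

lemma J_lt (t : ℕ) : F.J t < F.b := by rw [← mirror_I]; exact F.mirror.I_lt t

lemma not_V_low {t i : ℕ} (hi : i ≤ F.I t + 1) : ¬ F.V t (F.l i) := by
  intro h
  have h1 := F.UL_height (F.I_lt t) h.1
  have h2 := F.yl_le hi (F.I_lt t)
  simp only [l] at h1
  linarith

lemma I_succ_eq (t : ℕ) :
    F.I (t + 1) = fgr (fun i => ¬ F.V t (F.l i)) (F.a - 1) := rfl

lemma l_I_succ_not (t : ℕ) : ¬ F.V t (F.l (F.I (t + 1))) := by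
  classical
  have := Nat.findGreatest_spec (P := fun i => ¬ F.V t (F.l i)) (m := 0) (n := F.a - 1)
    (Nat.zero_le _) (F.not_V_low (Nat.zero_le _))
  rw [I_succ_eq, fgr]; convert this

lemma in_V {t i : ℕ} (h1 : F.I (t + 1) < i) (h2 : i < F.a) : F.V t (F.l i) := by
  classical
  by_contra hcon
  rw [I_succ_eq, fgr] at h1
  exact Nat.findGreatest_is_greatest (P := fun i => ¬ F.V t (F.l i)) (n := F.a - 1) (k := i)
    (by convert h1) (by omega) hcon

lemma le_I_succ {t i : ℕ} (h1 : ¬ F.V t (F.l i)) (h2 : i < F.a) : i ≤ F.I (t + 1) := by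
  by_contra hcon
  exact h1 (F.in_V (by omega) h2)

lemma le_J_succ {t i : ℕ} (h1 : ¬ F.V t (F.r i)) (h2 : i < F.b) : i ≤ F.J (t + 1) := by
  rw [← mirror_I]
  apply F.mirror.le_I_succ _ h2
  rwa [mirror_l, mirror_V]

lemma I_mono (t : ℕ) : F.I t ≤ F.I (t + 1) := F.le_I_succ (F.not_V_low (by omega)) (F.I_lt t)
lemma J_mono (t : ℕ) : F.J t ≤ F.J (t + 1) := by
  rw [← mirror_I, ← mirror_I]; exact F.mirror.I_mono t

lemma V_succ {t : ℕ} {p : ℝ × ℝ} (h : F.V (t + 1) p) : F.V t p :=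
  ⟨F.UL_mono (F.I_mono t) (F.I_lt _) h.1, F.UR_mono (F.J_mono t) (F.J_lt _) h.2⟩

lemma V_mono {s t : ℕ} (hst : s ≤ t) {p : ℝ × ℝ} (h : F.V t p) : F.V s p := by
  induction t, hst using Nat.le_induction with
  | base => exact h
  | succ t _ ih => exact ih (F.V_succ h)

lemma V_apex {t : ℕ} {p : ℝ × ℝ} (h : F.V t p) : F.V t (F.l F.a) :=
  ⟨F.UL_apex (F.I_lt t) h.1, by rw [apex_eq]; exact F.UR_apex (F.J_lt t) h.2⟩

/-- nonemptiness of `V t` -/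
def NE (t : ℕ) : Prop := F.V t (F.l F.a)

lemma NE_mono {s t : ℕ} (hst : s ≤ t) (h : F.NE t) : F.NE s := F.V_mono hst h

lemma NE_mirror {t : ℕ} (h : F.NE t) : F.mirror.NE t := by
  unfold NE at *
  rw [mirror_l, mirror_V]
  rw [apex_eq] at h; exact h

lemma top_V {t : ℕ} (h : F.NE t) : F.V t (F.l (F.I (t + 1) + 1)) := by
  rcases Nat.lt_or_ge (F.I (t + 1) + 1) F.a with h1 | h1
  · exact F.in_V (by omega) h1
  · have := F.I_lt (t + 1)
    rw [show F.I (t + 1) + 1 = F.a by omega]; exact h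

lemma I_succ_lt {t : ℕ} (h : F.NE t) : F.I t + 1 ≤ F.I (t + 1) := by
  apply F.le_I_succ (F.not_V_low le_rfl)
  have h1 := F.UL_height (F.I_lt t) h.1
  have h2 := F.I_lt t
  rcases Nat.lt_or_ge (F.I t + 1) F.a with h3 | h3
  · exact h3
  · rw [show F.I t + 1 = F.a by omega] at h1
    simp [l] at h1

lemma exists_T : ∃ T, ¬ F.NE T := by
  by_contra hcon
  push Not at hcon
  have : ∀ t, t ≤ F.I t := by
    intro t
    induction t with
    | zero => exact Nat.zero_le _
    | succ t ih => have := F.I_succ_lt (hcon t); omega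
  have := this F.a
  have := F.I_lt F.a
  omega

lemma lemA {t : ℕ} (h : F.NE t) {p : ℝ × ℝ} (hp : F.UL (F.I (t + 1)) p) : F.V t p :=
  ⟨F.UL_mono (F.I_mono t) (F.I_lt _) hp,
    F.UR_of_l (F.J_lt t) (F.I_lt (t + 1)) (F.top_V h).2 hp.1 (F.UL_height (F.I_lt _) hp).le⟩

lemma lemA2 {s i : ℕ} (hi : i < F.a) (h : F.V s (F.l i)) {p : ℝ × ℝ} (hp : F.UL i p) :
    F.V s p := by
  have h1 : F.I s ≤ i := by
    by_contra hcon
    exact F.not_V_low (by omega) h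
  exact ⟨F.UL_mono h1 hi hp, F.UR_of_l (F.J_lt s) hi.le h.2 hp.1 hp.2.1.le⟩

lemma lemA2r {s j : ℕ} (hj : j < F.b) (h : F.V s (F.r j)) {p : ℝ × ℝ} (hp : F.UR j p) :
    F.V s p := by
  rw [← mirror_V] at h ⊢
  rw [← mirror_UL] at hp
  rw [← mirror_l] at h
  exact F.mirror.lemA2 hj h hp

lemma clos {s : ℕ} (h : F.NE (s + 1)) {p : ℝ × ℝ} (hp : p ∈ F.R) (h1 : F.yl (F.I (s + 2)) ≤ p.2)
    (h2 : p.1 ≤ F.L (F.I (s + 2)) p.2) : F.UL (F.I s) p := by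
  have hs := F.NE_mono (Nat.le_succ s) h
  have i1 : F.I (s + 1) + 1 ≤ F.I (s + 2) := F.I_succ_lt h
  have i2 := F.I_succ_lt hs
  have b2 := F.I_lt (s + 2)
  refine ⟨hp, (F.yl_lt (show F.I s < F.I (s + 2) by omega) b2.le).trans_le h1, ?_⟩
  have e1 := F.L_le_above (show F.I (s + 1) ≤ F.I (s + 2) by omega) b2 h1
  have e2 := (F.top_V hs).1.2.2
  simp only [l] at e2
  rw [← F.L_at_succ (F.I_lt (s + 1))] at e2
  have e3 := F.yl_le (show F.I (s + 1) + 1 ≤ F.I (s + 2) by omega) b2.le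
  have e4 := F.L_sub (F.I (s + 1)) p.2 (F.yl (F.I (s + 1) + 1))
  have e5 := F.L_sub (F.I s) p.2 (F.yl (F.I (s + 1) + 1))
  have e6 := F.sl_anti (F.I_mono s) (F.I_lt (s + 1))
  nlinarith

lemma closr {s : ℕ} (h : F.NE (s + 1)) {p : ℝ × ℝ} (hp : p ∈ F.R) (h1 : F.yr (F.J (s + 2)) ≤ p.2)
    (h2 : F.M (F.J (s + 2)) p.2 ≤ p.1) : F.UR (F.J s) p := by
  rw [← mirror_UL, ← mirror_I]
  apply F.mirror.clos (F.NE_mirror h) (F.mem_R_mirror.2 hp)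
  · rw [mirror_I]; exact h1
  · rw [mirror_I, mirror_L]; simp only [mp]; linarith

lemma exists_point {s t : ℕ} (hst : s + 2 ≤ t) (ht : F.NE (t + 1)) :
    ∃ p ∈ F.R, p.1 = F.L (F.I (t + 1)) p.2 ∧ p.2 < F.yl (F.I (t + 1) + 1) ∧ ¬ F.V (s + 2) p ∧
      F.V s p := by
  set i := F.I (t + 1) with hi
  have hia : i < F.a := F.I_lt _
  have hbig : F.V (s + 2) (F.l (i + 1)) := F.V_mono hst (F.top_V (F.NE_mono (Nat.le_succ t) ht))
  obtain ⟨⟨hR, b1, b2⟩, -, b3, b4⟩ := hbig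
  simp only [l] at b1 b2 b3 b4
  set φ : ℝ → ℝ := fun y => min (min (y - F.yl (F.I (s + 2))) (F.L (F.I (s + 2)) y - F.L i y))
    (min (y - F.yr (F.J (s + 2))) (F.L i y - F.M (F.J (s + 2)) y)) with hφ
  have hc : Continuous φ := by
    simp only [hφ, L, M]; fun_prop
  have hy0 : 0 ≤ F.yl (i + 1) := F.yl_nonneg hia
  have h0 : φ 0 ≤ 0 := by
    have := F.yl_nonneg (F.I_lt (s + 2)).le
    exact (min_le_left _ _).trans ((min_le_left _ _).trans (by linarith))
  have h1 : 0 < φ (F.yl (i + 1)) := by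
    simp only [hφ, lt_min_iff, F.L_at_succ hia]
    refine ⟨⟨?_, ?_⟩, ?_, ?_⟩ <;> linarith
  obtain ⟨y, ⟨hya, hyb⟩, hy⟩ := intermediate_value_Icc hy0 hc.continuousOn ⟨h0, h1.le⟩
  have hyb' : y < F.yl (i + 1) := by
    rcases hyb.lt_or_eq with h | h
    · exact h
    · rw [h] at hy; linarith
  have hyR : ((F.L i y, y) : ℝ × ℝ) ∈ F.R :=
    ⟨hya, hyb.trans (F.yl_le_h hia), F.f_le_L hia hya (hyb.trans (F.yl_le_h hia)),
      F.L_le_g hia hya hyb⟩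
  have hge : 0 ≤ φ y := hy.ge
  simp only [hφ, le_min_iff] at hge
  obtain ⟨⟨c1, c2⟩, c3, c4⟩ := hge
  refine ⟨(F.L i y, y), hyR, rfl, hyb', ?_, ?_, ?_⟩
  · rintro ⟨⟨-, d1, d2⟩, -, d3, d4⟩
    have : 0 < φ y := by
      simp only [hφ, lt_min_iff]
      simp only at d1 d2 d3 d4
      refine ⟨⟨?_, ?_⟩, ?_, ?_⟩ <;> linarith
    linarith
  · exact F.clos (F.NE_mono (by omega) ht) hyR (by simp only; linarith) (by simp only; linarith)
  · exact F.closr (F.NE_mono (by omega) ht) hyR (by simp only; linarith) (by simp only; linarith)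

/-- vertices -/
def Vx (v : ℝ × ℝ) : Prop := (∃ i ≤ F.a, v = F.l i) ∨ ∃ j ≤ F.b, v = F.r j

/-- shifted regions -/
def W : ℕ → ℝ × ℝ → Prop
  | 0, p => p ∈ F.R
  | q + 1, p => F.V q p

lemma W_succ {q : ℕ} {p : ℝ × ℝ} (h : F.W (q + 1) p) : F.W q p := by
  cases q with
  | zero => exact h.1.1
  | succ q => exact F.V_succ h

lemma W_mono {s t : ℕ} (hst : s ≤ t) {p : ℝ × ℝ} (h : F.W t p) : F.W s p := by
  induction t, hst using Nat.le_induction with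
  | base => exact h
  | succ t _ ih => exact ih (F.W_succ h)

lemma Vx_mem {v : ℝ × ℝ} (hv : F.Vx v) : v ∈ F.R := by
  rcases hv with ⟨i, hi, rfl⟩ | ⟨i, hi, rfl⟩
  · exact F.l_mem hi
  · exact F.r_mem hi

/-- The critical point. -/
lemma crit {s t : ℕ} (hst : s + 2 ≤ t) (ht : F.NE (t + 1)) :
    ∃ p ∈ F.R, ∀ v, F.Vx v → (F.See v p → F.W s v ∧ ¬ F.W (t + 2) v) ∧
      (F.W (s + 3) v → ¬ F.W (t + 1) v → F.See v p) := by
  obtain ⟨p, hp, hpL, hpy, hps, hps'⟩ := F.exists_point hst ht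
  have hNt : F.NE t := F.NE_mono (Nat.le_succ t) ht
  refine ⟨p, hp, fun v hv => ⟨fun hsee => ⟨?_, fun hW => ?_⟩, fun h1 h2 => ?_⟩⟩
  · cases s with
    | zero => exact F.Vx_mem hv
    | succ q =>
      by_contra hcon
      have hcon : ¬ F.V q v := hcon
      have hNq : F.NE q := F.NE_mono (by omega) ht
      rcases hv with ⟨i, hi, rfl⟩ | ⟨i, hi, rfl⟩
      · have hia : i < F.a := lt_of_le_of_ne hi (by rintro rfl; exact hcon hNq)
        exact F.not_see_l hia (F.UL_mono (F.le_I_succ hcon hia) (F.I_lt _) hps'.1) hsee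
      · have hia : i < F.b := lt_of_le_of_ne hi
          (by rintro rfl; exact hcon (by rw [← apex_eq]; exact hNq))
        exact F.not_see_r hia (F.UR_mono (F.le_J_succ hcon hia) (F.J_lt _) hps'.2) hsee
  · exact F.not_see (F.I_lt _) hpL hpy hW.1 (F.see_symm hsee)
  · have h1 : F.V (s + 2) v := h1
    have h2 : ¬ F.V t v := h2
    rcases hv with ⟨i, hi, rfl⟩ | ⟨i, hi, rfl⟩
    · have hia : i < F.a := lt_of_le_of_ne hi (by rintro rfl; exact h2 hNt)
      exact F.chord_see_l (F.I_lt _) (F.le_I_succ h2 hia) hp hpL (fun h => hps (F.lemA2 hia h1 h))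
    · have hia : i < F.b := lt_of_le_of_ne hi
          (by rintro rfl; exact h2 (by rw [← apex_eq]; exact hNt))
      exact F.chord_see_r (F.I_lt _) hia hp hpL (fun h => hps (F.lemA2r hia h1 h))
        (fun h => h2 (F.lemA hNt h))

end FD

/-- The combinatorial core. -/
lemma cf_core {α : Type*} {k : ℕ} (χ : α → Fin k) (G : α → Prop) (W : ℕ → α → Prop)
    (hW : ∀ s t, s ≤ t → ∀ p, W t p → W s p) (T : ℕ)
    (H : ∀ a b, a + 4 ≤ b → b ≤ T → ∃ g, G g ∧ W a g ∧ ¬ W b g ∧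
      ∀ h, G h → h ≠ g → W (a + 3) h → ¬ W (b - 1) h → χ h ≠ χ g) :
    ∀ (c : ℕ) (C : Finset (Fin k)), C.card = c → ∀ q r, q + (8 * 2 ^ c - 4) ≤ r → r ≤ T →
      (∀ g, G g → W q g → ¬ W r g → χ g ∈ C) → False := by
  classical
  intro c
  induction c with
  | zero =>
    intro C hC q r h1 h2 h3
    obtain ⟨g, g1, g2, g3, -⟩ := H q r (by simpa using h1) h2
    have := h3 g g1 g2 g3
    rw [Finset.card_eq_zero.1 hC] at this
    simp at this
  | succ c ih =>
    intro C hC q r h1 h2 h3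
    have hpow : 1 ≤ 2 ^ c := Nat.one_le_two_pow
    rw [pow_succ] at h1
    obtain ⟨g, g1, g2, g3, g4⟩ := H q r (by omega) h2
    have hex : ∃ l, ¬ W (l + 1) g := ⟨r, fun h => g3 (hW _ _ (by omega) _ h)⟩
    set l := Nat.find hex with hl
    have l1 : ¬ W (l + 1) g := Nat.find_spec hex
    have l2 : W l g := by
      rcases Nat.eq_zero_or_pos l with h | h
      · rw [h]; exact hW 0 q (Nat.zero_le _) _ g2
      · have := Nat.find_min hex (m := l - 1) (by omega)
        rw [not_not, show l - 1 + 1 = l by omega] at this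
        exact this
    have l3 : q ≤ l := by
      by_contra hcon
      exact l1 (hW _ _ (by omega) _ g2)
    have l4 : l < r := by
      by_contra hcon
      exact g3 (hW _ _ (by omega) _ l2)
    have hgC := h3 g g1 g2 g3
    have hcard : (C.erase (χ g)).card = c := by rw [Finset.card_erase_of_mem hgC]; omega
    rcases Nat.lt_or_ge l (q + 3 + (8 * 2 ^ c - 4)) with hlt | hge
    · refine ih (C.erase (χ g)) hcard (max (l + 1) (q + 3)) (r - 1) (by omega) (by omega) ?_
      intro h k1 k2 k3
      rw [Finset.mem_erase]
      have hne : h ≠ g := by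
        rintro rfl
        exact l1 (hW _ _ (le_max_left _ _) _ k2)
      exact ⟨g4 h k1 hne (hW _ _ (le_max_right _ _) _ k2) k3,
        h3 h k1 (hW _ _ (by omega) _ k2) (fun h' => k3 (hW _ _ (by omega) _ h'))⟩
    · refine ih (C.erase (χ g)) hcard (q + 3) l hge (by omega) ?_
      intro h k1 k2 k3
      rw [Finset.mem_erase]
      have hne : h ≠ g := by
        rintro rfl
        exact k3 l2
      exact ⟨g4 h k1 hne k2 (fun h' => k3 (hW _ _ (by omega) _ h')),
        h3 h k1 (hW _ _ (by omega) _ k2) (fun h' => k3 (hW _ _ (by omega) _ h'))⟩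

namespace FD
variable (F : FD)

lemma guard_left {t : ℕ} {p : ℝ × ℝ} (hW : F.W t p) (h : ¬ F.UL (F.I t) p) :
    F.See (F.l (F.I t)) p := by
  have hp : p ∈ F.R := F.W_mono (Nat.zero_le _) hW
  rcases le_or_gt (F.yl (F.I t)) p.2 with h1 | h1
  · exact F.see_up_l (F.I_lt t) hp h1 h
  · cases t with
    | zero =>
      have : F.I 0 = 0 := rfl
      rw [this, F.yl0] at h1
      linarith [hp.1]
    | succ t =>
      have hV : F.V t p := hW
      have hn := F.l_I_succ_not t
      by_cases hUL : F.UL (F.I t) (F.l (F.I (t + 1)))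
      · exact F.see_down (F.I_lt _) (F.J_lt t) hV.2 h1 (fun h' => hn ⟨hUL, h'⟩)
      · exfalso
        apply hUL
        have hi := F.I_lt (t + 1)
        obtain ⟨⟨q1, q2, q3⟩, -⟩ := hV
        refine ⟨F.l_mem hi.le, by simp only [l]; linarith, ?_⟩
        obtain ⟨k, hik, hk, h4, h5⟩ := F.cover (F.I_lt t) q2.le hp.2.1
        have e1 := F.f_eq_L hk h4 h5
        have e2 := F.f_le_L hk (F.yl_nonneg hi.le) (F.yl_le_h hi.le)
        rw [F.f_at hi.le] at e2
        simp only [l]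
        have e4 := F.L_sub k (F.yl (F.I (t + 1))) p.2
        have e5 := F.L_sub (F.I t) (F.yl (F.I (t + 1))) p.2
        have e6 := F.sl_anti hik hk
        have e7 := hp.2.2.1
        nlinarith

lemma mirror_W {t : ℕ} {p : ℝ × ℝ} : F.mirror.W t (mp p) ↔ F.W t p := by
  cases t with
  | zero => exact F.mem_R_mirror
  | succ t => exact F.mirror_V

lemma guard_right {t : ℕ} {p : ℝ × ℝ} (hW : F.W t p) (h : ¬ F.UR (F.J t) p) :
    F.See (F.r (F.J t)) p := by
  rw [← See_mirror_iff, ← mirror_l, ← mirror_I]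
  apply F.mirror.guard_left (F.mirror_W.2 hW)
  rwa [mirror_I, mirror_UL]

/-- The result for funnels in coordinates. -/
theorem main {k : ℕ} (χ : ℝ × ℝ → Fin k) (G : Finset (ℝ × ℝ)) (hG : ∀ g ∈ G, F.Vx g)
    (hcf : ∀ p ∈ F.R, ∃ g ∈ G, F.See g p ∧ ∀ h ∈ G, h ≠ g → F.See h p → χ h ≠ χ g) :
    ∃ G0 : Finset (ℝ × ℝ), (∀ g ∈ G0, F.Vx g) ∧ (∀ p ∈ F.R, ∃ g ∈ G0, F.See g p) ∧
      G0.card + 3 < 2 ^ (k + 4) := by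
  classical
  set T := Nat.find F.exists_T with hT
  have hT1 : ¬ F.NE T := Nat.find_spec F.exists_T
  have hT2 : ∀ t < T, F.NE t := fun t ht => by
    have := Nat.find_min F.exists_T ht; rwa [not_not] at this
  have hbound : T < 8 * 2 ^ k - 4 := by
    by_contra hcon
    refine cf_core χ (fun g => g ∈ G) F.W (fun s t hst p => F.W_mono hst) T ?_ k Finset.univ
      (by simp) 0 T (by omega) le_rfl (fun _ _ _ _ => Finset.mem_univ _)
    intro a b hab hbT
    obtain ⟨t, rfl⟩ : ∃ t, b = t + 2 := ⟨b - 2, by omega⟩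
    obtain ⟨p, hp, hcr⟩ := F.crit (s := a) (t := t) (by omega) (hT2 _ (by omega))
    obtain ⟨g, g1, g2, g3⟩ := hcf p hp
    refine ⟨g, g1, ((hcr g (hG g g1)).1 g2).1, ((hcr g (hG g g1)).1 g2).2, ?_⟩
    intro h h1 h2 h3 h4
    exact g3 h h1 h2 ((hcr h (hG h h1)).2 h3 h4)
  refine ⟨(Finset.range (T + 1)).image (fun t => F.l (F.I t)) ∪
    (Finset.range (T + 1)).image (fun t => F.r (F.J t)), ?_, ?_, ?_⟩
  · intro g hg
    simp only [Finset.mem_union, Finset.mem_image] at hg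
    rcases hg with ⟨t, -, rfl⟩ | ⟨t, -, rfl⟩
    · exact Or.inl ⟨_, (F.I_lt t).le, rfl⟩
    · exact Or.inr ⟨_, (F.J_lt t).le, rfl⟩
  · intro p hp
    have hex : ∃ t, ¬ F.V t p := ⟨T, fun h => hT1 (F.V_apex h)⟩
    have h1 := Nat.find_spec hex
    have h2 : Nat.find hex ≤ T := Nat.find_min' hex (fun h => hT1 (F.V_apex h))
    have h3 : F.W (Nat.find hex) p := by
      rcases Nat.eq_zero_or_pos (Nat.find hex) with h | h
      · rw [h]; exact hp
      · have := Nat.find_min hex (m := Nat.find hex - 1) (by omega)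
        rw [not_not] at this
        rw [show Nat.find hex = (Nat.find hex - 1) + 1 by omega]
        exact this
    by_cases hUL : F.UL (F.I (Nat.find hex)) p
    · have hUR : ¬ F.UR (F.J (Nat.find hex)) p := fun h => h1 ⟨hUL, h⟩
      refine ⟨_, Finset.mem_union_right _ (Finset.mem_image.2
        ⟨Nat.find hex, Finset.mem_range.2 (by omega), rfl⟩), F.guard_right h3 hUR⟩
    · refine ⟨_, Finset.mem_union_left _ (Finset.mem_image.2
        ⟨Nat.find hex, Finset.mem_range.2 (by omega), rfl⟩), F.guard_left h3 hUL⟩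
  · have hc := Finset.card_union_le ((Finset.range (T + 1)).image (fun t => F.l (F.I t)))
      ((Finset.range (T + 1)).image (fun t => F.r (F.J t)))
    have h1 := Finset.card_image_le (s := Finset.range (T + 1)) (f := fun t => F.l (F.I t))
    have h2 := Finset.card_image_le (s := Finset.range (T + 1)) (f := fun t => F.r (F.J t))
    rw [Finset.card_range] at h1 h2
    have : 2 ^ (k + 4) = 16 * 2 ^ k := by rw [pow_add]; ring
    rw [this]
    have hpow : 1 ≤ 2 ^ k := Nat.one_le_two_pow
    omega

end FD
end FunnelLB


namespace FunnelLB

/-- cross product -/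
def cr (a b : ℝ × ℝ) : ℝ := a.1 * b.2 - a.2 * b.1

lemma cr_swap (a b : ℝ × ℝ) : cr b a = - cr a b := by simp only [cr]; ring

/-- edge `i` of a cyclic sequence -/
def seg (v : ℕ → ℝ × ℝ) (i : ℕ) : Set (ℝ × ℝ) := segment ℝ (v i) (v (i + 1))

/-- Simple polygon as a periodic sequence. -/
structure Simp (n : ℕ) (v : ℕ → ℝ × ℝ) : Prop where
  three : 3 ≤ n
  per : ∀ i, v (i + n) = v i
  ne : ∀ i, v i ≠ v (i + 1)
  sep : ∀ i j, i < j → j < i + n → ∀ x, x ∈ seg v i → x ∈ seg v j →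
    (j = i + 1 ∧ x = v j) ∨ (j + 1 = i + n ∧ x = v i)

/-- doubled signed area -/
def ar (n : ℕ) (v : ℕ → ℝ × ℝ) : ℝ := ∑ i ∈ Finset.range n, cr (v i) (v (i + 1))

lemma vl_seg (v : ℕ → ℝ × ℝ) (i : ℕ) : v i ∈ seg v i := left_mem_segment ℝ _ _
lemma vr_seg (v : ℕ → ℝ × ℝ) (i : ℕ) : v (i + 1) ∈ seg v i := right_mem_segment ℝ _ _

namespace Simp
variable {n : ℕ} {v : ℕ → ℝ × ℝ}

lemma inj (h : Simp n v) {i j : ℕ} (hij : i < j) (hj : j < i + n) : v i ≠ v j := by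
  intro e
  rcases h.sep i j hij hj (v i) (vl_seg v i) (by rw [e]; exact vl_seg v j) with ⟨h1, -⟩ | ⟨h1, -⟩
  · subst h1; exact h.ne i e
  · apply h.ne j
    rw [h1, h.per, e]

lemma shift (h : Simp n v) (s : ℕ) : Simp n (fun i => v (i + s)) where
  three := h.three
  per i := by have := h.per (i + s); rwa [show i + n + s = i + s + n by omega]
  ne i := by have := h.ne (i + s); rwa [show i + 1 + s = i + s + 1 by omega]
  sep i j h1 h2 x h3 h4 := by
    have := h.sep (i + s) (j + s) (by omega) (by omega) x
      (by simp only [seg] at h3 ⊢; rwa [show i + s + 1 = i + 1 + s by omega])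
      (by simp only [seg] at h4 ⊢; rwa [show j + s + 1 = j + 1 + s by omega])
    rcases this with ⟨h5, h6⟩ | ⟨h5, h6⟩
    · exact Or.inl ⟨by omega, h6⟩
    · exact Or.inr ⟨by omega, h6⟩

lemma per_mul (h : Simp n v) (i q : ℕ) : v (i + n * q) = v i := by
  induction q with
  | zero => simp
  | succ q ih => rw [Nat.mul_succ, ← Nat.add_assoc, h.per, ih]

lemma mod (h : Simp n v) (i : ℕ) : v i = v (i % n) := by
  conv_lhs => rw [← Nat.mod_add_div i n, h.per_mul]

end Simp

lemma per_seg {n : ℕ} {v : ℕ → ℝ × ℝ} (per : ∀ i, v (i + n) = v i) (i q : ℕ) :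
    seg v (i + n * q) = seg v i ∧ v (i + n * q) = v i := by
  have key : ∀ i, v (i + n * q) = v i := by
    intro i
    induction q with
    | zero => simp
    | succ q ih => rw [Nat.mul_succ, ← Nat.add_assoc, per, ih]
  refine ⟨?_, key i⟩
  simp only [seg]
  rw [key, show i + n * q + 1 = i + 1 + n * q by omega, key]

/-- It suffices to check the axioms for indices below `n`. -/
lemma Simp.mk' {n : ℕ} {v : ℕ → ℝ × ℝ} (three : 3 ≤ n) (per : ∀ i, v (i + n) = v i)
    (ne : ∀ i < n, v i ≠ v (i + 1))
    (sep : ∀ i j, i < j → j < n → ∀ x, x ∈ seg v i → x ∈ seg v j →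
      (j = i + 1 ∧ x = v j) ∨ (j + 1 = i + n ∧ x = v i)) : Simp n v := by
  refine ⟨three, per, ?_, ?_⟩
  · intro i
    have h1 := (per_seg per (i % n) (i / n)).2
    have h2 := (per_seg per (i % n + 1) (i / n)).2
    rw [show i % n + 1 + n * (i / n) = i % n + n * (i / n) + 1 by omega, Nat.mod_add_div] at h2
    rw [Nat.mod_add_div] at h1
    rw [h1, h2]
    exact ne _ (Nat.mod_lt _ (by omega))
  · intro i j hij hj x hi hjx
    obtain ⟨q, i0, hi0, rfl⟩ : ∃ q i0, i0 < n ∧ i = i0 + n * q :=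
      ⟨i / n, i % n, Nat.mod_lt _ (by omega), (Nat.mod_add_div i n).symm⟩
    obtain ⟨j0, rfl⟩ : ∃ j0, j = j0 + n * q := ⟨j - n * q, by omega⟩
    rw [(per_seg per _ q).1] at hi hjx
    rw [(per_seg per i0 q).2, (per_seg per j0 q).2]
    rcases Nat.lt_or_ge j0 n with hlt | hge
    · rcases sep i0 j0 (by omega) hlt x hi hjx with ⟨h1, h2⟩ | ⟨h1, h2⟩
      · exact Or.inl ⟨by omega, h2⟩
      · exact Or.inr ⟨by omega, h2⟩
    · obtain ⟨j1, rfl⟩ : ∃ j1, j0 = j1 + n * 1 := ⟨j0 - n, by omega⟩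
      rw [(per_seg per _ 1).1] at hjx
      rw [(per_seg per _ 1).2]
      rcases sep j1 i0 (by omega) hi0 x hjx hi with ⟨h1, h2⟩ | ⟨h1, h2⟩
      · exact Or.inr ⟨by omega, h2⟩
      · exact Or.inl ⟨by omega, h2⟩

/-- cyclic part cut off by the diagonal `(0, k)` -/
def part (u : ℕ → ℝ × ℝ) (k : ℕ) : ℕ → ℝ × ℝ := fun i => u (i % (k + 1))

lemma part_le (u : ℕ → ℝ × ℝ) {k i : ℕ} (h : i ≤ k) : part u k i = u i := by
  simp only [part]; rw [Nat.mod_eq_of_lt (by omega)]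

lemma part_wrap (u : ℕ → ℝ × ℝ) (k i : ℕ) : part u k (i + (k + 1)) = part u k i := by
  simp [part]

lemma part_succ (u : ℕ → ℝ × ℝ) (k : ℕ) : part u k (k + 1) = u 0 := by simp [part]

lemma seg_part_lt (u : ℕ → ℝ × ℝ) {k i : ℕ} (h : i < k) : seg (part u k) i = seg u i := by
  simp only [seg]; rw [part_le u h.le, part_le u h]

lemma seg_part_eq (u : ℕ → ℝ × ℝ) (k : ℕ) : seg (part u k) k = segment ℝ (u k) (u 0) := by
  simp only [seg]; rw [part_le u le_rfl, part_succ]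

/-- `(0,k)` is a diagonal. -/
structure Diag (n : ℕ) (u : ℕ → ℝ × ℝ) (k : ℕ) : Prop where
  lo : 2 ≤ k
  hi : k + 2 ≤ n
  D : ∀ j x, x ∈ segment ℝ (u 0) (u k) → x ∈ seg u j → x = u 0 ∨ x = u k

lemma Diag.part1 {n k : ℕ} {u : ℕ → ℝ × ℝ} (h : Simp n u) (d : Diag n u k) :
    Simp (k + 1) (part u k) := by
  have hlo := d.lo
  have hhi := d.hi
  apply Simp.mk'
  · omega
  · exact part_wrap u k
  · intro i hi
    rcases Nat.lt_or_ge i k with h1 | h1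
    · rw [part_le u h1.le, part_le u h1]; exact h.ne i
    · rw [show i = k by omega, part_le u le_rfl, part_succ]
      exact (h.inj (i := 0) (j := k) (by omega) (by omega)).symm
  · intro i j hij hj x hi hjx
    rw [seg_part_lt u (show i < k by omega)] at hi
    rcases Nat.lt_or_ge j k with h1 | h1
    · rw [seg_part_lt u h1] at hjx
      rw [part_le u h1.le]
      rcases h.sep i j hij (by omega) x hi hjx with ⟨h2, h3⟩ | ⟨h2, h3⟩
      · exact Or.inl ⟨h2, h3⟩
      · omega
    · have hjk : j = k := by omega
      subst hjk
      rw [seg_part_eq, segment_symm] at hjx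
      rw [part_le u le_rfl, part_le u (show i ≤ j by omega)]
      rcases d.D i x hjx hi with rfl | rfl
      · right
        rcases Nat.eq_zero_or_pos i with h2 | h2
        · subst h2; exact ⟨by omega, rfl⟩
        · rcases h.sep 0 i h2 (by omega) _ (vl_seg u 0) hi with ⟨h3, h4⟩ | ⟨h3, h4⟩
          · subst h3; exact absurd h4 (h.ne 0)
          · omega
      · left
        rcases h.sep i j hij (by omega) _ hi (vl_seg u j) with ⟨h3, h4⟩ | ⟨h3, h4⟩
        · exact ⟨h3, rfl⟩
        · omega

lemma Diag.rot {n k : ℕ} {u : ℕ → ℝ × ℝ} (h : Simp n u) (d : Diag n u k) :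
    Diag n (fun i => u (i + k)) (n - k) := by
  have hlo := d.lo
  have hhi := d.hi
  refine ⟨by omega, by omega, ?_⟩
  intro j x hx hj
  have e : u (n - k + k) = u 0 := by
    rw [show n - k + k = 0 + n by omega, h.per]
  simp only [e, Nat.zero_add] at hx ⊢
  rw [segment_symm] at hx
  have := d.D (j + k) x hx (by simp only [seg] at hj ⊢; rwa [show j + k + 1 = j + 1 + k by omega])
  tauto

/-- second part -/
def part2 (n : ℕ) (u : ℕ → ℝ × ℝ) (k : ℕ) : ℕ → ℝ × ℝ := part (fun i => u (i + k)) (n - k)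

lemma Diag.part2 {n k : ℕ} {u : ℕ → ℝ × ℝ} (h : Simp n u) (d : Diag n u k) :
    Simp (n - k + 1) (part2 n u k) := Diag.part1 (h.shift k) (d.rot h)

lemma ar_part (u : ℕ → ℝ × ℝ) (k : ℕ) :
    ar (k + 1) (part u k) = ∑ i ∈ Finset.range k, cr (u i) (u (i + 1)) + cr (u k) (u 0) := by
  rw [ar, Finset.sum_range_succ, part_le u le_rfl, part_succ]
  congr 1
  apply Finset.sum_congr rfl
  intro i hi
  rw [Finset.mem_range] at hi
  rw [part_le u hi.le, part_le u hi]

lemma Diag.area {n k : ℕ} {u : ℕ → ℝ × ℝ} (h : Simp n u) (d : Diag n u k) :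
    ar n u = ar (k + 1) (part u k) + ar (n - k + 1) (FunnelLB.part2 n u k) := by
  have hlo := d.lo
  have hhi := d.hi
  rw [FunnelLB.part2, ar_part, ar_part]
  have e : u (n - k + k) = u 0 := by
    rw [show n - k + k = 0 + n by omega, h.per]
  rw [e, Nat.zero_add, cr_swap (u 0) (u k)]
  obtain ⟨m, rfl⟩ : ∃ m, n = k + m := ⟨n - k, by omega⟩
  rw [ar, Finset.sum_range_add, show k + m - k = m by omega]
  have : ∀ i, cr (u (k + i)) (u (k + i + 1)) = cr (u (i + k)) (u (i + 1 + k)) := by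
    intro i; rw [show k + i = i + k by omega, show i + k + 1 = i + 1 + k by omega]
  simp only [this]
  ring

lemma sum_per {M : Type*} [AddCommMonoid M] {n : ℕ} (f : ℕ → M) (hf : ∀ i, f (i + n) = f i)
    (s : ℕ) : ∑ i ∈ Finset.range n, f (i + s) = ∑ i ∈ Finset.range n, f i := by
  induction s with
  | zero => simp
  | succ s ih =>
    rw [← ih]
    cases n with
    | zero => simp
    | succ n =>
      rw [Finset.sum_range_succ, Finset.sum_range_succ']
      congr 1
      · apply Finset.sum_congr rfl; intro i _; congr 1; omega
      · rw [show n + (s + 1) = s + (n + 1) by omega, hf]; simp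

lemma ar_shift {n : ℕ} {v : ℕ → ℝ × ℝ} (h : Simp n v) (s : ℕ) :
    ar n (fun i => v (i + s)) = ar n v := by
  have := sum_per (n := n) (fun i => cr (v i) (v (i + 1)))
    (fun i => by rw [h.per, show i + n + 1 = i + 1 + n by omega, h.per]) s
  rw [ar, ar, ← this]
  apply Finset.sum_congr rfl
  intro i _
  rw [show i + 1 + s = i + s + 1 by omega]

end FunnelLB


namespace FunnelLB

/-- dot product -/
def dt (w p : ℝ × ℝ) : ℝ := w.1 * p.1 + w.2 * p.2

lemma dt_add (w p q : ℝ × ℝ) : dt w (p + q) = dt w p + dt w q := by simp [dt]; ring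
lemma dt_sub (w p q : ℝ × ℝ) : dt w (p - q) = dt w p - dt w q := by simp [dt]; ring
lemma dt_smul (w p : ℝ × ℝ) (t : ℝ) : dt w (t • p) = t * dt w p := by simp [dt]; ring

lemma mem_seg {x p q : ℝ × ℝ} :
    x ∈ segment ℝ p q ↔ ∃ t : ℝ, 0 ≤ t ∧ t ≤ 1 ∧ x = (1 - t) • p + t • q := by
  constructor
  · rintro ⟨a, b, ha, hb, hab, rfl⟩
    exact ⟨b, hb, by linarith, by rw [← hab]; simp⟩
  · rintro ⟨t, h0, h1, rfl⟩
    exact ⟨1 - t, t, by linarith, h0, by ring, rfl⟩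

lemma mem_oseg {x p q : ℝ × ℝ} :
    x ∈ openSegment ℝ p q ↔ ∃ t : ℝ, 0 < t ∧ t < 1 ∧ x = (1 - t) • p + t • q := by
  constructor
  · rintro ⟨a, b, ha, hb, hab, rfl⟩
    exact ⟨b, hb, by linarith, by rw [← hab]; simp⟩
  · rintro ⟨t, h0, h1, rfl⟩
    exact ⟨1 - t, t, by linarith, h0, by ring, rfl⟩

/-- A local extremum of a linear functional is not a straight vertex. -/
lemma Simp.fold {n : ℕ} {v : ℕ → ℝ × ℝ} (h : Simp n v) (w : ℝ × ℝ) (i : ℕ)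
    (h0 : dt w (v i) < dt w (v (i + 1))) (h2 : dt w (v (i + 2)) < dt w (v (i + 1))) :
    cr (v (i + 1) - v i) (v (i + 2) - v (i + 1)) ≠ 0 := by
  intro hc
  have h3 := h.three
  set a := dt w (v (i + 1)) - dt w (v i) with ha
  set b := dt w (v (i + 1)) - dt w (v (i + 2)) with hb
  have ha0 : 0 < a := by linarith
  have hb0 : 0 < b := by linarith
  have e1 : b * ((v i).1 - (v (i + 1)).1) = a * ((v (i + 2)).1 - (v (i + 1)).1) := by
    simp only [cr, dt, Prod.fst_sub, Prod.snd_sub] at hc ha hb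
    rw [ha, hb]; linear_combination w.2 * hc
  have e2 : b * ((v i).2 - (v (i + 1)).2) = a * ((v (i + 2)).2 - (v (i + 1)).2) := by
    simp only [cr, dt, Prod.fst_sub, Prod.snd_sub] at hc ha hb
    rw [ha, hb]; linear_combination - w.1 * hc
  rcases le_total a b with hab | hab
  · have hm : v i ∈ seg v (i + 1) := by
      rw [seg, mem_seg]
      refine ⟨a / b, by positivity, (div_le_one hb0).2 hab, ?_⟩
      ext
      · simp; field_simp; linarith
      · simp; field_simp; linarith
    rcases h.sep i (i + 1) (by omega) (by omega) _ (vl_seg v i) hm with ⟨-, h4⟩ | ⟨h4, -⟩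
    · exact h.ne i h4
    · omega
  · have hm : v (i + 2) ∈ seg v i := by
      rw [seg, mem_seg]
      refine ⟨1 - b / a, ?_, ?_, ?_⟩
      · have := (div_le_one ha0).2 hab; linarith
      · have : 0 < b / a := by positivity
        linarith
      · ext
        · simp; field_simp; linarith
        · simp; field_simp; linarith
    rcases h.sep i (i + 1) (by omega) (by omega) _ hm (vr_seg v (i + 1)) with ⟨-, h4⟩ | ⟨h4, -⟩
    · exact h.ne (i + 1) h4.symm
    · omega

/-- barycentric coordinates -/
noncomputable def m0 (a b c p : ℝ × ℝ) : ℝ := cr (b - p) (c - b) / cr (b - a) (c - b)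
/-- barycentric coordinates -/
noncomputable def m1 (a b c p : ℝ × ℝ) : ℝ := cr (p - a) (c - a) / cr (b - a) (c - b)
/-- barycentric coordinates -/
noncomputable def m2 (a b c p : ℝ × ℝ) : ℝ := cr (b - a) (p - a) / cr (b - a) (c - b)

section bary
variable {a b c : ℝ × ℝ}

lemma m0_aff (p q : ℝ × ℝ) (t : ℝ) :
    m0 a b c ((1 - t) • p + t • q) = (1 - t) * m0 a b c p + t * m0 a b c q := by
  simp only [m0, cr, Prod.fst_sub, Prod.snd_sub, Prod.fst_add, Prod.snd_add, Prod.smul_fst,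
    Prod.smul_snd, smul_eq_mul]
  ring
lemma m1_aff (p q : ℝ × ℝ) (t : ℝ) :
    m1 a b c ((1 - t) • p + t • q) = (1 - t) * m1 a b c p + t * m1 a b c q := by
  simp only [m1, cr, Prod.fst_sub, Prod.snd_sub, Prod.fst_add, Prod.snd_add, Prod.smul_fst,
    Prod.smul_snd, smul_eq_mul]
  ring
lemma m2_aff (p q : ℝ × ℝ) (t : ℝ) :
    m2 a b c ((1 - t) • p + t • q) = (1 - t) * m2 a b c p + t * m2 a b c q := by
  simp only [m2, cr, Prod.fst_sub, Prod.snd_sub, Prod.fst_add, Prod.snd_add, Prod.smul_fst,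
    Prod.smul_snd, smul_eq_mul]
  ring

lemma m_sum (hD : cr (b - a) (c - b) ≠ 0) (p : ℝ × ℝ) :
    m0 a b c p + m1 a b c p + m2 a b c p = 1 := by
  simp only [m0, m1, m2]
  rw [← add_div, ← add_div, div_eq_one_iff_eq hD]
  simp only [cr, Prod.fst_sub, Prod.snd_sub]; ring

lemma m_rec (hD : cr (b - a) (c - b) ≠ 0) (p : ℝ × ℝ) :
    p = m0 a b c p • a + m1 a b c p • b + m2 a b c p • c := by
  simp only [m0, m1, m2]
  ext
  · simp only [Prod.fst_add, Prod.smul_fst, smul_eq_mul]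
    field_simp
    simp only [cr, Prod.fst_sub, Prod.snd_sub]; ring
  · simp only [Prod.snd_add, Prod.smul_snd, smul_eq_mul]
    field_simp
    simp only [cr, Prod.fst_sub, Prod.snd_sub]; ring

lemma m0_a (hD : cr (b - a) (c - b) ≠ 0) : m0 a b c a = 1 := by
  simp only [m0]; rw [div_eq_one_iff_eq hD]
lemma m0_b : m0 a b c b = 0 := by simp [m0, cr]
lemma m0_c : m0 a b c c = 0 := by simp only [m0, cr]; simp; left; ring
lemma m1_a : m1 a b c a = 0 := by simp [m1, cr]
lemma m1_b (hD : cr (b - a) (c - b) ≠ 0) : m1 a b c b = 1 := by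
  have := m_sum hD b
  rw [m0_b] at this
  have h2 : m2 a b c b = 0 := by simp [m2, cr]; left; ring
  linarith
lemma m1_c : m1 a b c c = 0 := by simp only [m1, cr]; simp; left; ring
lemma m2_a : m2 a b c a = 0 := by simp [m2, cr]
lemma m2_b : m2 a b c b = 0 := by simp [m2, cr]; left; ring
lemma m2_c (hD : cr (b - a) (c - b) ≠ 0) : m2 a b c c = 1 := by
  have := m_sum hD c
  rw [m0_c, m1_c] at this
  linarith

end bary

/-- Claim C. -/
lemma Simp.claimC {n : ℕ} {v : ℕ → ℝ × ℝ} (h : Simp n v)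
    (hD : cr (v 1 - v 0) (v 2 - v 1) ≠ 0) {j : ℕ} (hj2 : 2 ≤ j) (hjn : j < n) {x p : ℝ × ℝ}
    (hx : x ∈ seg v j) (hx0 : 0 < m0 (v 0) (v 1) (v 2) x) (hx2 : 0 < m2 (v 0) (v 1) (v 2) x)
    (hx1 : 0 ≤ m1 (v 0) (v 1) (v 2) x) (hp : p = v j ∨ p = v (j + 1))
    (hpx : m1 (v 0) (v 1) (v 2) x ≤ m1 (v 0) (v 1) (v 2) p) :
    0 ≤ m0 (v 0) (v 1) (v 2) p ∧ 0 ≤ m2 (v 0) (v 1) (v 2) p := by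
  by_contra hcon
  have h3 := h.three
  have hpseg : p ∈ seg v j := by
    rcases hp with rfl | rfl
    · exact vl_seg v j
    · exact vr_seg v j
  have hc : Continuous (fun t : ℝ => min (m0 (v 0) (v 1) (v 2) ((1 - t) • x + t • p))
      (m2 (v 0) (v 1) (v 2) ((1 - t) • x + t • p))) := by
    simp only [m0_aff, m2_aff]; fun_prop
  have hF0 : 0 ≤ min (m0 (v 0) (v 1) (v 2) ((1 - (0:ℝ)) • x + (0:ℝ) • p))
      (m2 (v 0) (v 1) (v 2) ((1 - (0:ℝ)) • x + (0:ℝ) • p)) := by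
    simp; exact ⟨hx0.le, hx2.le⟩
  have hF1 : min (m0 (v 0) (v 1) (v 2) ((1 - (1:ℝ)) • x + (1:ℝ) • p))
      (m2 (v 0) (v 1) (v 2) ((1 - (1:ℝ)) • x + (1:ℝ) • p)) ≤ 0 := by
    simp; by_contra h'; push Not at h'; exact hcon ⟨h'.1.le, h'.2.le⟩
  obtain ⟨t, ⟨ht0, ht1⟩, ht⟩ := intermediate_value_Icc' zero_le_one hc.continuousOn ⟨hF1, hF0⟩
  simp only at ht
  have htpos : 0 < t := by
    rcases ht0.lt_or_eq with h' | h'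
    · exact h'
    · subst h'
      simp at ht
      have : 0 < min (m0 (v 0) (v 1) (v 2) x) (m2 (v 0) (v 1) (v 2) x) := lt_min hx0 hx2
      linarith
  set z := (1 - t) • x + t • p with hz
  have hzseg : z ∈ seg v j := by
    have hcv : Convex ℝ (seg v j) := convex_segment _ _
    exact hcv hx hpseg (by linarith) ht0 (by ring)
  have hz0 : 0 ≤ m0 (v 0) (v 1) (v 2) z := by rw [← ht]; exact min_le_left _ _
  have hz2 : 0 ≤ m2 (v 0) (v 1) (v 2) z := by rw [← ht]; exact min_le_right _ _
  have hz1 : 0 ≤ m1 (v 0) (v 1) (v 2) z := by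
    rw [hz, m1_aff]
    have := hx1.trans hpx
    nlinarith
  have hsum := m_sum hD z
  have hrec := m_rec hD z
  obtain ⟨s, hs0, hs1, hxs⟩ := mem_seg.1 hx
  rcases min_eq_iff.1 ht with ⟨he, -⟩ | ⟨he, -⟩
  · have hz1seg : z ∈ seg v 1 := by
      rw [seg, mem_seg]
      refine ⟨m2 (v 0) (v 1) (v 2) z, hz2, by linarith, ?_⟩
      conv_lhs => rw [hrec, he]
      rw [show m1 (v 0) (v 1) (v 2) z = 1 - m2 (v 0) (v 1) (v 2) z by linarith]
      simp
    rcases h.sep 1 j (by omega) (by omega) z hz1seg hzseg with ⟨rfl, h5⟩ | ⟨h4, -⟩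
    · rcases hp with rfl | rfl
      · apply hcon; rw [m0_c, m2_c hD]; norm_num
      · have hne := h.ne 2
        apply hne
        have hpos : 0 < (1 - t) * s + t := by nlinarith
        rw [hz, hxs] at h5
        have h6 := congrArg Prod.fst h5
        have h7 := congrArg Prod.snd h5
        simp at h6 h7
        ext
        · have : ((1 - t) * s + t) * ((v 2).1 - (v 3).1) = 0 := by linear_combination -h6
          rcases mul_eq_zero.1 this with h8 | h8 <;> linarith
        · have : ((1 - t) * s + t) * ((v 2).2 - (v 3).2) = 0 := by linear_combination -h7
          rcases mul_eq_zero.1 this with h8 | h8 <;> linarith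
    · omega
  · have hz0seg : z ∈ seg v 0 := by
      rw [seg, mem_seg]
      refine ⟨m1 (v 0) (v 1) (v 2) z, hz1, by linarith, ?_⟩
      conv_lhs => rw [hrec, he]
      rw [show m0 (v 0) (v 1) (v 2) z = 1 - m1 (v 0) (v 1) (v 2) z by linarith]
      simp
    rcases h.sep 0 j (by omega) (by omega) z hz0seg hzseg with ⟨h4, -⟩ | ⟨h4, h5⟩
    · omega
    · have hv : v (j + 1) = v 0 := by rw [h4, h.per]
      rcases hp with rfl | rfl
      · apply h.ne j
        rw [hv] at hxs ⊢
        have hpos : 0 < (1 - t) * (1 - s) + t := by nlinarith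
        rw [hz, hxs] at h5
        have h6 := congrArg Prod.fst h5
        have h7 := congrArg Prod.snd h5
        simp at h6 h7
        ext
        · have : ((1 - t) * (1 - s) + t) * ((v j).1 - (v 0).1) = 0 := by linear_combination h6
          rcases mul_eq_zero.1 this with h8 | h8 <;> linarith
        · have : ((1 - t) * (1 - s) + t) * ((v j).2 - (v 0).2) = 0 := by linear_combination h7
          rcases mul_eq_zero.1 this with h8 | h8 <;> linarith
      · apply hcon; rw [hv, m0_a hD, m2_a]; norm_num

end FunnelLB


namespace FunnelLB

/-- Orientation statement about free rays. -/
def RayOK (n : ℕ) (v : ℕ → ℝ × ℝ) : Prop :=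
  ar n v ≠ 0 ∧ ∀ i x d, x ∈ openSegment ℝ (v i) (v (i + 1)) → cr (v (i + 1) - v i) d ≠ 0 →
    (∀ t : ℝ, 0 < t → ∀ j, x + t • d ∉ seg v j) → ar n v * cr (v (i + 1) - v i) d < 0

lemma conv_le {z a b s : ℝ} (h : z = (1 - s) * a + s * b) (h0 : 0 ≤ s) (h1 : s ≤ 1) :
    z ≤ a ∨ z ≤ b := by
  by_contra hc
  push Not at hc
  rcases h0.lt_or_eq with h2 | h2
  · nlinarith [mul_lt_mul_of_pos_left hc.2 h2,
      mul_le_mul_of_nonneg_left hc.1.le (by linarith : 0 ≤ 1 - s)]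
  · subst h2; linarith [hc.1]

lemma dt_seg_le {w p q x : ℝ × ℝ} {M : ℝ} (hx : x ∈ segment ℝ p q) (hp : dt w p ≤ M)
    (hq : dt w q ≤ M) : dt w x ≤ M := by
  obtain ⟨t, h0, h1, rfl⟩ := mem_seg.1 hx
  rw [dt_add, dt_smul, dt_smul]
  nlinarith

lemma dt_seg_lt {w p q x : ℝ × ℝ} {M : ℝ} (hx : x ∈ segment ℝ p q) (hp : dt w p < M)
    (hq : dt w q < M) : dt w x < M :=
  lt_of_le_of_lt (dt_seg_le hx (le_max_left _ _) (le_max_right _ _)) (max_lt hp hq)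

lemma seg_mod {n : ℕ} {v : ℕ → ℝ × ℝ} (h : Simp n v) (j : ℕ) : seg v j = seg v (j % n) := by
  conv_lhs => rw [← Nat.mod_add_div j n, (per_seg h.per _ _).1]

/-- Extreme vertices turn according to the orientation. -/
lemma Simp.ext {n : ℕ} {v : ℕ → ℝ × ℝ} (h : Simp n v) (hR : RayOK n v) (w : ℝ × ℝ)
    (hw : ∀ j, 2 ≤ j → j ≤ n → dt w (v j) < dt w (v 1)) :
    0 < ar n v * cr (v 1 - v 0) (v 2 - v 1) := by
  have h3 := h.three
  have hv0 : v n = v 0 := by have := h.per 0; rwa [Nat.zero_add] at this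
  have hw0 : dt w (v 0) < dt w (v 1) := by rw [← hv0]; exact hw n (by omega) le_rfl
  have hw2 : dt w (v 2) < dt w (v 1) := hw 2 le_rfl (by omega)
  have hD := h.fold w 0 hw0 hw2
  rw [Nat.zero_add, Nat.zero_add] at hD
  obtain ⟨j0, hj0, hmax⟩ := Finset.exists_max_image (Finset.Icc 2 n) (fun j => dt w (v j))
    ⟨2, by simp; omega⟩
  rw [Finset.mem_Icc] at hj0
  set M := dt w (v j0) with hM
  have hM1 : M < dt w (v 1) := hw j0 hj0.1 hj0.2
  have hM0 : dt w (v 0) ≤ M := by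
    rw [← hv0]; exact hmax n (by simp; omega)
  have ha : 0 < dt w (v 1) - dt w (v 0) := by linarith
  set ε := (dt w (v 1) - M) / (2 * (dt w (v 1) - dt w (v 0))) with hε
  have hε0 : 0 < ε := div_pos (by linarith) (by linarith)
  have hε1 : ε < 1 := by rw [hε, div_lt_one (by linarith)]; linarith
  have hεa : ε * (dt w (v 1) - dt w (v 0)) = (dt w (v 1) - M) / 2 := by
    rw [hε]; field_simp
  set x := (1 - (1 - ε)) • v 0 + (1 - ε) • v 1 with hx
  have hxφ : M < dt w x := by
    rw [hx, dt_add, dt_smul, dt_smul]; nlinarith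
  have key := hR.2 0 x (v 1 - v 2) (mem_oseg.2 ⟨1 - ε, by linarith, by linarith, rfl⟩)
    (by
      intro h'; apply hD; rw [Nat.zero_add] at h'
      simp only [cr, Prod.fst_sub, Prod.snd_sub] at h' ⊢; linarith)
    (by
      intro t ht j hj
      rw [seg_mod h] at hj
      have hjn := Nat.mod_lt j (show 0 < n by omega)
      set J := j % n
      by_cases hJ0 : J = 0
      · rw [hJ0, seg, mem_seg] at hj
        obtain ⟨s, -, -, hs⟩ := hj
        have e1 := congrArg Prod.fst hs
        have e2 := congrArg Prod.snd hs
        simp [hx] at e1 e2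
        have : t * cr (v 1 - v 0) (v 2 - v 1) = 0 := by
          simp only [cr, Prod.fst_sub, Prod.snd_sub]
          linear_combination ((v 1).2 - (v 0).2) * e1 - ((v 1).1 - (v 0).1) * e2
        rcases mul_eq_zero.1 this with h8 | h8
        · linarith
        · exact hD h8
      by_cases hJ1 : J = 1
      · rw [hJ1, seg, mem_seg] at hj
        obtain ⟨s, -, -, hs⟩ := hj
        have e1 := congrArg Prod.fst hs
        have e2 := congrArg Prod.snd hs
        simp [hx] at e1 e2
        have : ε * cr (v 1 - v 0) (v 2 - v 1) = 0 := by
          simp only [cr, Prod.fst_sub, Prod.snd_sub]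
          linear_combination -((v 2).2 - (v 1).2) * e1 + ((v 2).1 - (v 1).1) * e2
        rcases mul_eq_zero.1 this with h8 | h8
        · linarith
        · exact hD h8
      have := dt_seg_le (w := w) hj (hmax J (by simp; omega)) (hmax (J + 1) (by simp; omega))
      rw [dt_add, dt_smul, dt_sub] at this
      nlinarith)
  rw [Nat.zero_add] at key
  have e : cr (v 1 - v 0) (v 1 - v 2) = - cr (v 1 - v 0) (v 2 - v 1) := by
    simp only [cr, Prod.fst_sub, Prod.snd_sub]; ring
  rw [e] at key
  linarith

lemma Simp.mem_seg1 {v : ℕ → ℝ × ℝ} (hD : cr (v 1 - v 0) (v 2 - v 1) ≠ 0) {z : ℝ × ℝ}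
    (he : m0 (v 0) (v 1) (v 2) z = 0) (h1 : 0 ≤ m1 (v 0) (v 1) (v 2) z)
    (h2 : 0 ≤ m2 (v 0) (v 1) (v 2) z) : z ∈ seg v 1 := by
  have hsum := m_sum hD z
  have hrec := m_rec hD z
  rw [seg, mem_seg]
  refine ⟨m2 (v 0) (v 1) (v 2) z, h2, by linarith, ?_⟩
  conv_lhs => rw [hrec, he]
  rw [show m1 (v 0) (v 1) (v 2) z = 1 - m2 (v 0) (v 1) (v 2) z by linarith]
  simp

lemma Simp.mem_seg0 {v : ℕ → ℝ × ℝ} (hD : cr (v 1 - v 0) (v 2 - v 1) ≠ 0) {z : ℝ × ℝ}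
    (he : m2 (v 0) (v 1) (v 2) z = 0) (h1 : 0 ≤ m1 (v 0) (v 1) (v 2) z)
    (h2 : 0 ≤ m0 (v 0) (v 1) (v 2) z) : z ∈ seg v 0 := by
  have hsum := m_sum hD z
  have hrec := m_rec hD z
  rw [seg, mem_seg]
  refine ⟨m1 (v 0) (v 1) (v 2) z, h1, by linarith, ?_⟩
  conv_lhs => rw [hrec, he]
  rw [show m0 (v 0) (v 1) (v 2) z = 1 - m1 (v 0) (v 1) (v 2) z by linarith]
  simp

lemma Simp.mem_seg2 {v : ℕ → ℝ × ℝ} (hD : cr (v 1 - v 0) (v 2 - v 1) ≠ 0) {z : ℝ × ℝ}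
    (he : m1 (v 0) (v 1) (v 2) z = 0) (h1 : 0 ≤ m0 (v 0) (v 1) (v 2) z)
    (h2 : 0 ≤ m2 (v 0) (v 1) (v 2) z) : z ∈ segment ℝ (v 2) (v 0) := by
  have hsum := m_sum hD z
  have hrec := m_rec hD z
  rw [mem_seg]
  refine ⟨m0 (v 0) (v 1) (v 2) z, h1, by linarith, ?_⟩
  conv_lhs => rw [hrec, he]
  rw [show m2 (v 0) (v 1) (v 2) z = 1 - m0 (v 0) (v 1) (v 2) z by linarith]
  simp
  rw [add_comm]

/-- The diagonal with compatible orientations exists: case of a vertex in the triangle. -/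
lemma Simp.diag1 {n : ℕ} {v : ℕ → ℝ × ℝ} (h : Simp n v) (w : ℝ × ℝ)
    (hw : ∀ j, 2 ≤ j → j ≤ n → dt w (v j) < dt w (v 1))
    (IH : ∀ m < n, ∀ u, Simp m u → RayOK m u)
    (hD : cr (v 1 - v 0) (v 2 - v 1) ≠ 0)
    (hex : ∃ k, 3 ≤ k ∧ k < n ∧ 0 ≤ m0 (v 0) (v 1) (v 2) (v k) ∧
      0 ≤ m1 (v 0) (v 1) (v 2) (v k) ∧ 0 ≤ m2 (v 0) (v 1) (v 2) (v k)) :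
    ∃ s k, Diag n (fun i => v (i + s)) k ∧ 0 < ar (k + 1) (part (fun i => v (i + s)) k) *
      ar (n - k + 1) (part2 n (fun i => v (i + s)) k) := by
  classical
  have hv0 : v n = v 0 := by have := h.per 0; rwa [Nat.zero_add] at this
  have hv1 : v (n + 1) = v 1 := by have := h.per 1; rwa [Nat.add_comm] at this
  obtain ⟨k, hk, hmax⟩ := Finset.exists_max_image
    ((Finset.Ico 3 n).filter (fun k => 0 ≤ m0 (v 0) (v 1) (v 2) (v k) ∧
      0 ≤ m1 (v 0) (v 1) (v 2) (v k) ∧ 0 ≤ m2 (v 0) (v 1) (v 2) (v k)))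
    (fun k => m1 (v 0) (v 1) (v 2) (v k))
    (by obtain ⟨k, h1, h2, h3⟩ := hex
        exact ⟨k, by simp [h1, h2, h3]⟩)
  simp only [Finset.mem_filter, Finset.mem_Ico] at hk hmax
  obtain ⟨⟨hk3, hkn⟩, hk0, hk1, hk2⟩ := hk
  have hk0' : 0 < m0 (v 0) (v 1) (v 2) (v k) := by
    rcases hk0.lt_or_eq with h' | h'
    · exact h'
    · have := Simp.mem_seg1 hD h'.symm hk1 hk2
      rcases h.sep 1 k (by omega) (by omega) _ this (vl_seg v k) with ⟨h4, -⟩ | ⟨h4, -⟩ <;> omega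
  have hk2' : 0 < m2 (v 0) (v 1) (v 2) (v k) := by
    rcases hk2.lt_or_eq with h' | h'
    · exact h'
    · have := Simp.mem_seg0 hD h'.symm hk1 hk0
      rcases h.sep 0 k (by omega) (by omega) _ this (vl_seg v k) with ⟨h4, -⟩ | ⟨h4, h5⟩
      · omega
      · exact absurd h5.symm (h.inj (by omega) (by omega))
  have hsum := m_sum hD (v k)
  have hdiag : Diag n (fun i => v (i + 1)) (k - 1) := by
    refine ⟨by omega, by omega, ?_⟩
    intro j x hx hj
    simp only [Nat.zero_add, show k - 1 + 1 = k by omega] at hx ⊢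
    have hj' : x ∈ seg v (j + 1) := hj
    rw [seg_mod h] at hj'
    have hjn := Nat.mod_lt (j + 1) (show 0 < n by omega)
    set J := (j + 1) % n
    obtain ⟨t, ht0, ht1, rfl⟩ := mem_seg.1 hx
    rcases ht0.lt_or_eq with ht | ht
    swap
    · left; subst ht; simp
    right
    have e0 := m0_aff (a := v 0) (b := v 1) (c := v 2) (v 1) (v k) t
    have e1 := m1_aff (a := v 0) (b := v 1) (c := v 2) (v 1) (v k) t
    have e2 := m2_aff (a := v 0) (b := v 1) (c := v 2) (v 1) (v k) t
    rw [m0_b] at e0; rw [m1_b hD] at e1; rw [m2_b] at e2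
    set x := (1 - t) • v 1 + t • v k with hxdef
    have hx0 : 0 < m0 (v 0) (v 1) (v 2) x := by rw [e0]; nlinarith
    have hx2 : 0 < m2 (v 0) (v 1) (v 2) x := by rw [e2]; nlinarith
    have hx1 : 0 ≤ m1 (v 0) (v 1) (v 2) x := by rw [e1]; nlinarith
    obtain ⟨s, hs0, hs1, hs⟩ := mem_seg.1 hj'
    by_cases hJ0 : J = 0
    · rw [hs, m2_aff, hJ0, m2_a, m2_b] at hx2; linarith
    by_cases hJ1 : J = 1
    · rw [hs, m0_aff, hJ1, m0_b, m0_c] at hx0; linarith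
    obtain ⟨q, hq, hqx⟩ : ∃ q, (q = J ∨ q = J + 1) ∧
        m1 (v 0) (v 1) (v 2) x ≤ m1 (v 0) (v 1) (v 2) (v q) := by
      by_contra hcon
      push Not at hcon
      have c1 := hcon J (Or.inl rfl)
      have c2 := hcon (J + 1) (Or.inr rfl)
      have := m1_aff (a := v 0) (b := v 1) (c := v 2) (v J) (v (J + 1)) s
      rw [← hs] at this
      rcases conv_le this hs0 hs1 with h5 | h5 <;> linarith
    have hcl := h.claimC hD (show 2 ≤ J by omega) hjn hj' hx0 hx2 hx1 (p := v q)
      (by rcases hq with rfl | rfl <;> simp) hqx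
    have hle : m1 (v 0) (v 1) (v 2) (v q) ≤ m1 (v 0) (v 1) (v 2) (v k) := by
      by_cases h2 : q = 2
      · rw [h2, m1_c]; exact hk1
      by_cases hn : q = n
      · rw [hn, hv0, m1_a]; exact hk1
      exact hmax q ⟨⟨by omega, by omega⟩, hcl.1, hx1.trans hqx, hcl.2⟩
    have : t = 1 := by
      by_contra hne
      have : t < 1 := lt_of_le_of_ne ht1 hne
      nlinarith
    rw [hxdef, this]; simp
  refine ⟨1, k - 1, hdiag, ?_⟩
  have hu := h.shift 1
  have S1 := hdiag.part1 hu
  have S2 := hdiag.part2 hu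
  have A1 := ar_shift S1 (k - 1)
  have A2 := ar_shift S2 (n - k)
  have S1' := S1.shift (k - 1)
  have S2' := S2.shift (n - k)
  have E1 := S1'.ext (IH _ (by omega) _ S1') w
  have E2 := S2'.ext (IH _ (by omega) _ S2') w
  rw [A1] at E1
  rw [A2] at E2
  have p1 : part (fun i => v (i + 1)) (k - 1) (1 + (k - 1)) = v 1 := by
    rw [show 1 + (k - 1) = k - 1 + 1 by omega, part_succ]
  have p0 : part (fun i => v (i + 1)) (k - 1) (0 + (k - 1)) = v k := by
    rw [Nat.zero_add, part_le _ le_rfl, show k - 1 + 1 = k by omega]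
  have p2 : part (fun i => v (i + 1)) (k - 1) (2 + (k - 1)) = v 2 := by
    rw [show 2 + (k - 1) = 1 + (k - 1 + 1) by omega, part_wrap, part_le _ (by omega)]
  have pj : ∀ j, 2 ≤ j → j ≤ k - 1 + 1 →
      part (fun i => v (i + 1)) (k - 1) (j + (k - 1)) = v j := by
    intro j h1 h2
    rw [show j + (k - 1) = (j - 1) + (k - 1 + 1) by omega, part_wrap, part_le _ (by omega),
      show j - 1 + 1 = j by omega]
  simp only [p0, p1, p2] at E1
  have E1' := E1 (fun j h1 h2 => by rw [pj j h1 h2]; exact hw j h1 (by omega))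
  have q1 : part2 n (fun i => v (i + 1)) (k - 1) (1 + (n - k)) = v 1 := by
    rw [part2, part_le _ (by omega), ← hv1]; congr 1; omega
  have q0 : part2 n (fun i => v (i + 1)) (k - 1) (0 + (n - k)) = v 0 := by
    rw [part2, part_le _ (by omega), ← hv0]; congr 1; omega
  have qj : ∀ j, 2 ≤ j → j ≤ n - (k - 1) + 1 →
      part2 n (fun i => v (i + 1)) (k - 1) (j + (n - k)) = v (j - 2 + k) := by
    intro j h1 h2
    rw [part2, show j + (n - k) = (j - 2) + (n - (k - 1) + 1) by omega, part_wrap,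
      part_le _ (by omega)]
    congr 1; omega
  have q2 : part2 n (fun i => v (i + 1)) (k - 1) (2 + (n - k)) = v k := by
    rw [qj 2 le_rfl (by omega)]; congr 1; omega
  simp only [q0, q1, q2] at E2
  have E2' := E2 (fun j h1 h2 => by rw [qj j h1 h2]; exact hw _ (by omega) (by omega))
  have f0 : cr (v 1 - v k) (v 2 - v 1) =
      m0 (v 0) (v 1) (v 2) (v k) * cr (v 1 - v 0) (v 2 - v 1) := by
    rw [m0]; field_simp
  have f2 : cr (v 1 - v 0) (v k - v 1) =
      m2 (v 0) (v 1) (v 2) (v k) * cr (v 1 - v 0) (v 2 - v 1) := by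
    rw [m2]; field_simp; simp only [cr, Prod.fst_sub, Prod.snd_sub]; ring
  rw [f0] at E1'
  rw [f2] at E2'
  set a1 := ar (k - 1 + 1) (part (fun i => v (i + 1)) (k - 1))
  set a2 := ar (n - (k - 1) + 1) (part2 n (fun i => v (i + 1)) (k - 1))
  set D := cr (v 1 - v 0) (v 2 - v 1)
  have hDD : 0 < D ^ 2 := by positivity
  have : 0 < (a1 * a2) * (m0 (v 0) (v 1) (v 2) (v k) * m2 (v 0) (v 1) (v 2) (v k) * D ^ 2) := by
    have := mul_pos E1' E2'
    nlinarith
  exact (pos_iff_pos_of_mul_pos this).2 (by positivity)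

end FunnelLB


namespace FunnelLB

/-- The diagonal with compatible orientations exists: case of an empty triangle (an ear). -/
lemma Simp.diag2 {n : ℕ} {v : ℕ → ℝ × ℝ} (h : Simp n v) (hn : 4 ≤ n) (w : ℝ × ℝ)
    (hw : ∀ j, 2 ≤ j → j ≤ n → dt w (v j) < dt w (v 1))
    (IH : ∀ m < n, ∀ u, Simp m u → RayOK m u)
    (hD : cr (v 1 - v 0) (v 2 - v 1) ≠ 0)
    (hno : ∀ k, 3 ≤ k → k < n → 0 ≤ m0 (v 0) (v 1) (v 2) (v k) →
      0 ≤ m1 (v 0) (v 1) (v 2) (v k) → 0 ≤ m2 (v 0) (v 1) (v 2) (v k) → False) :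
    ∃ s k, Diag n (fun i => v (i + s)) k ∧ 0 < ar (k + 1) (part (fun i => v (i + s)) k) *
      ar (n - k + 1) (part2 n (fun i => v (i + s)) k) := by
  classical
  have hv0 : v n = v 0 := by have := h.per 0; rwa [Nat.zero_add] at this
  -- no edge other than 0, 1 reaches the triangle with both m0, m2 positive and m1 ≥ 0
  have key : ∀ J, 2 ≤ J → J < n → ∀ x ∈ seg v J, 0 < m0 (v 0) (v 1) (v 2) x →
      0 < m2 (v 0) (v 1) (v 2) x → 0 ≤ m1 (v 0) (v 1) (v 2) x → False := by
    intro J hJ2 hJn x hx hx0 hx2 hx1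
    have hq : ∀ q, (q = J ∨ q = J + 1) →
        m1 (v 0) (v 1) (v 2) x ≤ m1 (v 0) (v 1) (v 2) (v q) → q = 2 ∨ q = n := by
      intro q hq hqx
      have hcl := h.claimC hD hJ2 hJn hx hx0 hx2 hx1 (p := v q)
        (by rcases hq with rfl | rfl <;> simp) hqx
      by_contra hcon
      exact hno q (by omega) (by omega) hcl.1 (hx1.trans hqx) hcl.2
    have hmm : ∀ q, q = 2 ∨ q = n → m1 (v 0) (v 1) (v 2) (v q) = 0 := by
      rintro q (rfl | rfl)
      · exact m1_c
      · rw [hv0]; exact m1_a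
    obtain ⟨s, hs0, hs1, hs⟩ := mem_seg.1 hx
    have e1 := m1_aff (a := v 0) (b := v 1) (c := v 2) (v J) (v (J + 1)) s
    rw [← hs] at e1
    have e0 := m0_aff (a := v 0) (b := v 1) (c := v 2) (v J) (v (J + 1)) s
    have e2 := m2_aff (a := v 0) (b := v 1) (c := v 2) (v J) (v (J + 1)) s
    rw [← hs] at e0 e2
    by_cases c1 : m1 (v 0) (v 1) (v 2) x ≤ m1 (v 0) (v 1) (v 2) (v J)
    · have hJ := hq J (Or.inl rfl) c1
      have z1 := hmm J hJ
      by_cases c2 : m1 (v 0) (v 1) (v 2) x ≤ m1 (v 0) (v 1) (v 2) (v (J + 1))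
      · have hJ' := hq (J + 1) (Or.inr rfl) c2
        omega
      · push Not at c2
        have hx10 : m1 (v 0) (v 1) (v 2) x = 0 := by linarith
        rw [hx10, z1] at e1
        have hs00 : s = 0 := by
          rw [hx10] at c2
          have : s * m1 (v 0) (v 1) (v 2) (v (J + 1)) = 0 := by linarith
          rcases mul_eq_zero.1 this with h' | h'
          · exact h'
          · linarith
        have hJ2' : J = 2 := by omega
        rw [hs00, hJ2', m0_c] at e0
        simp at e0; linarith
    · push Not at c1
      have c2 : m1 (v 0) (v 1) (v 2) x ≤ m1 (v 0) (v 1) (v 2) (v (J + 1)) := by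
        rcases conv_le e1 hs0 hs1 with h5 | h5
        · linarith
        · exact h5
      have hJ' := hq (J + 1) (Or.inr rfl) c2
      have z1 := hmm (J + 1) hJ'
      have hx10 : m1 (v 0) (v 1) (v 2) x = 0 := by linarith
      rw [hx10, z1] at e1
      have hs00 : 1 - s = 0 := by
        rw [hx10] at c1
        have : (1 - s) * m1 (v 0) (v 1) (v 2) (v J) = 0 := by linarith
        rcases mul_eq_zero.1 this with h' | h'
        · exact h'
        · linarith
      have hJ2' : J + 1 = n := by omega
      rw [hs00, hJ2', hv0, m2_a] at e2
      simp at e2; linarith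
  have hdiag : Diag n (fun i => v (i + 0)) 2 := by
    refine ⟨le_rfl, by omega, ?_⟩
    intro j x hx hj
    simp only [Nat.add_zero] at hx hj ⊢
    have hj' : x ∈ seg v j := hj
    rw [seg_mod h] at hj'
    have hjn := Nat.mod_lt j (show 0 < n by omega)
    set J := j % n
    obtain ⟨t, ht0, ht1, rfl⟩ := mem_seg.1 hx
    rcases ht0.lt_or_eq with ht | ht
    swap
    · left; subst ht; simp
    rcases ht1.lt_or_eq with ht' | ht'
    swap
    · right; subst ht'; simp
    exfalso
    have e0 := m0_aff (a := v 0) (b := v 1) (c := v 2) (v 0) (v 2) t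
    have e1 := m1_aff (a := v 0) (b := v 1) (c := v 2) (v 0) (v 2) t
    have e2 := m2_aff (a := v 0) (b := v 1) (c := v 2) (v 0) (v 2) t
    rw [m0_c, m0_a hD] at e0; rw [m1_a, m1_c] at e1; rw [m2_a, m2_c hD] at e2
    set x := (1 - t) • v 0 + t • v 2 with hxdef
    have hx0 : 0 < m0 (v 0) (v 1) (v 2) x := by rw [e0]; linarith
    have hx2 : 0 < m2 (v 0) (v 1) (v 2) x := by rw [e2]; linarith
    have hx1 : 0 ≤ m1 (v 0) (v 1) (v 2) x := by rw [e1]; linarith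
    obtain ⟨s, hs0, hs1, hs⟩ := mem_seg.1 hj'
    by_cases hJ0 : J = 0
    · rw [hs, m2_aff, hJ0, m2_a, m2_b] at hx2; linarith
    by_cases hJ1 : J = 1
    · rw [hs, m0_aff, hJ1, m0_b, m0_c] at hx0; linarith
    exact key J (by omega) hjn x hj' hx0 hx2 hx1
  refine ⟨0, 2, hdiag, ?_⟩
  have hu := h.shift 0
  have S2 := hdiag.part2 hu
  have R2 := IH _ (by omega) _ S2
  have a1 : ar (2 + 1) (part (fun i => v (i + 0)) 2) = cr (v 1 - v 0) (v 2 - v 1) := by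
    rw [ar_part]
    simp [Finset.sum_range_succ, cr]; ring
  rw [a1]
  have p0 : part2 n (fun i => v (i + 0)) 2 (n - 2) = v 0 := by
    rw [part2, part_le _ le_rfl, ← hv0]; congr 1; omega
  have p1 : part2 n (fun i => v (i + 0)) 2 (n - 2 + 1) = v 2 := by
    rw [part2, part_succ]
  have hR := R2.2 (n - 2)
  rw [p0, p1] at hR
  set x := (1 - (1 / 2 : ℝ)) • v 0 + (1 / 2 : ℝ) • v 2 with hx
  have hcr : cr (v 2 - v 0) (v 1 - x) = - cr (v 1 - v 0) (v 2 - v 1) := by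
    simp [hx, cr]; ring
  have := hR x (v 1 - x) (mem_oseg.2 ⟨1/2, by norm_num, by norm_num, rfl⟩)
    (by rw [hcr]; simpa using hD) ?_
  · rw [hcr] at this; linarith
  intro t ht j hj
  have hz : x + t • (v 1 - x) = (1 - t) • x + t • v 1 := by
    rw [smul_sub, sub_smul, one_smul]; abel
  rw [hz] at hj
  set z := (1 - t) • x + t • v 1 with hzdef
  have e0 : m0 (v 0) (v 1) (v 2) z = (1 - t) / 2 := by
    rw [hzdef, m0_aff, hx, m0_aff, m0_a hD, m0_b, m0_c]; ring
  have e1 : m1 (v 0) (v 1) (v 2) z = t := by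
    rw [hzdef, m1_aff, hx, m1_aff, m1_a, m1_b hD, m1_c]; ring
  have e2 : m2 (v 0) (v 1) (v 2) z = (1 - t) / 2 := by
    rw [hzdef, m2_aff, hx, m2_aff, m2_a, m2_b, m2_c hD]; ring
  rw [seg_mod S2] at hj
  have hjn := Nat.mod_lt j (show 0 < n - 2 + 1 by omega)
  set J := j % (n - 2 + 1)
  by_cases hJ : J = n - 2
  · rw [hJ, seg, p0, p1] at hj
    obtain ⟨s, hs0, hs1, hs⟩ := mem_seg.1 hj
    rw [hs, m1_aff, m1_a, m1_c] at e1; linarith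
  have hJ' : J < n - 2 := by omega
  have hj2 : z ∈ seg v (J + 2) := by
    rw [part2, seg_part_lt _ hJ'] at hj
    simp only [seg, Nat.add_zero] at hj ⊢
    rwa [show J + 2 + 1 = J + 1 + 2 by omega]
  by_cases ht1 : t < 1
  · exact key (J + 2) (by omega) (by omega) z hj2 (by rw [e0]; linarith) (by rw [e2]; linarith)
      (by rw [e1]; exact ht.le)
  · push Not at ht1
    have hlt := dt_seg_lt hj2 (hw (J + 2) (by omega) (by omega)) (hw (J + 2 + 1) (by omega) (by omega))
    have hw0 := hw n (by omega) le_rfl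
    rw [hv0] at hw0
    have hw2 := hw 2 le_rfl (by omega)
    rw [hzdef, dt_add, dt_smul, dt_smul, hx, dt_add, dt_smul, dt_smul] at hlt
    nlinarith

/-- A strictly extreme vertex, shifted to index one. -/
lemma Simp.exmax {n : ℕ} {v : ℕ → ℝ × ℝ} (h : Simp n v) :
    ∃ s w, ∀ j, 2 ≤ j → j ≤ n → dt w (v (j + s)) < dt w (v (1 + s)) := by
  have h3 := h.three
  obtain ⟨q, hq, hmax⟩ := Finset.exists_max_image (Finset.range n)
    (fun j => dt (v j) (v j)) ⟨0, by simp; omega⟩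
  rw [Finset.mem_range] at hq
  have hmax' : ∀ j, dt (v j) (v j) ≤ dt (v q) (v q) := by
    intro j
    rw [h.mod j]
    exact hmax _ (Finset.mem_range.2 (Nat.mod_lt _ (by omega)))
  have hq1 : v (1 + (q + n - 1)) = v q := by
    rw [show 1 + (q + n - 1) = q + n by omega, h.per]
  refine ⟨q + n - 1, v q, ?_⟩
  intro j hj2 hjn
  rw [hq1]
  have hne : v q ≠ v (j + (q + n - 1)) := by
    have := h.inj (i := 1 + (q + n - 1)) (j := j + (q + n - 1)) (by omega) (by omega)
    rwa [hq1] at this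
  have hle := hmax' (j + (q + n - 1))
  set z := v (j + (q + n - 1))
  by_contra hc
  push Not at hc
  simp only [dt] at hc hle
  apply hne
  have h1 : ((v q).1 - z.1) ^ 2 + ((v q).2 - z.2) ^ 2 ≤ 0 := by nlinarith
  ext <;> nlinarith [sq_nonneg ((v q).1 - z.1), sq_nonneg ((v q).2 - z.2)]

/-- Splitting of a simple polygon. -/
lemma Simp.split {n : ℕ} {v : ℕ → ℝ × ℝ} (h : Simp n v) (hn : 4 ≤ n)
    (IH : ∀ m < n, ∀ u, Simp m u → RayOK m u) :
    ∃ s k, Diag n (fun i => v (i + s)) k ∧ 0 < ar (k + 1) (part (fun i => v (i + s)) k) *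
      ar (n - k + 1) (part2 n (fun i => v (i + s)) k) := by
  obtain ⟨s, w, hw⟩ := h.exmax
  have hu := h.shift s
  have hw' : ∀ j, 2 ≤ j → j ≤ n → dt w ((fun i => v (i + s)) j) < dt w ((fun i => v (i + s)) 1) := hw
  have hv0 : v (n + s) = v (0 + s) := by rw [Nat.add_comm, Nat.zero_add, h.per]
  have hD := hu.fold w 0 (by have := hw n (by omega) le_rfl; rw [hv0] at this; exact this)
    (hw 2 le_rfl (by omega))
  simp only [Nat.zero_add] at hD
  have key : ∃ s' k, Diag n (fun i => v (i + s' + s)) k ∧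
      0 < ar (k + 1) (part (fun i => v (i + s' + s)) k) *
      ar (n - k + 1) (part2 n (fun i => v (i + s' + s)) k) := by
    by_cases hex : ∃ k, 3 ≤ k ∧ k < n ∧ 0 ≤ m0 (v (0 + s)) (v (1 + s)) (v (2 + s)) (v (k + s)) ∧
      0 ≤ m1 (v (0 + s)) (v (1 + s)) (v (2 + s)) (v (k + s)) ∧
      0 ≤ m2 (v (0 + s)) (v (1 + s)) (v (2 + s)) (v (k + s))
    · exact hu.diag1 w hw' IH (by simpa using hD) hex
    · exact hu.diag2 hn w hw' IH (by simpa using hD)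
        (fun k h1 h2 h3 h4 h5 => hex ⟨k, h1, h2, h3, h4, h5⟩)
  obtain ⟨s', k, hk⟩ := key
  refine ⟨s' + s, k, ?_⟩
  simpa only [Nat.add_assoc] using hk

end FunnelLB


namespace FunnelLB

lemma RayOK.unshift {n : ℕ} {v : ℕ → ℝ × ℝ} (h : Simp n v) (s : ℕ)
    (hR : RayOK n (fun i => v (i + s))) : RayOK n v := by
  have h3 := h.three
  refine ⟨by rw [← ar_shift h s]; exact hR.1, ?_⟩
  intro i x d hx hc hf
  have hs : s ≤ n * s := Nat.le_mul_of_pos_left s (by omega)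
  have e0 : v (i + n * s - s + s) = v i := by
    rw [Nat.sub_add_cancel (by omega), h.per_mul]
  have e1 : v (i + n * s - s + 1 + s) = v (i + 1) := by
    rw [show i + n * s - s + 1 + s = i + 1 + n * s by omega, h.per_mul]
  have := hR.2 (i + n * s - s) x d
  simp only [e0, e1, ar_shift h s] at this
  apply this hx hc
  intro t ht j hj
  apply hf t ht (j + s)
  simp only [seg] at hj ⊢
  rwa [show j + s + 1 = j + 1 + s by omega]

lemma ar3 (v : ℕ → ℝ × ℝ) (h : v 3 = v 0) : ar 3 v = cr (v 1 - v 0) (v 2 - v 1) := by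
  simp only [ar, Finset.sum_range_succ, Finset.sum_range_zero, h, cr, Prod.fst_sub, Prod.snd_sub]
  simp only [Nat.zero_add, Nat.reduceAdd, h]
  ring

lemma RayOK.base {v : ℕ → ℝ × ℝ} (h : Simp 3 v) : RayOK 3 v := by
  have har : ar 3 v ≠ 0 := by
    obtain ⟨s, w, hw⟩ := h.exmax
    have hu := h.shift s
    have h30 : v (3 + s) = v (0 + s) := by rw [Nat.add_comm, h.per, Nat.zero_add]
    have := hu.fold w 0 (by have := hw 3 (by omega) le_rfl; rw [h30] at this; exact this)
      (hw 2 le_rfl (by omega))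
    rw [← ar_shift h s, ar3 _ h30]
    simpa using this
  refine ⟨har, ?_⟩
  intro i x d hx hc hf
  have hu := h.shift i
  rw [← ar_shift h i] at har ⊢
  have hf' : ∀ t : ℝ, 0 < t → ∀ j, x + t • d ∉ seg (fun j => v (j + i)) j := by
    intro t ht j hj
    apply hf t ht (j + i)
    simp only [seg] at hj ⊢
    rwa [show j + i + 1 = j + 1 + i by omega]
  have hx' : x ∈ openSegment ℝ ((fun j => v (j + i)) 0) ((fun j => v (j + i)) 1) := by
    simpa [Nat.add_comm] using hx
  have hc' : cr ((fun j => v (j + i)) 1 - (fun j => v (j + i)) 0) d ≠ 0 := by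
    simpa [Nat.add_comm] using hc
  have goal' : ar 3 (fun j => v (j + i)) * cr ((fun j => v (j + i)) 1 - (fun j => v (j + i)) 0) d < 0 := by
    generalize (fun j => v (j + i)) = u at *
    have h30 : u 3 = u 0 := hu.per 0
    rw [ar3 u h30] at har ⊢
    set D := cr (u 1 - u 0) (u 2 - u 1) with hDdef
    by_contra hcon
    have hpos : 0 < D * cr (u 1 - u 0) d :=
      lt_of_le_of_ne (not_lt.1 hcon) (mul_ne_zero har hc').symm
    have hD := har
    obtain ⟨s, hs0, hs1, hs⟩ := mem_oseg.1 hx'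
    have f : ∀ (y : ℝ × ℝ) (t : ℝ), y + t • d = (1 - t) • y + t • (y + d) := by
      intro y t
      rw [smul_add, sub_smul, one_smul]; abel
    have g0 : m0 (u 0) (u 1) (u 2) x = 1 - s := by rw [hs, m0_aff, m0_a hD, m0_b]; ring
    have g1 : m1 (u 0) (u 1) (u 2) x = s := by rw [hs, m1_aff, m1_a, m1_b hD]; ring
    have g2 : m2 (u 0) (u 1) (u 2) x = 0 := by rw [hs, m2_aff, m2_a, m2_b]; ring
    have gd : m2 (u 0) (u 1) (u 2) (x + d) = cr (u 1 - u 0) d / D := by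
      have : m2 (u 0) (u 1) (u 2) (x + d) = m2 (u 0) (u 1) (u 2) x + cr (u 1 - u 0) d / D := by
        rw [m2, m2, ← hDdef, ← add_div]; congr 1
        simp only [cr, Prod.fst_sub, Prod.snd_sub, Prod.fst_add, Prod.snd_add]; ring
      rw [this, g2, zero_add]
    set δ := cr (u 1 - u 0) d / D with hδ
    have hδ0 : 0 < δ := by
      have : δ = D * cr (u 1 - u 0) d / D ^ 2 := by rw [hδ]; field_simp
      rw [this]; positivity
    set F : ℝ → ℝ := fun t => min (m0 (u 0) (u 1) (u 2) (x + t • d)) (m1 (u 0) (u 1) (u 2) (x + t • d))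
      with hF
    have hFc : Continuous F := by
      have : F = fun t => min ((1 - t) * m0 (u 0) (u 1) (u 2) x + t * m0 (u 0) (u 1) (u 2) (x + d))
        ((1 - t) * m1 (u 0) (u 1) (u 2) x + t * m1 (u 0) (u 1) (u 2) (x + d)) := by
        funext t; rw [hF]; simp only [f x t, m0_aff, m1_aff]
      rw [this]; fun_prop
    have hm2 : ∀ t, m2 (u 0) (u 1) (u 2) (x + t • d) = t * δ := by
      intro t; rw [f, m2_aff, g2, gd]; ring
    have hF0 : 0 < F 0 := by
      simp only [hF, zero_smul, add_zero, g0, g1]; exact lt_min (by linarith) hs0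
    have hF1 : F (1 / δ) ≤ 0 := by
      have e := m_sum hD (x + (1 / δ) • d)
      rw [hm2, one_div_mul_cancel hδ0.ne'] at e
      simp only [hF]
      rcases le_total (m0 (u 0) (u 1) (u 2) (x + (1 / δ) • d)) 0 with h' | h'
      · exact (min_le_left _ _).trans h'
      · exact (min_le_right _ _).trans (by linarith)
    obtain ⟨t, ht, hFt⟩ := intermediate_value_Icc' (show (0 : ℝ) ≤ 1 / δ by positivity)
      hFc.continuousOn ⟨hF1, hF0.le⟩
    have ht0 : 0 < t := by
      rcases ht.1.lt_or_eq with h' | h'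
      · exact h'
      · rw [← h'] at hFt; linarith
    have h2 : 0 ≤ m2 (u 0) (u 1) (u 2) (x + t • d) := by rw [hm2]; positivity
    simp only [hF] at hFt
    rcases min_choice (m0 (u 0) (u 1) (u 2) (x + t • d)) (m1 (u 0) (u 1) (u 2) (x + t • d)) with h' | h'
    · have h1 := min_le_right (m0 (u 0) (u 1) (u 2) (x + t • d)) (m1 (u 0) (u 1) (u 2) (x + t • d))
      exact hf' t ht0 1 (Simp.mem_seg1 hD (by linarith) (by linarith) h2)
    · have h1 := min_le_left (m0 (u 0) (u 1) (u 2) (x + t • d)) (m1 (u 0) (u 1) (u 2) (x + t • d))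
      apply hf' t ht0 2
      rw [seg, show 2 + 1 = 3 from rfl, h30]
      exact Simp.mem_seg2 hD (by linarith) (by linarith) h2
  simpa [Nat.add_comm] using goal'

lemma part_free {n k : ℕ} {u : ℕ → ℝ × ℝ} (S : Simp (k + 1) (part u k)) {y d : ℝ × ℝ}
    (hf : ∀ t : ℝ, 0 < t → ∀ j, y + t • d ∉ seg u j)
    (hg : ∀ t : ℝ, 0 < t → y + t • d ∉ segment ℝ (u 0) (u k)) :
    ∀ t : ℝ, 0 < t → ∀ j, y + t • d ∉ seg (part u k) j := by
  intro t ht j hj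
  rw [seg_mod S] at hj
  have hjn := Nat.mod_lt j (show 0 < k + 1 by omega)
  by_cases hJ : j % (k + 1) = k
  · rw [hJ, seg_part_eq, segment_symm] at hj
    exact hg t ht hj
  · rw [seg_part_lt _ (by omega)] at hj
    exact hf t ht _ hj

lemma RayOK.step {n k : ℕ} {u : ℕ → ℝ × ℝ} (h : Simp n u) (dg : Diag n u k)
    (R1 : RayOK (k + 1) (part u k)) (R2 : RayOK (n - k + 1) (part2 n u k))
    (hpos : 0 < ar (k + 1) (part u k) * ar (n - k + 1) (part2 n u k)) : RayOK n u := by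
  have hlo := dg.lo
  have hhi := dg.hi
  have S1 := dg.part1 h
  have S2 := dg.part2 h
  have hun : u n = u 0 := by have := h.per 0; rwa [Nat.zero_add] at this
  rw [RayOK, dg.area h]
  set A1 := ar (k + 1) (part u k)
  set A2 := ar (n - k + 1) (part2 n u k)
  have hsum : ∀ c : ℝ, A1 * c < 0 → A2 * c < 0 := by
    intro c hc
    by_contra h'
    push Not at h'
    have : A1 * A2 * c ^ 2 ≤ 0 := by nlinarith
    have hc0 : c ≠ 0 := by rintro rfl; simp at hc
    have : 0 < A1 * A2 * c ^ 2 := by positivity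
    linarith
  have hsum' : ∀ c : ℝ, A2 * c < 0 → A1 * c < 0 := by
    intro c hc
    by_contra h'
    push Not at h'
    have : A1 * A2 * c ^ 2 ≤ 0 := by nlinarith
    have hc0 : c ≠ 0 := by rintro rfl; simp at hc
    have : 0 < A1 * A2 * c ^ 2 := by positivity
    linarith
  refine ⟨?_, ?_⟩
  · intro h0
    have : A1 = - A2 := by linarith
    rw [this] at hpos
    nlinarith [sq_nonneg A2]
  intro i x d hx hc hf
  have hp2 : ∀ y : ℝ × ℝ, (∀ t : ℝ, 0 < t → ∀ j, y + t • d ∉ seg u j) →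
      ∀ t : ℝ, 0 < t → ∀ j, y + t • d ∉ seg (fun i => u (i + k)) j := by
    intro y hy t ht j hj
    apply hy t ht (j + k)
    simp only [seg] at hj ⊢
    rwa [show j + k + 1 = j + 1 + k by omega]
  have q0 : part2 n u k (n - k) = u 0 := by
    rw [part2, part_le _ le_rfl, ← hun]; congr 1; omega
  have q1 : part2 n u k (n - k + 1) = u k := by
    rw [part2, part_succ, Nat.zero_add]
  have hnk : u (n - k + k) = u 0 := by
    rw [← hun]; congr 1; omega
  have h0k : u (0 + k) = u k := by simp
  by_cases hit : ∃ t : ℝ, 0 < t ∧ x + t • d ∈ segment ℝ (u 0) (u k)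
  · exfalso
    obtain ⟨t, ht, hy⟩ := hit
    set y := x + t • d with hydef
    have hyf : ∀ τ : ℝ, 0 < τ → ∀ j, y + τ • d ∉ seg u j := by
      intro τ hτ j hj
      apply hf (t + τ) (by linarith) j
      rwa [add_smul, ← add_assoc]
    obtain ⟨s, hs0, hs1, hs⟩ := mem_seg.1 hy
    have hs0' : 0 < s := by
      rcases hs0.lt_or_eq with h' | h'
      · exact h'
      · exfalso; apply hf t ht 0; rw [← hydef, hs, ← h']; simpa using vl_seg u 0
    have hs1' : s < 1 := by
      rcases hs1.lt_or_eq with h' | h'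
      · exact h'
      · exfalso; apply hf t ht k; rw [← hydef, hs, h']; simpa using vl_seg u k
    have hne : u 0 ≠ u k := h.inj (by omega) (by omega)
    by_cases hpar : cr (u k - u 0) d = 0
    · set e := u k - u 0 with he
      have hN : 0 < dt e e := by
        have : e ≠ 0 := sub_ne_zero.2 hne.symm
        by_contra h'
        apply this
        simp only [dt] at h'
        ext <;> simp <;> nlinarith [sq_nonneg e.1, sq_nonneg e.2]
      set l := dt e d / dt e e with hl
      have hdl : d = l • e := by
        simp only [cr] at hpar
        ext
        · simp only [Prod.smul_fst, smul_eq_mul, hl]; rw [div_mul_eq_mul_div, eq_div_iff hN.ne']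
          simp only [dt]; linear_combination (-e.2) * hpar
        · simp only [Prod.smul_snd, smul_eq_mul, hl]; rw [div_mul_eq_mul_div, eq_div_iff hN.ne']
          simp only [dt]; linear_combination (e.1) * hpar
      have hl0 : l ≠ 0 := by
        rintro h'
        apply hc; rw [hdl, h']; simp [cr]
      rcases lt_or_gt_of_ne hl0 with h' | h'
      · apply hyf (-s / l) (div_pos_of_neg_of_neg (by linarith) h') 0
        have : y + (-s / l) • d = u 0 := by
          rw [hs, hdl, smul_smul, div_mul_cancel₀ _ hl0, he, smul_sub, neg_smul, neg_smul, sub_smul, one_smul]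
          abel
        rw [this]; exact vl_seg u 0
      · apply hyf ((1 - s) / l) (div_pos (by linarith) h') k
        have : y + ((1 - s) / l) • d = u k := by
          rw [hs, hdl, smul_smul, div_mul_cancel₀ _ hl0, he, smul_sub, sub_smul, sub_smul, one_smul, one_smul]
          abel
        rw [this]; exact vl_seg u k
    · have hdg : ∀ τ : ℝ, 0 < τ → y + τ • d ∉ segment ℝ (u 0) (u k) := by
        intro τ hτ hz
        obtain ⟨s', -, -, hs'⟩ := mem_seg.1 hz
        rw [hs] at hs'
        have e1 := congrArg Prod.fst hs'
        have e2 := congrArg Prod.snd hs'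
        simp at e1 e2
        have : τ * cr (u k - u 0) d = 0 := by
          simp only [cr, Prod.fst_sub, Prod.snd_sub]
          linear_combination ((u k).1 - (u 0).1) * e2 - ((u k).2 - (u 0).2) * e1
        rcases mul_eq_zero.1 this with h8 | h8
        · linarith
        · exact hpar h8
      have K1 := R1.2 k y d
      rw [part_succ, part_le u le_rfl] at K1
      have hsw : cr (u 0 - u k) d = - cr (u k - u 0) d := by
        simp only [cr, Prod.fst_sub, Prod.snd_sub]; ring
      have K1' := K1 (mem_oseg.2 ⟨1 - s, by linarith, by linarith, by
          rw [hs, sub_sub_cancel, add_comm]⟩) (by rw [hsw]; simpa using hpar)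
        (part_free (n := n) S1 hyf hdg)
      have K2 := R2.2 (n - k) y d
      rw [q0, q1] at K2
      have K2' := K2 (mem_oseg.2 ⟨s, hs0', hs1', hs⟩) hpar
        (part_free (n := n) S2 (hp2 y hyf) (by rw [hnk, h0k, segment_symm]; exact hdg))
      have := hsum' _ K2'
      rw [hsw] at K1'
      linarith
  · push Not at hit
    have hin := Nat.mod_lt i (show 0 < n by omega)
    have e0 : u i = u (i % n) := h.mod i
    have e1 : u (i + 1) = u (i % n + 1) := by
      conv_lhs => rw [← Nat.mod_add_div i n, show i % n + n * (i / n) + 1 = i % n + 1 + n * (i / n) by omega, h.per_mul]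
    rw [e0, e1] at hx hc ⊢
    generalize i % n = I at *
    by_cases hI : I < k
    · have K := R1.2 I x d
      rw [part_le u hI.le, part_le u (show I + 1 ≤ k by omega)] at K
      have K' := K hx hc (part_free (n := n) S1 hf hit)
      have := hsum _ K'
      linarith
    · have K := R2.2 (I - k) x d
      rw [part2, part_le _ (by omega), part_le _ (by omega)] at K
      simp only [show I - k + k = I by omega, show I - k + 1 + k = I + 1 by omega] at K
      have K' := K hx hc (part_free (n := n) S2 (hp2 x hf) (by rw [hnk, h0k, segment_symm]; exact hit))
      have := hsum' _ K'
      have K'' : A2 * cr (u (I + 1) - u I) d < 0 := K'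
      linarith

theorem Simp.rayOK {n : ℕ} : ∀ {v : ℕ → ℝ × ℝ}, Simp n v → RayOK n v := by
  induction n using Nat.strong_induction_on with
  | _ n IH =>
    intro v h
    by_cases h3 : n = 3
    · subst h3; exact RayOK.base h
    have h3' := h.three
    have IH' : ∀ m < n, ∀ u, Simp m u → RayOK m u := fun m hm u hu => IH m hm hu
    obtain ⟨s, k, dg, hpos⟩ := h.split (by omega) IH'
    have hlo := dg.lo
    have hhi := dg.hi
    have hu := h.shift s
    exact RayOK.unshift h s (RayOK.step hu dg (IH' _ (by omega) _ (dg.part1 hu))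
      (IH' _ (by omega) _ (dg.part2 hu)) hpos)

theorem Simp.split' {n : ℕ} {v : ℕ → ℝ × ℝ} (h : Simp n v) (hn : 4 ≤ n) :
    ∃ s k, Diag n (fun i => v (i + s)) k ∧ 0 < ar (k + 1) (part (fun i => v (i + s)) k) *
      ar (n - k + 1) (part2 n (fun i => v (i + s)) k) :=
  h.split hn (fun _ _ _ hu => hu.rayOK)

end FunnelLB


namespace FunnelLB

open Classical in
/-- Contribution of a corner: convex maxima count `1`, reflex minima count `-1`. -/
noncomputable def cc (w p q r : ℝ × ℝ) : ℤ :=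
  if dt w p < dt w q ∧ dt w r < dt w q ∧ 0 < cr (q - p) (r - q) then 1
  else if dt w q < dt w p ∧ dt w q < dt w r ∧ cr (q - p) (r - q) < 0 then -1 else 0

lemma cr_id (w p q r z : ℝ × ℝ) :
    cr (q - p) (r - q) * (dt w z - dt w q) =
      cr (q - p) (z - q) * (dt w r - dt w q) - cr (q - z) (r - q) * (dt w q - dt w p) := by
  simp only [cr, dt, Prod.fst_sub, Prod.snd_sub]; ring

lemma cc_le (w p q r : ℝ × ℝ) : cc w p q r ≤ 1 := by
  rw [cc]; split_ifs <;> norm_num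

lemma neg_le_cc (w p q r : ℝ × ℝ) : -1 ≤ cc w p q r := by
  rw [cc]; split_ifs <;> norm_num

lemma cc_pos {w p q r : ℝ × ℝ} (h : 0 < cc w p q r) :
    dt w p < dt w q ∧ dt w r < dt w q ∧ 0 < cr (q - p) (r - q) := by
  rw [cc] at h; split_ifs at h with h1 h2
  · exact h1
  all_goals simp at h

lemma cc_neg {w p q r : ℝ × ℝ} (h : cc w p q r < 0) :
    dt w q < dt w p ∧ dt w q < dt w r ∧ cr (q - p) (r - q) < 0 := by
  rw [cc] at h; split_ifs at h with h1 h2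
  · simp at h
  · exact h2
  · simp at h

lemma cc_one {w p q r : ℝ × ℝ} (h1 : dt w p < dt w q) (h2 : dt w r < dt w q)
    (h3 : 0 < cr (q - p) (r - q)) : cc w p q r = 1 := by
  rw [cc, if_pos ⟨h1, h2, h3⟩]

lemma cc_neg_one {w p q r : ℝ × ℝ} (h1 : dt w q < dt w p) (h2 : dt w q < dt w r)
    (h3 : cr (q - p) (r - q) < 0) : cc w p q r = -1 := by
  rw [cc, if_neg (fun h => absurd h.1 (by linarith)), if_pos ⟨h1, h2, h3⟩]

lemma cc_lt {w p q r z : ℝ × ℝ} (hz : dt w z < dt w q) :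
    cc w p q z + cc w z q r - 1 ≤ cc w p q r := by
  have hid := cr_id w p q r z
  have b1 := cc_le w p q z
  have b2 := cc_le w z q r
  have b3 := neg_le_cc w p q r
  by_contra hc
  push Not at hc
  by_cases h0 : cc w p q r < 0
  · obtain ⟨a1, a2, -⟩ := cc_neg h0
    by_cases hX : 0 < cc w p q z
    · linarith [(cc_pos hX).1]
    · have := (cc_pos (show 0 < cc w z q r by omega)).2.1
      linarith
  · obtain ⟨x1, x2, x3⟩ := cc_pos (show 0 < cc w p q z by omega)
    obtain ⟨y1, y2, y3⟩ := cc_pos (show 0 < cc w z q r by omega)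
    have : 0 < cr (q - p) (r - q) := by
      by_contra h'
      push Not at h'
      have k1 := mul_pos x3 (sub_pos.2 y2)
      have k2 := mul_pos y3 (sub_pos.2 x1)
      have k3 := mul_nonneg (neg_nonneg.2 h') (sub_pos.2 hz).le
      nlinarith
    have := cc_one x1 y2 this
    omega

lemma cc_gt {w p q r z : ℝ × ℝ} (hz : dt w q < dt w z) :
    cc w p q z + cc w z q r ≤ cc w p q r := by
  have hid := cr_id w p q r z
  have b3 := neg_le_cc w p q r
  have hX : cc w p q z ≤ 0 := by
    by_contra h'
    push Not at h'
    linarith [(cc_pos h').2.1]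
  have hY : cc w z q r ≤ 0 := by
    by_contra h'
    push Not at h'
    linarith [(cc_pos h').1]
  by_contra hc
  push Not at hc
  obtain ⟨a1, a2, a3⟩ := cc_neg (show cc w p q r < 0 by omega)
  have hX0 : 0 ≤ cr (q - p) (z - q) := by
    by_contra h'
    push Not at h'
    have := cc_neg_one a1 hz h'
    omega
  have hY0 : 0 ≤ cr (q - z) (r - q) := by
    by_contra h'
    push Not at h'
    have := cc_neg_one hz a2 h'
    omega
  have k1 := mul_nonneg hX0 (sub_pos.2 a2).le
  have k2 := mul_nonneg hY0 (sub_pos.2 a1).le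
  have k3 := mul_pos (neg_pos.2 a3) (sub_pos.2 hz)
  nlinarith

/-- Total contribution. -/
noncomputable def CC (w : ℝ × ℝ) (n : ℕ) (v : ℕ → ℝ × ℝ) : ℤ :=
  ∑ i ∈ Finset.range n, cc w (v i) (v (i + 1)) (v (i + 2))

lemma CC_shift (w : ℝ × ℝ) {n : ℕ} {v : ℕ → ℝ × ℝ} (h : Simp n v) (s : ℕ) :
    CC w n (fun i => v (i + s)) = CC w n v := by
  have := sum_per (n := n) (fun i => cc w (v i) (v (i + 1)) (v (i + 2)))
    (fun i => by rw [h.per, show i + n + 1 = i + 1 + n by omega, h.per,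
      show i + n + 2 = i + 2 + n by omega, h.per]) s
  rw [CC, CC, ← this]
  apply Finset.sum_congr rfl
  intro i _
  rw [show i + 1 + s = i + s + 1 by omega, show i + 2 + s = i + s + 2 by omega]

lemma CC_part (w : ℝ × ℝ) (u : ℕ → ℝ × ℝ) (K : ℕ) :
    CC w (K + 1 + 1) (part u (K + 1)) =
      ∑ i ∈ Finset.range K, cc w (u i) (u (i + 1)) (u (i + 2)) +
        cc w (u K) (u (K + 1)) (u 0) + cc w (u (K + 1)) (u 0) (u 1) := by
  rw [CC, Finset.sum_range_succ, Finset.sum_range_succ]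
  congr 1
  · congr 1
    · apply Finset.sum_congr rfl
      intro i hi
      rw [Finset.mem_range] at hi
      rw [part_le u (by omega), part_le u (by omega), part_le u (by omega)]
    · rw [part_le u (by omega), part_le u (by omega), part_succ]
  · rw [part_le u (by omega), part_succ, show K + 1 + 2 = 1 + (K + 1 + 1) by omega, part_wrap,
      part_le u (by omega)]

lemma CC_split (w : ℝ × ℝ) {K M : ℕ} {u : ℕ → ℝ × ℝ}
    (per : ∀ i, u (i + (K + 1 + M + 1)) = u i) (hne : dt w (u 0) ≠ dt w (u (K + 1))) :
    CC w (K + 1 + 1) (part u (K + 1)) + CC w (M + 1 + 1) (part (fun i => u (i + (K + 1))) (M + 1)) - 1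
      ≤ CC w (K + 1 + M + 1) u := by
  rw [CC_part, CC_part]
  have e0 : u (M + 1 + (K + 1)) = u 0 := by
    rw [show M + 1 + (K + 1) = 0 + (K + 1 + M + 1) by omega, per]
  have hC : CC w (K + 1 + M + 1) u = ∑ i ∈ Finset.range K, cc w (u i) (u (i + 1)) (u (i + 2)) +
      cc w (u K) (u (K + 1)) (u (K + 2)) +
      ∑ i ∈ Finset.range M, cc w (u (i + (K + 1))) (u (i + 1 + (K + 1))) (u (i + 2 + (K + 1))) +
      cc w (u (M + (K + 1))) (u 0) (u 1) := by
    rw [CC, Finset.sum_range_succ, Finset.sum_range_add, Finset.sum_range_succ]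
    congr 1
    · congr 1
      apply Finset.sum_congr rfl
      intro i _
      rw [show K + 1 + i = i + (K + 1) by omega, show i + (K + 1) + 1 = i + 1 + (K + 1) by omega,
        show i + (K + 1) + 2 = i + 2 + (K + 1) by omega]
    · rw [show K + 1 + M = M + (K + 1) by omega, show M + (K + 1) + 1 = M + 1 + (K + 1) by omega, e0,
        show M + (K + 1) + 2 = 1 + (K + 1 + M + 1) by omega, per]
  rw [hC]
  simp only [e0, Nat.zero_add, show 1 + (K + 1) = K + 2 by omega]
  rcases lt_or_gt_of_ne hne with h | h
  · have l1 := cc_lt (p := u K) (r := u (K + 2)) h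
    have l2 := cc_gt (p := u (M + (K + 1))) (r := u 1) h
    linarith
  · have l1 := cc_gt (p := u K) (r := u (K + 2)) h
    have l2 := cc_lt (p := u (M + (K + 1))) (r := u 1) h
    linarith

lemma CC_base (w : ℝ × ℝ) {v : ℕ → ℝ × ℝ} (h : Simp 3 v) (ha : 0 < ar 3 v)
    (hw : ∀ i j, v i ≠ v j → dt w (v i) ≠ dt w (v j)) : 1 ≤ CC w 3 v := by
  have h30 : v 3 = v 0 := h.per 0
  have h41 : v 4 = v 1 := h.per 1
  rw [ar3 v h30] at ha
  have n01 := hw 0 1 (h.inj (by omega) (by omega))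
  have n12 := hw 1 2 (h.inj (by omega) (by omega))
  have n02 := hw 0 2 (h.inj (by omega) (by omega))
  have d1 : 0 < cr (v 2 - v 1) (v 0 - v 2) := by
    simp only [cr, Prod.fst_sub, Prod.snd_sub] at ha ⊢; linarith
  have d2 : 0 < cr (v 0 - v 2) (v 1 - v 0) := by
    simp only [cr, Prod.fst_sub, Prod.snd_sub] at ha ⊢; linarith
  simp only [CC, Finset.sum_range_succ, Finset.sum_range_zero, Nat.zero_add, Nat.reduceAdd, h30, h41]
  have nn : ∀ p q r, 0 < cr (q - p) (r - q) → 0 ≤ cc w p q r := by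
    intro p q r h'
    by_contra h''
    push Not at h''
    linarith [(cc_neg h'').2.2]
  have k0 := nn _ _ _ ha
  have k1 := nn _ _ _ d1
  have k2 := nn _ _ _ d2
  by_cases m0 : dt w (v 1) < dt w (v 0) ∧ dt w (v 2) < dt w (v 0)
  · have := cc_one m0.2 m0.1 d2
    omega
  by_cases m1 : dt w (v 0) < dt w (v 1) ∧ dt w (v 2) < dt w (v 1)
  · have := cc_one m1.1 m1.2 ha
    omega
  have m2 : dt w (v 1) < dt w (v 2) ∧ dt w (v 0) < dt w (v 2) := by
    rcases lt_or_gt_of_ne n01 with a | a <;> rcases lt_or_gt_of_ne n12 with b | b <;>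
      rcases lt_or_gt_of_ne n02 with c | c <;>
      first
        | exact ⟨b, c⟩
        | exact (m0 ⟨a, c⟩).elim
        | exact (m1 ⟨a, b⟩).elim
        | (exfalso; linarith)
  have := cc_one m2.1 m2.2 d1
  omega

theorem Simp.CC_ge (w : ℝ × ℝ) {n : ℕ} : ∀ {v : ℕ → ℝ × ℝ}, Simp n v → 0 < ar n v →
    (∀ i j, v i ≠ v j → dt w (v i) ≠ dt w (v j)) → 1 ≤ CC w n v := by
  induction n using Nat.strong_induction_on with
  | _ n IH =>
    intro v h ha hw
    by_cases h3 : n = 3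
    · subst h3; exact CC_base w h ha hw
    have h3' := h.three
    obtain ⟨s, k, dg, hpos⟩ := h.split' (by omega)
    have hlo := dg.lo
    have hhi := dg.hi
    have hu := h.shift s
    have har := dg.area hu
    rw [ar_shift h s] at har
    rw [← CC_shift w h s]
    have hA : 0 < ar (k + 1) (part (fun i => v (i + s)) k) ∧
        0 < ar (n - k + 1) (part2 n (fun i => v (i + s)) k) := by
      rcases mul_pos_iff.1 hpos with h' | h'
      · exact h'
      · linarith [h'.1, h'.2]
    have I1 := IH (k + 1) (by omega) (dg.part1 hu) hA.1 (fun i j => hw _ _)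
    have I2 := IH (n - k + 1) (by omega) (dg.part2 hu) hA.2 (fun i j => hw _ _)
    have hper := hu.per
    have hne := hw _ _ (hu.inj (i := 0) (j := k) (by omega) (by omega))
    obtain ⟨K, rfl⟩ : ∃ K, k = K + 1 := ⟨k - 1, by omega⟩
    obtain ⟨M, rfl⟩ : ∃ M, n = K + 1 + M + 1 := ⟨n - K - 2, by omega⟩
    have := CC_split w (u := fun i => v (i + s)) hper hne
    rw [show K + 1 + M + 1 - (K + 1) + 1 = M + 1 + 1 by omega] at I2
    rw [part2, show K + 1 + M + 1 - (K + 1) = M + 1 by omega] at I2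
    linarith

end FunnelLB


namespace FunnelLB

/-- turn at vertex `i+1` -/
def tn (v : ℕ → ℝ × ℝ) (i : ℕ) : ℝ := cr (v (i + 1) - v i) (v (i + 2) - v (i + 1))

/-- Normalised funnel sequences: base from the origin along the positive axis. -/
structure FS (n : ℕ) (v : ℕ → ℝ × ℝ) (m : ℕ) : Prop where
  S : Simp n v
  ar : 0 < ar n v
  v0 : v 0 = (0, 0)
  v1y : (v 1).2 = 0
  v1x : 0 < (v 1).1
  m2 : 2 ≤ m
  mn : m < n
  t0 : 0 < tn v 0
  tn : 0 < tn v (n - 1)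
  t : ∀ i < n, i ≠ 0 → i ≠ n - 1 → i ≠ m - 1 → FunnelLB.tn v i ≤ 0

namespace FS
variable {n m : ℕ} {v : ℕ → ℝ × ℝ}

lemma vn (h : FS n v m) : v n = v 0 := by
  have := h.S.per 0; rwa [Nat.zero_add] at this

lemma vn1 (h : FS n v m) : v (n + 1) = v 1 := by
  have := h.S.per 1; rwa [Nat.add_comm] at this

lemma y2 (h : FS n v m) : 0 < (v 2).2 := by
  have := h.t0
  simp only [FunnelLB.tn, cr, Nat.zero_add, Prod.fst_sub, Prod.snd_sub, h.v0, h.v1y] at this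
  have h1 := h.v1x
  have : 0 < (v 1).1 * (v 2).2 := by linarith
  exact (pos_iff_pos_of_mul_pos this).1 h1

lemma yn (h : FS n v m) : 0 < (v (n - 1)).2 := by
  have h3 := h.S.three
  have := h.tn
  rw [FunnelLB.tn, show n - 1 + 1 = n by omega, show n - 1 + 2 = n + 1 by omega, h.vn, h.vn1] at this
  simp only [cr, Prod.fst_sub, Prod.snd_sub, h.v0, h.v1y] at this
  have h1 := h.v1x
  have : 0 < (v 1).1 * (v (n - 1)).2 := by linarith
  exact (pos_iff_pos_of_mul_pos this).1 h1

/-- small perturbation -/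
lemma exeps (h : FS n v m) : ∃ ε > (0 : ℝ), ∀ i j, (v i).2 < (v j).2 →
    (v i).2 + ε * (v i).1 < (v j).2 + ε * (v j).1 ∧
    (v i).2 - ε * (v i).1 < (v j).2 - ε * (v j).1 := by
  have h3 := h.S.three
  have key : ∀ᶠ ε in nhdsWithin (0 : ℝ) (Set.Ioi 0), ∀ i ∈ Finset.range n, ∀ j ∈ Finset.range n,
      (v i).2 < (v j).2 → (v i).2 + ε * (v i).1 < (v j).2 + ε * (v j).1 ∧
    (v i).2 - ε * (v i).1 < (v j).2 - ε * (v j).1 := by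
    rw [Filter.eventually_all_finset]
    intro i _
    rw [Filter.eventually_all_finset]
    intro j _
    by_cases hij : (v i).2 < (v j).2
    · have c1 : ∀ᶠ ε in nhds (0 : ℝ), (v i).2 + ε * (v i).1 < (v j).2 + ε * (v j).1 := by
        apply ContinuousAt.eventually_lt (by fun_prop) (by fun_prop)
        simpa using hij
      have c2 : ∀ᶠ ε in nhds (0 : ℝ), (v i).2 - ε * (v i).1 < (v j).2 - ε * (v j).1 := by
        apply ContinuousAt.eventually_lt (by fun_prop) (by fun_prop)
        simpa using hij
      apply Filter.Eventually.filter_mono nhdsWithin_le_nhds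
      filter_upwards [c1, c2] with ε h1 h2 _
      exact ⟨h1, h2⟩
    · exact Filter.Eventually.of_forall (fun ε h' => absurd h' hij)
  obtain ⟨ε, hk, hε⟩ := (key.and self_mem_nhdsWithin).exists
  refine ⟨ε, hε, ?_⟩
  intro i j
  rw [h.S.mod i, h.S.mod j]
  exact hk _ (Finset.mem_range.2 (Nat.mod_lt _ (by omega))) _
    (Finset.mem_range.2 (Nat.mod_lt _ (by omega)))

/-- Facts for a single generic direction refining the height. -/
lemma dir (h : FS n v m) (w : ℝ × ℝ) (hlt : ∀ i j, (v i).2 < (v j).2 → dt w (v i) < dt w (v j))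
    (hinj : ∀ i j, v i ≠ v j → dt w (v i) ≠ dt w (v j)) :
    (∀ j, 1 ≤ j → j ≤ n → j ≠ m → dt w (v j) < dt w (v m)) ∧
    (∀ i, 1 ≤ i → i < m → dt w (v i) < dt w (v (i + 1))) ∧
    (∀ i, m ≤ i → i < n → dt w (v (i + 1)) < dt w (v i)) := by
  have h3 := h.S.three
  have hm2 := h.m2
  have hmn := h.mn
  have l12 : dt w (v 1) < dt w (v 2) := hlt _ _ (by rw [h.v1y]; exact h.y2)
  have ln : dt w (v n) < dt w (v (n - 1)) := hlt _ _ (by rw [h.vn, h.v0]; exact h.yn)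
  -- the maximum
  have hmax : ∀ j, 1 ≤ j → j ≤ n → j ≠ m → dt w (v j) < dt w (v m) := by
    obtain ⟨q, hq, hqm⟩ := Finset.exists_max_image (Finset.Icc 1 n) (fun j => dt w (v j))
      ⟨1, by simp; omega⟩
    rw [Finset.mem_Icc] at hq
    have hqm' : ∀ j, 1 ≤ j → j ≤ n → dt w (v j) ≤ dt w (v q) :=
      fun j h1 h2 => hqm j (Finset.mem_Icc.2 ⟨h1, h2⟩)
    have hall : ∀ j, dt w (v j) ≤ dt w (v q) := by
      intro j
      by_cases h0 : j % n = 0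
      · rw [h.S.mod j, h0, ← h.vn]; exact hqm' n (by omega) le_rfl
      · rw [h.S.mod j]; exact hqm' _ (by omega) (Nat.mod_lt _ (by omega)).le
    have hst : ∀ j, q < j → j < q + n → dt w (v j) < dt w (v q) := fun j h1 h2 =>
      lt_of_le_of_ne (hall j) (hinj _ _ (h.S.inj h1 h2).symm)
    have hu := h.S.shift (q - 1)
    have E := hu.ext hu.rayOK w (by
      intro j hj2 hjn
      rw [show 1 + (q - 1) = q by omega]
      exact hst _ (by omega) (by omega))
    rw [ar_shift h.S] at E
    have E' : 0 < FunnelLB.tn v (q - 1) := by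
      have := (pos_iff_pos_of_mul_pos E).1 h.ar
      simp only [FunnelLB.tn]
      rw [show q - 1 + 1 = 1 + (q - 1) by omega, show q - 1 + 2 = 2 + (q - 1) by omega]
      simpa using this
    have hqm : q = m := by
      by_contra hne
      by_cases h1 : q = 1
      · rw [h1] at hqm'; linarith [hqm' 2 (by omega) (by omega)]
      by_cases h2 : q = n
      · rw [h2] at hqm'; linarith [hqm' (n - 1) (by omega) (by omega)]
      linarith [h.t (q - 1) (by omega) (by omega) (by omega) (by omega)]
    subst hqm
    intro j h1 h2 h3
    refine lt_of_le_of_ne (hqm' j h1 h2) (hinj _ _ ?_)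
    rcases lt_or_gt_of_ne h3 with h' | h'
    · exact h.S.inj h' (by omega)
    · exact (h.S.inj h' (by omega)).symm
  -- no reflex local minima
  have hle : ∀ i < n, i ≠ m - 1 → cc w (v i) (v (i + 1)) (v (i + 2)) ≤ 0 := by
    intro i hi him
    by_contra hc
    push Not at hc
    obtain ⟨a1, a2, a3⟩ := cc_pos hc
    by_cases h1 : i = 0
    · subst h1; linarith
    by_cases h2 : i = n - 1
    · subst h2; rw [show n - 1 + 1 = n by omega] at a1; linarith
    have := h.t i hi h1 h2 him
    rw [FunnelLB.tn] at this
    linarith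
  have hge : ∀ i < n, i ≠ m - 1 → 0 ≤ cc w (v i) (v (i + 1)) (v (i + 2)) := by
    intro i hi him
    have hC := h.S.CC_ge w h.ar hinj
    by_contra hc
    push Not at hc
    rw [CC, ← Finset.add_sum_erase _ _ (Finset.mem_range.2 hi),
      ← Finset.add_sum_erase _ _ (Finset.mem_erase.2 ⟨Ne.symm him, Finset.mem_range.2 (by omega : m - 1 < n)⟩)] at hC
    have h1 := cc_le w (v (m - 1)) (v (m - 1 + 1)) (v (m - 1 + 2))
    have h2 : ∑ x ∈ ((Finset.range n).erase i).erase (m - 1), cc w (v x) (v (x + 1)) (v (x + 2)) ≤ 0 := by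
      apply Finset.sum_nonpos
      intro x hx
      simp only [Finset.mem_erase, Finset.mem_range] at hx
      exact hle x hx.2.2 hx.1
    omega
  have hmin : ∀ i < n, i ≠ 0 → i ≠ n - 1 → i ≠ m - 1 → dt w (v (i + 1)) < dt w (v i) →
      dt w (v (i + 1)) < dt w (v (i + 2)) → False := by
    intro i hi h1 h2 h4 a1 a2
    have hneg : ∀ p, dt (-w) p = - dt w p := by intro p; simp [dt]; ring
    have hf := h.S.fold (-w) i (by rw [hneg, hneg]; linarith) (by rw [hneg, hneg]; linarith)
    have ht := h.t i hi h1 h2 h4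
    rw [FunnelLB.tn] at ht
    have := cc_neg_one a1 a2 (lt_of_le_of_ne ht hf)
    have := hge i hi h4
    omega
  refine ⟨hmax, ?_, ?_⟩
  · -- backwards induction from m
    have : ∀ d, d + 1 < m → dt w (v (m - 1 - d)) < dt w (v (m - 1 - d + 1)) := by
      intro d
      induction d with
      | zero =>
        intro _
        rw [Nat.sub_zero, show m - 1 + 1 = m by omega]
        exact hmax _ (by omega) (by omega) (by omega)
      | succ d ih =>
        intro hd
        have ih' := ih (by omega)
        rw [show m - 1 - d = m - 1 - (d + 1) + 1 by omega] at ih'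
        by_contra hc
        refine hmin (m - 1 - (d + 1)) (by omega) (by omega) (by omega) (by omega) ?_ ih'
        exact lt_of_le_of_ne (not_lt.1 hc) (hinj _ _ (h.S.ne _).symm)
    intro i h1 h2
    have := this (m - 1 - i) (by omega)
    rwa [show m - 1 - (m - 1 - i) = i by omega] at this
  · have : ∀ d, m + d < n → dt w (v (m + d + 1)) < dt w (v (m + d)) := by
      intro d
      induction d with
      | zero =>
        intro _
        exact hmax _ (by omega) (by omega) (by omega)
      | succ d ih =>
        intro hd
        have ih' := ih (by omega)
        by_contra hc
        refine hmin (m + d) (by omega) (by omega) (by omega) (by omega) ih' ?_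
        exact lt_of_le_of_ne (not_lt.1 hc) (hinj _ _ (h.S.ne _))
    intro i h1 h2
    have := this (i - m) (by omega)
    rwa [show m + (i - m) = i by omega] at this

/-- The heights are monotone along both chains. -/
lemma mono (h : FS n v m) :
    (∀ i, 1 ≤ i → i < m → (v i).2 < (v (i + 1)).2) ∧
    (∀ i, m ≤ i → i < n → (v (i + 1)).2 < (v i).2) := by
  obtain ⟨ε, hε, hlt⟩ := h.exeps
  have inj : ∀ c : ℝ, c ≠ 0 → (∀ i j, (v i).2 < (v j).2 → dt (c, 1) (v i) < dt (c, 1) (v j)) →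
      ∀ i j, v i ≠ v j → dt (c, 1) (v i) ≠ dt (c, 1) (v j) := by
    intro c hc hl i j hij
    rcases lt_trichotomy (v i).2 (v j).2 with h1 | h1 | h1
    · exact (hl _ _ h1).ne
    · intro he
      simp only [dt, h1] at he
      apply hij
      ext
      · exact mul_left_cancel₀ hc (by linarith)
      · exact h1
    · exact (hl _ _ h1).ne'
  have l1 : ∀ i j, (v i).2 < (v j).2 → dt (ε, 1) (v i) < dt (ε, 1) (v j) := by
    intro i j hij; have := (hlt i j hij).1; simp only [dt]; linarith
  have l2 : ∀ i j, (v i).2 < (v j).2 → dt (-ε, 1) (v i) < dt (-ε, 1) (v j) := by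
    intro i j hij; have := (hlt i j hij).2; simp only [dt]; linarith
  obtain ⟨-, a1, a2⟩ := h.dir _ l1 (inj _ hε.ne' l1)
  obtain ⟨-, b1, b2⟩ := h.dir _ l2 (inj _ (by linarith) l2)
  constructor
  · intro i h1 h2
    have x1 := a1 i h1 h2
    have x2 := b1 i h1 h2
    simp only [dt] at x1 x2
    linarith
  · intro i h1 h2
    have x1 := a2 i h1 h2
    have x2 := b2 i h1 h2
    simp only [dt] at x1 x2
    linarith

end FS

end FunnelLB


namespace FunnelLB

/-- Concave piecewise linear function through a chain. -/
lemma chain {a : ℕ} (ha : 0 < a) {y x s : ℕ → ℝ} (ym : ∀ i < a, y i < y (i + 1))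
    (sm : ∀ i, i + 1 < a → s (i + 1) ≤ s i)
    (xs : ∀ i < a, x (i + 1) = x i + s i * (y (i + 1) - y i)) :
    ∃ f : ℝ → ℝ, Continuous f ∧ (∀ i < a, ∀ t, f t ≤ x i + s i * (t - y i)) ∧
      ∀ i < a, ∀ t, y i ≤ t → t ≤ y (i + 1) → f t = x i + s i * (t - y i) := by
  have hne : (Finset.range a).Nonempty := ⟨0, by simpa using ha⟩
  have step : ∀ i, i + 1 < a → ∀ t,
      (x (i + 1) + s (i + 1) * (t - y (i + 1))) - (x i + s i * (t - y i)) =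
        (s i - s (i + 1)) * (y (i + 1) - t) := by
    intro i hi t; rw [xs i (by omega)]; ring
  have up : ∀ i k, i ≤ k → k < a → ∀ t, t ≤ y (i + 1) →
      x i + s i * (t - y i) ≤ x k + s k * (t - y k) := by
    intro i k hik
    induction k, hik using Nat.le_induction with
    | base => intro _ t _; exact le_rfl
    | succ k hk ih =>
      intro hka t ht
      have h1 := ih (by omega) t ht
      have h2 := step k hka t
      have hy : y (i + 1) ≤ y (k + 1) := by
        clear ih h1 h2
        induction k, hk using Nat.le_induction with
        | base => exact le_rfl
        | succ k hk ih => exact (ih (by omega)).trans (ym (k + 1) (by omega)).le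
      have := mul_nonneg (sub_nonneg.2 (sm k hka)) (sub_nonneg.2 (ht.trans hy))
      linarith
  have dn : ∀ i k, k ≤ i → i < a → ∀ t, y i ≤ t →
      x i + s i * (t - y i) ≤ x k + s k * (t - y k) := by
    intro i k hki
    induction i, hki using Nat.le_induction with
    | base => intro _ t _; exact le_rfl
    | succ i hi ih =>
      intro hia t ht
      have h1 := ih (by omega) t ((ym i (by omega)).le.trans ht)
      have h2 := step i hia t
      have := mul_nonneg (sub_nonneg.2 (sm i hia)) (sub_nonneg.2 ht)
      linarith
  refine ⟨fun t => (Finset.range a).inf' hne (fun i => x i + s i * (t - y i)), ?_, ?_, ?_⟩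
  · apply Continuous.finset_inf'_apply
    intro i _; fun_prop
  · intro i hi t
    exact Finset.inf'_le _ (Finset.mem_range.2 hi)
  · intro i hi t h1 h2
    apply le_antisymm
    · exact Finset.inf'_le _ (Finset.mem_range.2 hi)
    · apply Finset.le_inf'
      intro k hk
      rw [Finset.mem_range] at hk
      rcases le_total i k with hik | hik
      · exact up i k hik hk t h2
      · exact dn i k hik hi t h1

/-- point on an edge from its height -/
lemma seg_of_height {p q : ℝ × ℝ} {s t : ℝ} (hpq : p.2 < q.2) (hs : q.1 = p.1 + s * (q.2 - p.2))
    (h0 : p.2 ≤ t) (h1 : t ≤ q.2) : (p.1 + s * (t - p.2), t) ∈ segment ℝ p q := by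
  have hd : 0 < q.2 - p.2 := by linarith
  rw [mem_seg]
  refine ⟨(t - p.2) / (q.2 - p.2), div_nonneg (by linarith) hd.le, (div_le_one hd).2 (by linarith), ?_⟩
  ext
  · simp only [Prod.fst_add, Prod.smul_fst, smul_eq_mul]
    rw [hs]; field_simp; ring
  · simp only [Prod.snd_add, Prod.smul_snd, smul_eq_mul]
    field_simp; ring

lemma height_of_seg {p q z : ℝ × ℝ} {s : ℝ} (hpq : p.2 < q.2) (hs : q.1 = p.1 + s * (q.2 - p.2))
    (hz : z ∈ segment ℝ p q) : p.2 ≤ z.2 ∧ z.2 ≤ q.2 ∧ z.1 = p.1 + s * (z.2 - p.2) := by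
  obtain ⟨t, h0, h1, rfl⟩ := mem_seg.1 hz
  simp only [Prod.fst_add, Prod.smul_fst, smul_eq_mul, Prod.snd_add, Prod.smul_snd]
  refine ⟨by nlinarith, by nlinarith, ?_⟩
  rw [hs]; ring

theorem FS.exists_FD {n m : ℕ} {v : ℕ → ℝ × ℝ} (h : FS n v m) :
    ∃ F : FD, F.a = n - m ∧ F.b = m - 1 ∧ (∀ i, F.l i = v (n - i)) ∧ (∀ j, F.r j = v (1 + j)) ∧
      Continuous F.f ∧ Continuous F.g := by
  have h3 := h.S.three
  have hm2 := h.m2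
  have hmn := h.mn
  obtain ⟨mr, ml⟩ := h.mono
  -- left chain
  let yl : ℕ → ℝ := fun i => (v (n - i)).2
  let xl : ℕ → ℝ := fun i => (v (n - i)).1
  let sl : ℕ → ℝ := fun i => (xl (i + 1) - xl i) / (yl (i + 1) - yl i)
  have ylm : ∀ i < n - m, yl i < yl (i + 1) := by
    intro i hi
    have := ml (n - (i + 1)) (by omega) (by omega)
    rw [show n - (i + 1) + 1 = n - i by omega] at this
    exact this
  have xls : ∀ i < n - m, xl (i + 1) = xl i + sl i * (yl (i + 1) - yl i) := by
    intro i hi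
    have := sub_pos.2 (ylm i hi)
    simp only [sl]; rw [div_mul_cancel₀ _ this.ne']; ring
  have slm : ∀ i, i + 1 < n - m → sl (i + 1) ≤ sl i := by
    intro i hi
    have d0 := sub_pos.2 (ylm i (by omega))
    have d1 := sub_pos.2 (ylm (i + 1) hi)
    have ht := h.t (n - (i + 1 + 1)) (by omega) (by omega) (by omega) (by omega)
    rw [FunnelLB.tn, show n - (i + 1 + 1) + 1 = n - (i + 1) by omega,
      show n - (i + 1 + 1) + 2 = n - i by omega] at ht
    simp only [sl]
    rw [div_le_div_iff₀ d1 d0]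
    simp only [cr, Prod.fst_sub, Prod.snd_sub] at ht
    simp only [xl, yl]
    linarith
  -- right chain
  let yr : ℕ → ℝ := fun i => (v (1 + i)).2
  let xr : ℕ → ℝ := fun i => (v (1 + i)).1
  let sr : ℕ → ℝ := fun i => (xr (i + 1) - xr i) / (yr (i + 1) - yr i)
  have yrm : ∀ i < m - 1, yr i < yr (i + 1) := by
    intro i hi
    exact mr (1 + i) (by omega) (by omega)
  have xrs : ∀ i < m - 1, xr (i + 1) = xr i + sr i * (yr (i + 1) - yr i) := by
    intro i hi
    have := sub_pos.2 (yrm i hi)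
    simp only [sr]; rw [div_mul_cancel₀ _ this.ne']; ring
  have srm : ∀ i, i + 1 < m - 1 → sr i ≤ sr (i + 1) := by
    intro i hi
    have d0 := sub_pos.2 (yrm i (by omega))
    have d1 := sub_pos.2 (yrm (i + 1) hi)
    have ht := h.t (1 + i) (by omega) (by omega) (by omega) (by omega)
    rw [FunnelLB.tn, show 1 + i + 1 = 1 + (i + 1) by omega,
      show 1 + i + 2 = 1 + (i + 1 + 1) by omega] at ht
    simp only [sr]
    rw [div_le_div_iff₀ d0 d1]
    simp only [cr, Prod.fst_sub, Prod.snd_sub] at ht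
    simp only [xr, yr]
    linarith
  obtain ⟨f, fc, f_le, f_eq⟩ := chain (show 0 < n - m by omega) ylm slm xls
  obtain ⟨g', gc, g_le, g_eq⟩ := chain (show 0 < m - 1 by omega) (y := yr) (x := fun i => - xr i)
    (s := fun i => - sr i) yrm (fun i hi => by have := srm i hi; linarith)
    (fun i hi => by rw [xrs i hi]; ring)
  have yl0 : yl 0 = 0 := by simp only [yl, Nat.sub_zero, h.vn, h.v0]
  have xl0 : xl 0 = 0 := by simp only [xl, Nat.sub_zero, h.vn, h.v0]
  have yr0 : yr 0 = 0 := by simp only [yr, Nat.add_zero, h.v1y]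
  have yla : yl (n - m) = (v m).2 := by simp only [yl, show n - (n - m) = m by omega]
  have xla : xl (n - m) = (v m).1 := by simp only [xl, show n - (n - m) = m by omega]
  have yrb : yr (m - 1) = (v m).2 := by simp only [yr, show 1 + (m - 1) = m by omega]
  have xrb : xr (m - 1) = (v m).1 := by simp only [xr, show 1 + (m - 1) = m by omega]
  have coverl : ∀ t, 0 ≤ t → t ≤ (v m).2 → ∃ i < n - m, yl i ≤ t ∧ t ≤ yl (i + 1) := by
    intro t h0 h1
    by_contra hc
    push Not at hc
    have : ∀ i ≤ n - m, yl i ≤ t ∧ (0 < i → yl i < t) := by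
      intro i
      induction i with
      | zero => intro _; exact ⟨by rw [yl0]; exact h0, fun h' => absurd h' (by omega)⟩
      | succ i ih => intro hi; have := hc i (by omega) (ih (by omega)).1; exact ⟨this.le, fun _ => this⟩
    have := (this (n - m) le_rfl).2 (by omega)
    rw [yla] at this; linarith
  have coverr : ∀ t, 0 ≤ t → t ≤ (v m).2 → ∃ i < m - 1, yr i ≤ t ∧ t ≤ yr (i + 1) := by
    intro t h0 h1
    by_contra hc
    push Not at hc
    have : ∀ i ≤ m - 1, yr i ≤ t ∧ (0 < i → yr i < t) := by
      intro i
      induction i with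
      | zero => intro _; exact ⟨by rw [yr0]; exact h0, fun h' => absurd h' (by omega)⟩
      | succ i ih => intro hi; have := hc i (by omega) (ih (by omega)).1; exact ⟨this.le, fun _ => this⟩
    have := (this (m - 1) le_rfl).2 (by omega)
    rw [yrb] at this; linarith
  have f0 : f 0 = 0 := by
    have hl := ylm 0 (by omega)
    rw [f_eq 0 (by omega) 0 (by rw [yl0]) (by linarith), xl0, yl0]; ring
  have g0 : - g' 0 = (v 1).1 := by
    have hl := yrm 0 (by omega)
    rw [g_eq 0 (by omega) 0 (by rw [yr0]) (by linarith), yr0]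
    simp only [xr, Nat.add_zero]; ring
  have fh : f (v m).2 = (v m).1 := by
    have hl := ylm (n - m - 1) (by omega)
    have hx := xls (n - m - 1) (by omega)
    have := f_eq (n - m - 1) (by omega) (v m).2
    rw [show n - m - 1 + 1 = n - m by omega, yla] at this hl hx
    rw [this hl.le le_rfl, ← hx, xla]
  have gh : - g' (v m).2 = (v m).1 := by
    have hl := yrm (m - 1 - 1) (by omega)
    have hx := xrs (m - 1 - 1) (by omega)
    have := g_eq (m - 1 - 1) (by omega) (v m).2
    rw [show m - 1 - 1 + 1 = m - 1 by omega, yrb] at this hl hx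
    rw [this hl.le le_rfl]
    linarith
  have fg : ∀ y, 0 ≤ y → y < (v m).2 → f y < - g' y := by
    intro y h0 hy
    by_contra hc
    push Not at hc
    have hx1 := h.v1x
    obtain ⟨t, ht, he⟩ := intermediate_value_Icc (f := fun y => f y + g' y) h0
      (by fun_prop) (show (0 : ℝ) ∈ _ from ⟨by linarith, by linarith⟩)
    simp only at he
    have htm : t < (v m).2 := lt_of_le_of_lt ht.2 hy
    obtain ⟨i, hi, i1, i2⟩ := coverl t ht.1 htm.le
    obtain ⟨j, hj, j1, j2⟩ := coverr t ht.1 htm.le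
    have z1 := seg_of_height (p := v (n - i)) (q := v (n - (i + 1))) (s := sl i) (t := t)
      (ylm i hi) (xls i hi) i1 i2
    have z2 := seg_of_height (p := v (1 + j)) (q := v (1 + (j + 1))) (s := sr j) (t := t)
      (yrm j hj) (xrs j hj) j1 j2
    have e1 := f_eq i hi t i1 i2
    have e2 := g_eq j hj t j1 j2
    have e : (v (1 + j)).1 + sr j * (t - (v (1 + j)).2) = (v (n - i)).1 + sl i * (t - (v (n - i)).2) := by
      simp only [xl, yl, xr, yr] at e1 e2; linarith
    rw [e] at z2
    rw [segment_symm] at z1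
    have z1' := z1
    rw [show n - i = n - (i + 1) + 1 by omega] at z1
    rw [show 1 + (j + 1) = 1 + j + 1 by omega] at z2
    have z1'' : ((v (n - i)).1 + sl i * (t - (v (n - i)).2), t) ∈ seg v (n - (i + 1)) := by
      rw [seg, show n - (i + 1) + 1 = n - i by omega]; exact z1'
    rcases h.S.sep (1 + j) (n - (i + 1)) (by omega) (by omega) _ z2 z1'' with ⟨k1, k2⟩ | ⟨k1, k2⟩
    · have : n - (i + 1) = m := by omega
      rw [this] at k2
      have := congrArg Prod.snd k2
      simp only at this
      linarith
    · omega
  have slope' : sr (m - 1 - 1) ≤ sl (n - m - 1) := by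
    have hl := ylm (n - m - 1) (by omega)
    have hr := yrm (m - 1 - 1) (by omega)
    have hx := xls (n - m - 1) (by omega)
    have hx' := xrs (m - 1 - 1) (by omega)
    have fe := f_eq (n - m - 1) (by omega)
    have ge := g_eq (m - 1 - 1) (by omega)
    rw [show n - m - 1 + 1 = n - m by omega, yla] at hl hx fe
    rw [show m - 1 - 1 + 1 = m - 1 by omega, yrb] at hr hx' ge
    rw [xla] at hx
    rw [xrb] at hx'
    have hyl : 0 ≤ max (yl (n - m - 1)) 0 := le_max_right _ _
    set y := max (max (yl (n - m - 1)) 0) (yr (m - 1 - 1)) with hy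
    have hpos : (0 : ℝ) < (v m).2 := by
      have := coverl
      by_contra hc
      have h1 := mr 1 le_rfl (by omega)
      have : ∀ d, 1 + d ≤ m → 0 ≤ (v (1 + d)).2 ∧ (0 < d → 0 < (v (1 + d)).2) := by
        intro d
        induction d with
        | zero => intro _; simp [h.v1y]
        | succ d ih =>
          intro hd
          have h1 := mr (1 + d) (by omega) (by omega)
          have h2 := (ih (by omega)).1
          rw [show 1 + d + 1 = 1 + (d + 1) by omega] at h1
          exact ⟨by linarith, fun _ => by linarith⟩
      have := (this (m - 1) (by omega)).2 (by omega)
      rw [show 1 + (m - 1) = m by omega] at this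
      exact hc this
    have hyh : y < (v m).2 := max_lt (max_lt hl hpos) hr
    have hy0 : 0 ≤ y := hyl.trans (le_max_left _ _)
    have hfg := fg y hy0 hyh
    rw [fe y ((le_max_left _ _).trans (le_max_left _ _)) hyh.le, ge y (le_max_right _ _) hyh.le] at hfg
    have : 0 < (sl (n - m - 1) - sr (m - 1 - 1)) * ((v m).2 - y) := by nlinarith
    have := (pos_iff_pos_of_mul_pos this).2 (by linarith)
    linarith
  have slmono : ∀ i d, i + d < n - m → sl (i + d) ≤ sl i := by
    intro i d
    induction d with
    | zero => intro _; exact le_rfl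
    | succ d ih => intro hd; exact (slm (i + d) (by omega)).trans (ih (by omega))
  have srmono : ∀ i d, i + d < m - 1 → sr i ≤ sr (i + d) := by
    intro i d
    induction d with
    | zero => intro _; exact le_rfl
    | succ d ih => intro hd; exact (ih (by omega)).trans (srm (i + d) (by omega))
  refine ⟨{ a := n - m, b := m - 1, ha := by omega, hb := by omega, h := (v m).2, yl := yl, xl := xl, sl := sl, yr := yr, xr := xr, sr := sr, f := f, g := fun y => - g' y, yl0 := yl0, yla := yla, ylm := ylm, slm := slm, xls := xls, f_le := fun i hi y _ _ => f_le i hi y, f_eq := f_eq, yr0 := yr0, yrb := yrb, yrm := yrm, srm := srm, xrs := xrs, g_ge := ?_, g_eq := ?_, fg := fg, fgh := by rw [fh, gh], slope := ?_ }, rfl, rfl, fun i => rfl, fun j => rfl, fc, gc.neg⟩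
  · intro i hi y _ _
    have := g_le i hi y
    linarith
  · intro i hi y h1 h2
    rw [g_eq i hi y h1 h2]; ring
  · intro i hi j hj
    have s1 := slmono i (n - m - 1 - i) (by omega)
    have s2 := srmono j (m - 1 - 1 - j) (by omega)
    rw [show i + (n - m - 1 - i) = n - m - 1 by omega] at s1
    rw [show j + (m - 1 - 1 - j) = m - 1 - 1 by omega] at s2
    linarith

end FunnelLB


namespace FunnelLB

/-- boundary of the normalised funnel -/
def FD.bd (F : FD) : Set (ℝ × ℝ) :=
  {p | (p.2 = 0 ∧ F.f 0 ≤ p.1 ∧ p.1 ≤ F.g 0) ∨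
    (0 ≤ p.2 ∧ p.2 ≤ F.h ∧ (p.1 = F.f p.2 ∨ p.1 = F.g p.2))}

lemma FD.h_pos' (F : FD) : 0 < F.h := by
  have h1 := F.ylm 0 F.ha
  rw [F.yl0] at h1
  exact h1.trans_le (F.yl_le_h (by have := F.ha; omega))

lemma FD.bd_sub (F : FD) : F.bd ⊆ F.R := by
  have hp := F.h_pos'
  rintro p (⟨h0, h1, h2⟩ | ⟨h0, h1, h2⟩)
  · rw [F.mem_R, h0]; exact ⟨le_rfl, hp.le, h1, h2⟩
  · have := F.f_le_g h0 h1
    rw [F.mem_R]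
    rcases h2 with e | e <;> rw [e]
    · exact ⟨h0, h1, le_rfl, this⟩
    · exact ⟨h0, h1, this, le_rfl⟩

lemma FD.int_of (F : FD) {p : ℝ × ℝ} (hp : p ∈ F.R) (hb : p ∉ F.bd) :
    0 < p.2 ∧ p.2 < F.h ∧ F.f p.2 < p.1 ∧ p.1 < F.g p.2 := by
  obtain ⟨h0, h1, h2, h3⟩ := hp
  have n1 : p.2 ≠ 0 := by
    intro e; apply hb; left; rw [e] at h2 h3; exact ⟨e, h2, h3⟩
  have n2 : p.1 ≠ F.f p.2 := fun e => hb (Or.inr ⟨h0, h1, Or.inl e⟩)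
  have n3 : p.1 ≠ F.g p.2 := fun e => hb (Or.inr ⟨h0, h1, Or.inr e⟩)
  refine ⟨lt_of_le_of_ne h0 n1.symm, lt_of_le_of_ne h1 ?_, lt_of_le_of_ne h2 n2.symm,
    lt_of_le_of_ne h3 n3⟩
  intro e
  rw [e] at h2 h3 n2
  have := F.fgh
  apply n2; linarith

lemma FD.closed_R (F : FD) (cf : Continuous F.f) (cg : Continuous F.g) : IsClosed F.R := by
  have : F.R = {p | 0 ≤ p.2} ∩ ({p | p.2 ≤ F.h} ∩ ({p | F.f p.2 ≤ p.1} ∩ {p | p.1 ≤ F.g p.2})) := by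
    ext p; exact F.mem_R
  rw [this]
  refine (isClosed_le (by fun_prop) (by fun_prop)).inter
    ((isClosed_le (by fun_prop) (by fun_prop)).inter
    ((isClosed_le (by fun_prop) (by fun_prop)).inter (isClosed_le (by fun_prop) (by fun_prop))))

lemma FD.comp_R (F : FD) (cf : Continuous F.f) (cg : Continuous F.g) : IsCompact F.R := by
  have hK : IsCompact ((fun q : ℝ × ℝ => ((1 - q.1) * F.f q.2 + q.1 * F.g q.2, q.2)) ''
      (Set.Icc 0 1 ×ˢ Set.Icc 0 F.h)) :=
    (isCompact_Icc.prod isCompact_Icc).image (by fun_prop)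
  apply hK.of_isClosed_subset (F.closed_R cf cg)
  rintro ⟨x, y⟩ ⟨h0, h1, h2, h3⟩
  simp only at h0 h1 h2 h3
  by_cases he : F.f y = F.g y
  · exact ⟨(0, y), ⟨⟨le_rfl, zero_le_one⟩, h0, h1⟩, by ext <;> simp; linarith⟩
  · have hd : 0 < F.g y - F.f y := by
      rcases lt_or_eq_of_le (h2.trans h3) with h | h
      · linarith
      · exact absurd h he
    refine ⟨((x - F.f y) / (F.g y - F.f y), y),
      ⟨⟨div_nonneg (by linarith) hd.le, (div_le_one hd).2 (by linarith)⟩, h0, h1⟩, ?_⟩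
    ext
    · simp only; field_simp; ring
    · rfl

/-- Connected sets avoiding the boundary and meeting the region stay inside. -/
lemma FD.conn_in (F : FD) (cf : Continuous F.f) (cg : Continuous F.g) {s : Set (ℝ × ℝ)}
    (hs : IsPreconnected s) (hb : s ⊆ F.bdᶜ) {q : ℝ × ℝ} (hq : q ∈ s) (hR : q ∈ F.R) :
    s ⊆ F.R := by
  set U : Set (ℝ × ℝ) := {p | 0 < p.2} ∩ ({p | p.2 < F.h} ∩ ({p | F.f p.2 < p.1} ∩ {p | p.1 < F.g p.2}))
  have hU : IsOpen U := by
    refine (isOpen_lt (by fun_prop) (by fun_prop)).inter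
      ((isOpen_lt (by fun_prop) (by fun_prop)).inter
      ((isOpen_lt (by fun_prop) (by fun_prop)).inter (isOpen_lt (by fun_prop) (by fun_prop))))
  have hUR : U ⊆ F.R := fun p ⟨h0, h1, h2, h3⟩ => ⟨h0.le, h1.le, h2.le, h3.le⟩
  have hV : IsOpen F.Rᶜ := (F.closed_R cf cg).isOpen_compl
  have hd : Disjoint U F.Rᶜ := Set.disjoint_compl_right_iff_subset.2 hUR
  refine (hs.subset_left_of_subset_union hU hV hd ?_ ⟨q, hq, F.int_of hR (hb hq)⟩).trans hUR
  intro p hp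
  by_cases hpR : p ∈ F.R
  · exact Or.inl (F.int_of hpR (hb hp))
  · exact Or.inr hpR

/-- Points outside can escape to infinity along a ray. -/
lemma FD.ray_out (F : FD) {q : ℝ × ℝ} (hq : q ∉ F.R) :
    ∃ d : ℝ × ℝ, d ≠ 0 ∧ ∀ t : ℝ, 0 ≤ t → q + t • d ∉ F.bd := by
  have key : ∃ d : ℝ × ℝ, d ≠ 0 ∧ ∀ t : ℝ, 0 ≤ t → q + t • d ∉ F.R := by
    rw [F.mem_R] at hq
    by_cases h0 : 0 ≤ q.2
    · by_cases h1 : q.2 ≤ F.h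
      · by_cases h2 : F.f q.2 ≤ q.1
        · have h3 : ¬ q.1 ≤ F.g q.2 := fun h => hq ⟨h0, h1, h2, h⟩
          refine ⟨(1, 0), by simp, fun t ht hm => ?_⟩
          rw [F.mem_R] at hm
          simp at hm
          apply h3; linarith [hm.2.2.2]
        · refine ⟨(-1, 0), by simp, fun t ht hm => ?_⟩
          rw [F.mem_R] at hm
          simp at hm
          apply h2; linarith [hm.2.2.1]
      · refine ⟨(0, 1), by simp, fun t ht hm => ?_⟩
        rw [F.mem_R] at hm
        simp at hm
        apply h1; linarith [hm.2.1]
    · refine ⟨(0, -1), by simp, fun t ht hm => ?_⟩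
      rw [F.mem_R] at hm
      simp at hm
      apply h0; linarith [hm.1]
  obtain ⟨d, hd, h⟩ := key
  exact ⟨d, hd, fun t ht hm => h t ht (F.bd_sub hm)⟩

lemma FS.bd_iff {n m : ℕ} {v : ℕ → ℝ × ℝ} (h : FS n v m) (F : FD) (ha : F.a = n - m)
    (hb : F.b = m - 1) (hl : ∀ i, F.l i = v (n - i)) (hr : ∀ j, F.r j = v (1 + j)) (x : ℝ × ℝ) :
    x ∈ F.bd ↔ ∃ j < n, x ∈ seg v j := by
  have h3 := h.S.three
  have hm2 := h.m2
  have hmn := h.mn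
  have hx1 := h.v1x
  have hpos := F.h_pos'
  have f0 : F.f 0 = 0 := by
    have := F.f_eq 0 F.ha 0 (by rw [F.yl0]) (by have := F.ylm 0 F.ha; rw [F.yl0] at this; exact this.le)
    have e := congrArg Prod.fst (hl 0)
    rw [Nat.sub_zero, h.vn, h.v0] at e
    simp only [FD.l] at e
    rw [this, e, F.yl0]; ring
  have g0 : F.g 0 = (v 1).1 := by
    have := F.g_eq 0 F.hb 0 (by rw [F.yr0]) (by have := F.yrm 0 F.hb; rw [F.yr0] at this; exact this.le)
    have e := congrArg Prod.fst (hr 0)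
    simp only [FD.r] at e
    rw [this, e, F.yr0]; ring
  constructor
  · rintro (⟨h0, h1, h2⟩ | ⟨h0, h1, h2 | h2⟩)
    · refine ⟨0, by omega, ?_⟩
      rw [f0] at h1
      rw [g0] at h2
      rw [seg, mem_seg]
      refine ⟨x.1 / (v 1).1, by positivity, (div_le_one hx1).2 h2, ?_⟩
      ext
      · simp [h.v0]; field_simp
      · simp [h.v0, h.v1y, h0]
    · obtain ⟨i, -, hi, i1, i2⟩ := F.cover (i0 := 0) F.ha (by rw [F.yl0]; exact h0) h1
      refine ⟨n - (i + 1), by omega, ?_⟩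
      rw [seg, show n - (i + 1) + 1 = n - i by omega, segment_symm, ← hl, ← hl]
      have := seg_of_height (p := F.l i) (q := F.l (i + 1)) (s := F.sl i) (t := x.2)
        (F.ylm i hi) (F.xls i hi) i1 i2
      have e : x = ((F.l i).1 + F.sl i * (x.2 - (F.l i).2), x.2) := by
        ext
        · rw [h2, F.f_eq i hi x.2 i1 i2]; rfl
        · rfl
      rw [e]; exact this
    · obtain ⟨i, -, hi, i1, i2⟩ := F.mirror.cover (i0 := 0) (y := x.2) F.hb
        (by show F.yr 0 ≤ _; rw [F.yr0]; exact h0) h1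
      change i < F.b at hi
      change F.yr i ≤ x.2 at i1
      change x.2 ≤ F.yr (i + 1) at i2
      refine ⟨1 + i, by omega, ?_⟩
      rw [seg, show 1 + i + 1 = 1 + (i + 1) by omega, ← hr, ← hr]
      have := seg_of_height (p := F.r i) (q := F.r (i + 1)) (s := F.sr i) (t := x.2)
        (F.yrm i hi) (F.xrs i hi) i1 i2
      have e : x = ((F.r i).1 + F.sr i * (x.2 - (F.r i).2), x.2) := by
        ext
        · rw [h2, F.g_eq i hi x.2 i1 i2]; rfl
        · rfl
      rw [e]; exact this
  · rintro ⟨j, hj, hx⟩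
    rw [seg] at hx
    by_cases hj0 : j = 0
    · subst hj0
      left
      rw [f0, g0]
      obtain ⟨t, t0, t1, rfl⟩ := mem_seg.1 hx
      simp [h.v0, h.v1y]
      constructor
      · positivity
      · nlinarith
    · right
      by_cases hjm : j < m
      · obtain ⟨i, rfl⟩ : ∃ i, j = 1 + i := ⟨j - 1, by omega⟩
        have hi : i < F.b := by omega
        rw [show 1 + i + 1 = 1 + (i + 1) by omega, ← hr, ← hr] at hx
        obtain ⟨z1, z2, z3⟩ := height_of_seg (s := F.sr i) (F.yrm i hi) (F.xrs i hi) hx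
        refine ⟨(F.mirror.yl_nonneg (i := i) (by show i ≤ F.b; omega)).trans z1, z2.trans (F.mirror.yl_le_h (i := i + 1) (by show i + 1 ≤ F.b; omega)), Or.inr ?_⟩
        rw [z3, F.g_eq i hi _ z1 z2]; rfl
      · obtain ⟨i, hi, rfl⟩ : ∃ i, i < F.a ∧ j = n - (i + 1) := ⟨n - 1 - j, by omega, by omega⟩
        rw [show n - (i + 1) + 1 = n - i by omega, segment_symm, ← hl, ← hl] at hx
        obtain ⟨z1, z2, z3⟩ := height_of_seg (s := F.sl i) (F.ylm i hi) (F.xls i hi) hx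
        refine ⟨(F.yl_nonneg (i := i) (by omega)).trans z1, z2.trans (F.yl_le_h (i := i + 1) (by omega)), Or.inl ?_⟩
        rw [z3, F.f_eq i hi _ z1 z2]; rfl

end FunnelLB

namespace FunnelLB

/-- invertible affine change of coordinates -/
structure Sim (T S : ℝ × ℝ → ℝ × ℝ) : Prop where
  TS : ∀ q, T (S q) = q
  ST : ∀ p, S (T p) = p
  cT : Continuous T
  cS : Continuous S
  aff : ∀ p q : ℝ × ℝ, ∀ t : ℝ, T ((1 - t) • p + t • q) = (1 - t) • T p + t • T q

lemma Sim.seg_iff {T S : ℝ × ℝ → ℝ × ℝ} (H : Sim T S) (p q x : ℝ × ℝ) :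
    T x ∈ segment ℝ (T p) (T q) ↔ x ∈ segment ℝ p q := by
  rw [mem_seg, mem_seg]
  constructor
  · rintro ⟨t, h0, h1, e⟩
    refine ⟨t, h0, h1, ?_⟩
    rw [← H.aff] at e
    have := congrArg S e
    rwa [H.ST, H.ST] at this
  · rintro ⟨t, h0, h1, e⟩
    exact ⟨t, h0, h1, by rw [e, H.aff]⟩

lemma Sim.simp {T S : ℝ × ℝ → ℝ × ℝ} (H : Sim T S) {n : ℕ} {v : ℕ → ℝ × ℝ} (h : Simp n v) :
    Simp n (fun i => T (v i)) where
  three := h.three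
  per i := by simp only [h.per]
  ne i := by
    intro e
    have := congrArg S e
    simp only [H.ST] at this
    exact h.ne i this
  sep i j h1 h2 x h3 h4 := by
    have e : x = T (S x) := (H.TS x).symm
    rw [e, seg, H.seg_iff] at h3 h4
    rcases h.sep i j h1 h2 (S x) h3 h4 with ⟨a, b⟩ | ⟨a, b⟩
    · exact Or.inl ⟨a, by rw [e, b]⟩
    · exact Or.inr ⟨a, by rw [e, b]⟩

/-- The region in normalised coordinates. -/
lemma region_iff (P : SimplePolygon) {T S : ℝ × ℝ → ℝ × ℝ} (H : Sim T S) (F : FD)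
    (cf : Continuous F.f) (cg : Continuous F.g)
    (hB : ∀ x, x ∈ P.boundary ↔ T x ∈ F.bd) (p : ℝ × ℝ) : p ∈ P.region ↔ T p ∈ F.R := by
  by_cases hp : p ∈ P.boundary
  · exact ⟨fun _ => F.bd_sub ((hB p).1 hp), fun _ => Or.inl hp⟩
  have hpc : p ∈ P.boundaryᶜ := hp
  have hmem : p ∈ connectedComponentIn P.boundaryᶜ p := mem_connectedComponentIn hpc
  constructor
  · rintro (h | ⟨-, hbd⟩)
    · exact absurd h hp
    by_contra hR
    obtain ⟨d, hd, hray⟩ := F.ray_out hR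
    have hpre : IsPreconnected ((fun t : ℝ => S (T p + t • d)) '' Set.Ici 0) := by
      apply isPreconnected_Ici.image
      have := H.cS
      fun_prop
    have hsub : ((fun t : ℝ => S (T p + t • d)) '' Set.Ici 0) ⊆ P.boundaryᶜ := by
      rintro _ ⟨t, ht, rfl⟩ hx
      rw [hB, H.TS] at hx
      exact hray t ht hx
    have hin := hpre.subset_connectedComponentIn (x := p) ⟨0, Set.mem_Ici.2 le_rfl, by simp [H.ST]⟩ hsub
    have hK : IsCompact (T '' closure (connectedComponentIn P.boundaryᶜ p)) :=
      (hbd.isCompact_closure).image H.cT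
    obtain ⟨M, hM⟩ := hK.isBounded.exists_norm_le
    have hdn : 0 < ‖d‖ := norm_pos_iff.2 hd
    have hM0 : 0 ≤ M := (norm_nonneg _).trans (hM _ ⟨p, subset_closure hmem, rfl⟩)
    set t := (M + ‖T p‖ + 1) / ‖d‖ with ht
    have ht0 : 0 ≤ t := by positivity
    have h1 := hM (T p + t • d) ⟨S (T p + t • d), subset_closure (hin ⟨t, ht0, rfl⟩), H.TS _⟩
    have h2 : ‖t • d‖ ≤ ‖T p + t • d‖ + ‖T p‖ := by
      have := norm_sub_le (T p + t • d) (T p)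
      rwa [add_sub_cancel_left] at this
    rw [norm_smul, Real.norm_of_nonneg ht0, ht, div_mul_cancel₀ _ hdn.ne'] at h2
    linarith
  · intro hR
    right
    refine ⟨hp, ?_⟩
    have hpre : IsPreconnected (T '' connectedComponentIn P.boundaryᶜ p) :=
      isPreconnected_connectedComponentIn.image T H.cT.continuousOn
    have hsub : T '' connectedComponentIn P.boundaryᶜ p ⊆ F.bdᶜ := by
      rintro _ ⟨x, hx, rfl⟩ hb
      exact connectedComponentIn_subset _ _ hx ((hB x).2 hb)
    have := F.conn_in cf cg hpre hsub ⟨p, hmem, rfl⟩ hR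
    apply (((F.comp_R cf cg).image H.cS).isBounded).subset
    intro x hx
    exact ⟨T x, this ⟨x, hx, rfl⟩, H.ST x⟩

/-- Normalising similarity. -/
lemma exists_Sim (A B : ℝ × ℝ) (hAB : A ≠ B) : ∃ T S : ℝ × ℝ → ℝ × ℝ, ∃ N : ℝ, 0 < N ∧ Sim T S ∧
    T A = (0, 0) ∧ (T B).2 = 0 ∧ (T B).1 = N ∧
    (∀ p q r s, cr (T p - T q) (T r - T s) = N * cr (p - q) (r - s)) := by
  set N := (B.1 - A.1) ^ 2 + (B.2 - A.2) ^ 2 with hN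
  have hNp : 0 < N := by
    rcases lt_or_eq_of_le (show 0 ≤ N by positivity) with h | h
    · exact h
    · exfalso; apply hAB
      ext <;> nlinarith [sq_nonneg (B.1 - A.1), sq_nonneg (B.2 - A.2)]
  set D1 := B.1 - A.1
  set D2 := B.2 - A.2
  refine ⟨fun p => (D1 * (p.1 - A.1) + D2 * (p.2 - A.2), D1 * (p.2 - A.2) - D2 * (p.1 - A.1)),
    fun q => (A.1 + (D1 * q.1 - D2 * q.2) / N, A.2 + (D2 * q.1 + D1 * q.2) / N), N, hNp,
    ⟨?_, ?_, by fun_prop, by fun_prop, ?_⟩, ?_, ?_, ?_, ?_⟩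
  · intro q
    ext
    · simp only; field_simp; rw [hN]; ring
    · simp only; field_simp; rw [hN]; ring
  · intro q
    ext
    · simp only; field_simp; rw [hN]; ring
    · simp only; field_simp; rw [hN]; ring
  · intro p q t
    ext <;> simp <;> ring
  · simp
  · simp only [D1, D2]; ring
  · simp only [D1, D2, hN]; ring
  · intro p q r s
    simp only [cr, Prod.fst_sub, Prod.snd_sub, hN]; ring

/-- Signed area through differences. -/
lemma ar_tr {n : ℕ} {v : ℕ → ℝ × ℝ} (h : Simp n v) (A : ℝ × ℝ) :
    ar n v = ∑ i ∈ Finset.range n, cr (v i - A) (v (i + 1) - A) := by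
  have e : ∀ i, cr (v i - A) (v (i + 1) - A) =
      cr (v i) (v (i + 1)) - (cr A (v (i + 1)) - cr A (v i)) := by
    intro i; simp only [cr, Prod.fst_sub, Prod.snd_sub]; ring
  simp only [e]
  rw [Finset.sum_sub_distrib, Finset.sum_range_sub (fun i => cr A (v i))]
  have := h.per 0
  rw [Nat.zero_add] at this
  rw [this, ar]; ring

lemma FS_of_simp {n m : ℕ} {v : ℕ → ℝ × ℝ} (h : Simp n v) (har : 0 < ar n v) (m2 : 2 ≤ m)
    (mn : m < n) (t0 : 0 < tn v 0) (tn1 : 0 < tn v (n - 1))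
    (t : ∀ i < n, i ≠ 0 → i ≠ n - 1 → i ≠ m - 1 → tn v i ≤ 0) :
    ∃ T S, Sim T S ∧ FS n (fun i => T (v i)) m := by
  obtain ⟨T, S, N, hN, H, h0, h1, h2, hc⟩ := exists_Sim (v 0) (v 1) (h.ne 0)
  refine ⟨T, S, H, ⟨H.simp h, ?_, h0, h1, by rw [h2]; exact hN, m2, mn, ?_, ?_, ?_⟩⟩
  · rw [ar_tr (H.simp h) (T (v 0))]
    simp only [hc]
    rw [← Finset.mul_sum, ← ar_tr h]
    exact mul_pos hN har
  · simp only [tn, hc]; exact mul_pos hN t0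
  · simp only [tn, hc]; exact mul_pos hN tn1
  · intro i hi a b c
    simp only [tn, hc]
    exact mul_nonpos_of_nonneg_of_nonpos hN.le (t i hi a b c)

end FunnelLB


namespace FunnelLB

/-- periodic vertex sequence of a polygon -/
def vs (P : SimplePolygon) (i : ℕ) : ℝ × ℝ := P.vtx (Fin.ofNat P.n i)

lemma ofNat_succ (P : SimplePolygon) (i : ℕ) :
    Fin.ofNat P.n (i + 1) = Fin.ofNat P.n i + 1 := by
  apply Fin.ext
  have := P.three_le
  rw [Fin.val_add, Fin.val_ofNat, Fin.val_ofNat, Fin.val_one', Nat.add_mod]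

lemma ofNat_eq (P : SimplePolygon) (i j : ℕ) :
    Fin.ofNat P.n i = Fin.ofNat P.n j ↔ i % P.n = j % P.n := by
  rw [Fin.ext_iff, Fin.val_ofNat, Fin.val_ofNat]

lemma ofNat_val (P : SimplePolygon) (i : Fin P.n) : Fin.ofNat P.n i.val = i := by
  apply Fin.ext; rw [Fin.val_ofNat, Nat.mod_eq_of_lt i.isLt]

lemma vs_succ (P : SimplePolygon) (i : ℕ) : vs P (i + 1) = P.vtx (Fin.ofNat P.n i + 1) := by
  rw [vs, ofNat_succ]

lemma vs_simp (P : SimplePolygon) : Simp P.n (vs P) := by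
  have h3 := P.three_le
  refine Simp.mk' h3 ?_ ?_ ?_
  · intro i
    rw [vs, vs, (ofNat_eq P _ _).2 (Nat.add_mod_right _ _)]
  · intro i hi e
    have := P.inj e
    rw [ofNat_eq, Nat.mod_eq_of_lt hi] at this
    rcases Nat.lt_or_ge (i + 1) P.n with h | h
    · rw [Nat.mod_eq_of_lt h] at this; omega
    · rw [show i + 1 = P.n by omega, Nat.mod_self] at this; omega
  · intro i j hij hj x hx hy
    rw [seg, vs_succ] at hx hy
    rw [vs] at hx hy
    by_cases h1 : Fin.ofNat P.n j = Fin.ofNat P.n i + 1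
    · left
      have e := h1
      rw [← ofNat_succ, ofNat_eq, Nat.mod_eq_of_lt hj, Nat.mod_eq_of_lt (by omega)] at e
      refine ⟨e, ?_⟩
      rw [h1] at hy
      have : x ∈ ({P.vtx (Fin.ofNat P.n i + 1)} : Set (ℝ × ℝ)) := by
        rw [← P.consec_edges]; exact ⟨hx, hy⟩
      rw [vs, h1]; exact this
    by_cases h2 : Fin.ofNat P.n i = Fin.ofNat P.n j + 1
    · right
      have e := h2
      rw [← ofNat_succ, ofNat_eq, Nat.mod_eq_of_lt (hij.trans hj)] at e
      have : x ∈ ({P.vtx (Fin.ofNat P.n j + 1)} : Set (ℝ × ℝ)) := by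
        rw [← P.consec_edges]
        rw [h2] at hx
        exact ⟨hy, hx⟩
      refine ⟨?_, by rw [vs, h2]; exact this⟩
      rcases Nat.lt_or_ge (j + 1) P.n with h | h
      · rw [Nat.mod_eq_of_lt h] at e; omega
      · rw [show j + 1 = P.n by omega, Nat.mod_self] at e; omega
    · exfalso
      have h0 : Fin.ofNat P.n i ≠ Fin.ofNat P.n j := by
        intro e
        rw [ofNat_eq, Nat.mod_eq_of_lt hj, Nat.mod_eq_of_lt (hij.trans hj)] at e; omega
      have : x ∈ (∅ : Set (ℝ × ℝ)) := by
        rw [← P.nonconsec_edges _ _ h0 h1 h2]; exact ⟨hx, hy⟩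
      exact this

lemma vs_ar (P : SimplePolygon) (h : P.Ccw) : 0 < ar P.n (vs P) := by
  have : ar P.n (vs P) = ∑ i : Fin P.n, SimplePolygon.cross2 (P.vtx i) (P.vtx (i + 1)) := by
    rw [ar, Finset.sum_range]
    apply Finset.sum_congr rfl
    intro i _
    rw [vs_succ, vs, ofNat_val]; rfl
  rw [this]; exact h

lemma vs_tn (P : SimplePolygon) (i : ℕ) :
    0 < tn (vs P) i ↔ P.ConvexVtx (Fin.ofNat P.n (i + 1)) := by
  have e1 : Fin.ofNat P.n (i + 1) - 1 = Fin.ofNat P.n i := by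
    rw [ofNat_succ, add_sub_cancel_right]
  rw [SimplePolygon.ConvexVtx, e1, ← ofNat_succ]; rfl

lemma boundary_iff (P : SimplePolygon) (s : ℕ) (x : ℝ × ℝ) :
    x ∈ P.boundary ↔ ∃ j < P.n, x ∈ seg (fun i => vs P (i + s)) j := by
  have S := (vs_simp P).shift s
  have hn : 0 < P.n := by have := P.three_le; omega
  have e : ∀ j, seg (fun i => vs P (i + s)) j =
      segment ℝ (P.vtx (Fin.ofNat P.n (j + s))) (P.vtx (Fin.ofNat P.n (j + s) + 1)) := by
    intro j
    rw [seg, ← vs_succ, show j + s + 1 = j + 1 + s by omega]; rfl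
  rw [SimplePolygon.boundary, Set.mem_iUnion]
  constructor
  · rintro ⟨i, hi⟩
    refine ⟨(i.val + (P.n * s - s)) % P.n, Nat.mod_lt _ hn, ?_⟩
    rw [← seg_mod S, e]
    have : Fin.ofNat P.n (i.val + (P.n * s - s) + s) = i := by
      conv_rhs => rw [← ofNat_val P i]
      rw [ofNat_eq, show i.val + (P.n * s - s) + s = i.val + P.n * s by
        have := Nat.le_mul_of_pos_left s hn; omega, Nat.add_mul_mod_self_left]
    rw [this]; exact hi
  · rintro ⟨j, -, hj⟩
    rw [e] at hj
    exact ⟨_, hj⟩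

/-- Complete normalisation of a funnel. -/
theorem normalise (P : SimplePolygon) (hF : P.IsFunnel) :
    ∃ T S, Sim T S ∧ ∃ F : FD, (∀ p, p ∈ P.region ↔ T p ∈ F.R) ∧
      ∀ p, p ∈ Set.range P.vtx ↔ F.Vx (T p) := by
  obtain ⟨hccw, b, c, hcb, hcb1, hset⟩ := hF
  have h3 := P.three_le
  have conv : ∀ i, P.ConvexVtx i ↔ i = b ∨ i = b + 1 ∨ i = c := by
    intro i
    have : i ∈ {i | P.ConvexVtx i} ↔ i ∈ ({b, b + 1, c} : Set (Fin P.n)) := by rw [hset]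
    simpa using this
  set v : ℕ → ℝ × ℝ := fun i => vs P (i + b.val) with hv
  have hS : Simp P.n v := (vs_simp P).shift b.val
  have har : 0 < ar P.n v := by
    rw [hv, ar_shift (vs_simp P)]; exact vs_ar P hccw
  have htn : ∀ i, 0 < tn v i ↔ P.ConvexVtx (Fin.ofNat P.n (i + 1 + b.val)) := by
    intro i
    rw [show i + 1 + b.val = i + b.val + 1 by omega, ← vs_tn]
    simp only [tn, hv]
    rw [show i + 1 + b.val = i + b.val + 1 by omega, show i + 2 + b.val = i + b.val + 2 by omega]
  have hbl : b.val < P.n := b.isLt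
  have hcl : c.val < P.n := c.isLt
  obtain ⟨m, hmn, hmc⟩ : ∃ m < P.n, (m + b.val) % P.n = c.val := by
    rcases Nat.lt_or_ge c.val b.val with h | h
    · refine ⟨c.val + P.n - b.val, by omega, ?_⟩
      rw [show c.val + P.n - b.val + b.val = c.val + P.n by omega, Nat.add_mod_right,
        Nat.mod_eq_of_lt hcl]
    · refine ⟨c.val - b.val, by omega, ?_⟩
      rw [show c.val - b.val + b.val = c.val by omega, Nat.mod_eq_of_lt hcl]
  have ec : c = Fin.ofNat P.n (m + b.val) := by
    apply Fin.ext; rw [Fin.val_ofNat]; exact hmc.symm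
  have eb : b = Fin.ofNat P.n (0 + b.val) := by rw [Nat.zero_add, ofNat_val]
  have eb1 : b + 1 = Fin.ofNat P.n (1 + b.val) := by rw [Nat.add_comm, ofNat_succ, ofNat_val]
  have canc : ∀ i j, Fin.ofNat P.n (i + b.val) = Fin.ofNat P.n (j + b.val) → i % P.n = j % P.n := by
    intro i j e
    rw [ofNat_eq] at e
    exact Nat.ModEq.add_right_cancel' b.val e
  have m2 : 2 ≤ m := by
    by_contra hm
    have : m = 0 ∨ m = 1 := by omega
    rcases this with rfl | rfl
    · exact hcb (ec.trans eb.symm)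
    · exact hcb1 (ec.trans eb1.symm)
  have hper : Fin.ofNat P.n (P.n + b.val) = b := by
    conv_rhs => rw [eb]
    rw [ofNat_eq, Nat.add_comm, Nat.add_mod_right, Nat.zero_add]
  obtain ⟨T, S, H, hFS⟩ := FS_of_simp (m := m) hS har m2 hmn
    ((htn 0).2 ((conv _).2 (Or.inr (Or.inl (by rw [eb1])))))
    ((htn (P.n - 1)).2 ((conv _).2 (Or.inl (by rw [show P.n - 1 + 1 = P.n by omega, hper]))))
    (by
      intro i hi i0 i1 im
      rw [← not_lt, htn, conv]
      rintro (e | e | e)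
      · conv_rhs at e => rw [eb]
        have := canc _ _ e
        rw [Nat.mod_eq_of_lt (by omega), Nat.zero_mod] at this; omega
      · rw [eb1] at e
        have := canc _ _ e
        rw [Nat.mod_eq_of_lt (by omega), Nat.mod_eq_of_lt (by omega)] at this; omega
      · rw [ec] at e
        have := canc _ _ e
        rw [Nat.mod_eq_of_lt (by omega), Nat.mod_eq_of_lt (by omega)] at this; omega)
  obtain ⟨F, ha, hb, hl, hr, cf, cg⟩ := hFS.exists_FD
  refine ⟨T, S, H, F, ?_, ?_⟩
  · apply region_iff P H F cf cg
    intro x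
    rw [boundary_iff P b.val, hFS.bd_iff F ha hb hl hr]
    constructor
    · rintro ⟨j, hj, hx⟩
      exact ⟨j, hj, (H.seg_iff _ _ _).2 hx⟩
    · rintro ⟨j, hj, hx⟩
      exact ⟨j, hj, (H.seg_iff _ _ _).1 hx⟩
  · intro p
    have inj : ∀ x y, T x = T y → x = y := by
      intro x y e
      have := congrArg S e
      rwa [H.ST, H.ST] at this
    have hvr : ∀ i, v i ∈ Set.range P.vtx := fun i => ⟨_, rfl⟩
    constructor
    · rintro ⟨i, rfl⟩
      obtain ⟨j, hj, e⟩ : ∃ j < P.n, P.vtx i = v j := by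
        refine ⟨(i.val + (P.n - b.val)) % P.n, Nat.mod_lt _ (by omega), ?_⟩
        rw [← hS.mod]
        simp only [hv, vs]
        rw [show i.val + (P.n - b.val) + b.val = i.val + P.n by omega]
        have : Fin.ofNat P.n (i.val + P.n) = i := by
          conv_rhs => rw [← ofNat_val P i]
          rw [ofNat_eq, Nat.add_mod_right]
        rw [this]
      rw [e]
      by_cases h0 : j = 0
      · left
        refine ⟨0, by omega, ?_⟩
        rw [hl, h0, Nat.sub_zero, hFS.vn]
      by_cases hm : j ≤ m
      · right
        refine ⟨j - 1, by omega, ?_⟩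
        rw [hr, show 1 + (j - 1) = j by omega]
      · left
        refine ⟨P.n - j, by omega, ?_⟩
        rw [hl, show P.n - (P.n - j) = j by omega]
    · rintro (⟨i, -, e⟩ | ⟨i, -, e⟩)
      · rw [hl] at e; rw [inj _ _ e]; exact hvr _
      · rw [hr] at e; rw [inj _ _ e]; exact hvr _

theorem final (P : SimplePolygon) (hF : P.IsFunnel)
    (m : ℕ)
    (hm : IsLeast {c : ℕ | ∃ G : Finset (ℝ × ℝ), P.GuardsAll G ∧ G.card = c} m)
    (G : Finset (ℝ × ℝ)) (k : ℕ) (χ : ℝ × ℝ → Fin k)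
    (hG : P.IsCFGuardV2P G k χ) :
    Nat.log 2 (m + 3) - 3 ≤ k := by
  classical
  obtain ⟨T, S, H, F, hR, hV⟩ := normalise P hF
  have hsee : ∀ p q, P.Sees p q ↔ F.See (T p) (T q) := by
    intro p q
    constructor
    · intro h z hz
      rw [← H.TS z] at hz ⊢
      rw [← hR]
      exact h ((H.seg_iff _ _ _).1 hz)
    · intro h z hz
      rw [hR]
      exact h ((H.seg_iff _ _ _).2 hz)
  obtain ⟨G0, h1, h2, h3⟩ := F.main (fun p => χ (S p)) (G.image T)
    (by
      intro g hg
      obtain ⟨x, hx, rfl⟩ := Finset.mem_image.1 hg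
      exact (hV x).1 (hG.1 hx))
    (by
      intro p hp
      obtain ⟨g, hg, hs, hu⟩ := hG.2 (S p) (by rw [hR, H.TS]; exact hp)
      refine ⟨T g, Finset.mem_image_of_mem _ hg, ?_, ?_⟩
      · rw [hsee, H.TS] at hs; exact hs
      · intro h' hh hne hs'
        obtain ⟨x, hx, rfl⟩ := Finset.mem_image.1 hh
        simp only [H.ST]
        refine hu x hx (fun e => hne (by rw [e])) ?_
        rw [hsee, H.TS]; exact hs')
  have hle : m ≤ (G0.image S).card := by
    apply hm.2
    refine ⟨G0.image S, ⟨?_, ?_⟩, rfl⟩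
    · intro x hx
      obtain ⟨y, hy, rfl⟩ := Finset.mem_image.1 (Finset.mem_coe.1 hx)
      rw [hV, H.TS]; exact h1 y hy
    · intro p hp
      obtain ⟨g, hg, hs⟩ := h2 (T p) ((hR p).1 hp)
      refine ⟨S g, Finset.mem_image_of_mem _ hg, ?_⟩
      rw [hsee, H.TS]; exact hs
  have hc := Finset.card_image_le (s := G0) (f := S)
  have : Nat.log 2 (m + 3) < k + 4 := Nat.log_lt_of_lt_pow (by omega) (by omega)
  omega

end FunnelLB

/-- Lower bound: every vertex-to-point conflict-free
chromatic guarding of a funnel uses at least `⌊log₂(m+3)⌋ − 3` colours,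
where `m` is the minimum number of vertex guards needed to guard all
points of the funnel. -/
theorem funnel_cf_colour_lower_bound (P : SimplePolygon) (hF : P.IsFunnel)
    (m : ℕ)
    (hm : IsLeast {c : ℕ | ∃ G : Finset (ℝ × ℝ), P.GuardsAll G ∧ G.card = c} m)
    (G : Finset (ℝ × ℝ)) (k : ℕ) (χ : ℝ × ℝ → Fin k)
    (hG : P.IsCFGuardV2P G k χ) :
    Nat.log 2 (m + 3) - 3 ≤ k := by
  exact FunnelLB.final P hF m hm G k χ hG
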